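/- Assume the nonlinearity N is of non-parabolic resonance type, i.e. P_N(f) = 0 for every f ∈ C^∞(𝕋). Let s ∈ ℕ with s ≥ 13 and let φ ∈ H^s(𝕋) be real-valued. Then there exist T > 0, which can be chosen depending only on ‖φ‖_{H^{12}} (nonincreasingly), and a real-valued solution u ∈ C([−T,T]; H^s(𝕋)) of the fifth-order equation ∂_t u + γ₀∂_x⁵u + γ₁∂_x³u + γ₂∂_x u = N(∂_x³u,∂_x²u,∂_xu,u) on [−T,T]×𝕋 (in the sense of distributions) with u(0,·) = φ. -/

import Mathlib

/- Fifth order dispersive equations on the torus 𝕋 = ℝ/2πℤ: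
   local well-posedness for non-parabolic resonance type nonlinearities. -/

namespace FifthOrderStmt0

/-- Fourier coefficient of a `2π`-periodic function `f : ℝ → ℝ`:
`f̂(k) = (1/2π) ∫_0^{2π} f(x) e^{-ikx} dx`. -/
noncomputable def fc (f : ℝ → ℝ) (k : ℤ) : ℂ :=
  (Complex.ofReal (2 * Real.pi))⁻¹ *
    ∫ x in (0:ℝ)..(2 * Real.pi), (f x : ℂ) * Complex.exp (-Complex.I * (k : ℂ) * (x : ℂ))

/-- Sobolev norm `‖f‖_{H^s} = (Σ_k (1+k²)^s |f̂(k)|²)^{1/2}`. -/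
noncomputable def hsNorm (s : ℕ) (f : ℝ → ℝ) : ℝ :=
  Real.sqrt (∑' k : ℤ, (1 + (k : ℝ) ^ 2) ^ s * ‖fc f k‖ ^ 2)

/-- `f` belongs to `H^s(𝕋)` (continuous representative, `2π`-periodic, finite `H^s` norm). -/
def MemHs (s : ℕ) (f : ℝ → ℝ) : Prop :=
  Continuous f ∧ Function.Periodic f (2 * Real.pi) ∧
    Summable (fun k : ℤ => (1 + (k : ℝ) ^ 2) ^ s * ‖fc f k‖ ^ 2)

/-- The nonlinearity `N(∂_x³f, ∂_x²f, ∂_xf, f) = Σ_j λ_j (∂_x³f)^{a_j}(∂_x²f)^{b_j}(∂_xf)^{c_j}f^{d_j}`. -/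
noncomputable def Nfun (j0 : ℕ) (lam : Fin j0 → ℝ) (a b c d : Fin j0 → ℕ)
    (f : ℝ → ℝ) (x : ℝ) : ℝ :=
  ∑ j : Fin j0, lam j * (iteratedDeriv 3 f x) ^ (a j) * (iteratedDeriv 2 f x) ^ (b j) *
    (deriv f x) ^ (c j) * (f x) ^ (d j)

/-- The functional `P_N(f) = Σ_j (λ_j b_j / 2π) ∫_𝕋 (∂_x³f)^{a_j}(∂_x²f)^{b_j-1}(∂_xf)^{c_j}f^{d_j} dx`. -/
noncomputable def PN (j0 : ℕ) (lam : Fin j0 → ℝ) (a b c d : Fin j0 → ℕ) (f : ℝ → ℝ) : ℝ :=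
  ∑ j : Fin j0, (lam j * (b j : ℝ) / (2 * Real.pi)) *
    ∫ x in (0:ℝ)..(2 * Real.pi),
      (iteratedDeriv 3 f x) ^ (a j) * (iteratedDeriv 2 f x) ^ (b j - 1) *
        (deriv f x) ^ (c j) * (f x) ^ (d j)

/-- `u` is a (distributional) solution of
`∂_t u + γ₀∂_x⁵u + γ₁∂_x³u + γ₂∂_x u = N(∂_x³u,∂_x²u,∂_xu,u)` on `[T₁,T₂] × 𝕋`:
each `u(t)` is `2π`-periodic and `C³` in `x` (so that `N(u)` is defined pointwise), and for every
smooth test function `ψ`, `2π`-periodic in `x` and compactly supported in time inside `(T₁,T₂)`,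
the integrated-by-parts identity holds. -/
def IsSolution (γ0 γ1 γ2 : ℝ) (j0 : ℕ) (lam : Fin j0 → ℝ) (a b c d : Fin j0 → ℕ)
    (T1 T2 : ℝ) (u : ℝ → ℝ → ℝ) : Prop :=
  (∀ t ∈ Set.Icc T1 T2, ContDiff ℝ 3 (u t) ∧ Function.Periodic (u t) (2 * Real.pi)) ∧
  ∀ ψ : ℝ → ℝ → ℝ, ContDiff ℝ (⊤ : ℕ∞) (Function.uncurry ψ) →
    (∀ t : ℝ, Function.Periodic (ψ t) (2 * Real.pi)) →
    (∀ t : ℝ, t ∉ Set.Ioo T1 T2 → ∀ x : ℝ, ψ t x = 0) →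
    (∫ t in T1..T2, ∫ x in (0:ℝ)..(2 * Real.pi),
      (u t x * (deriv (fun τ : ℝ => ψ τ x) t
        + γ0 * iteratedDeriv 5 (ψ t) x
        + γ1 * iteratedDeriv 3 (ψ t) x
        + γ2 * deriv (ψ t) x)
      + Nfun j0 lam a b c d (u t) x * ψ t x)) = 0

/-- `t ↦ u(t)` is continuous from `A` into `H^s(𝕋)`. -/
def ContInHs (s : ℕ) (A : Set ℝ) (u : ℝ → ℝ → ℝ) : Prop :=
  ∀ t₀ ∈ A, ∀ ε > 0, ∃ δ > 0, ∀ t ∈ A, |t - t₀| < δ →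
    hsNorm s (fun x => u t x - u t₀ x) < ε

section Periodic

open Real MeasureTheory Set
open scoped Interval

/-- Smooth `2π`-periodic functions. -/
def SmoothPer (f : ℝ → ℝ) : Prop :=
  ContDiff ℝ (⊤ : ℕ∞) f ∧ Function.Periodic f (2 * π)

/-- The `j`-th derivative in space. -/
noncomputable def dx (j : ℕ) (f : ℝ → ℝ) : ℝ → ℝ := iteratedDeriv j f

lemma dx_zero (f : ℝ → ℝ) : dx 0 f = f := iteratedDeriv_zero

lemma dx_one (f : ℝ → ℝ) : dx 1 f = deriv f := iteratedDeriv_one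

lemma dx_succ (j : ℕ) (f : ℝ → ℝ) : dx (j + 1) f = deriv (dx j f) := iteratedDeriv_succ

lemma dx_dx (i j : ℕ) (f : ℝ → ℝ) : dx i (dx j f) = dx (i + j) f := by
  simp only [dx, iteratedDeriv_eq_iterate, ← Function.iterate_add_apply]

/-- The integral over one period. -/
noncomputable def per (f : ℝ → ℝ) : ℝ := ∫ x in (0:ℝ)..(2 * π), f x

/-- The squared norm of `H^m(𝕋)`, as a sum of squared `L²` norms of derivatives. -/
noncomputable def sob (m : ℕ) (f : ℝ → ℝ) : ℝ :=
  ∑ j ∈ Finset.range (m + 1), per (fun x => dx j f x ^ 2)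

namespace SmoothPer

variable {f g : ℝ → ℝ}

lemma continuous (hf : SmoothPer f) : Continuous f := hf.1.continuous

lemma hasDerivAt_dx (hf : SmoothPer f) (j : ℕ) (x : ℝ) :
    HasDerivAt (dx j f) (dx (j + 1) f x) x := by
  have h : Differentiable ℝ (iteratedDeriv j f) :=
    hf.1.differentiable_iteratedDeriv j (by exact_mod_cast WithTop.coe_lt_top _)
  rw [dx_succ]
  exact (h x).hasDerivAt

lemma hasDerivAt (hf : SmoothPer f) (x : ℝ) : HasDerivAt f (dx 1 f x) x := by
  simpa [dx_zero] using hf.hasDerivAt_dx 0 x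

lemma deriv (hf : SmoothPer f) : SmoothPer (_root_.deriv f) := by
  refine ⟨?_, ?_⟩
  · exact ((contDiff_infty_iff_deriv (𝕜 := ℝ)).1 hf.1).2
  · intro x
    have : _root_.deriv (fun y => f (y + 2 * π)) x = _root_.deriv f x := by
      congr 1; funext y; exact hf.2 y
    rwa [deriv_comp_add_const] at this

lemma dx (hf : SmoothPer f) (j : ℕ) : SmoothPer (dx j f) := by
  induction j with
  | zero => simpa [dx_zero] using hf
  | succ j ih => simpa [dx_succ] using ih.deriv

lemma const (c : ℝ) : SmoothPer (fun _ => c) := ⟨contDiff_const, fun _ => rfl⟩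

lemma add (hf : SmoothPer f) (hg : SmoothPer g) : SmoothPer (fun x => f x + g x) :=
  ⟨hf.1.add hg.1, hf.2.add hg.2⟩

lemma sub (hf : SmoothPer f) (hg : SmoothPer g) : SmoothPer (fun x => f x - g x) :=
  ⟨hf.1.sub hg.1, hf.2.sub hg.2⟩

lemma mul (hf : SmoothPer f) (hg : SmoothPer g) : SmoothPer (fun x => f x * g x) :=
  ⟨hf.1.mul hg.1, hf.2.mul hg.2⟩

lemma const_mul (c : ℝ) (hf : SmoothPer f) : SmoothPer (fun x => c * f x) :=
  (const c).mul hf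

lemma sum {ι : Type*} {s : Finset ι} {F : ι → ℝ → ℝ} (h : ∀ i ∈ s, SmoothPer (F i)) :
    SmoothPer (fun x => ∑ i ∈ s, F i x) := by
  classical
  induction s using Finset.induction_on with
  | empty => simpa using const 0
  | insert a s ha ih =>
    simp only [Finset.sum_insert ha]
    exact (h a (by simp)).add (ih fun i hi => h i (by simp [hi]))

end SmoothPer

lemma dx_sub {f g : ℝ → ℝ} (hf : SmoothPer f) (hg : SmoothPer g) (j : ℕ) (x : ℝ) :
    dx j (fun y => f y - g y) x = dx j f x - dx j g x := by
  induction j generalizing x with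
  | zero => simp [dx_zero]
  | succ j ih =>
    have h1 := ((hf.sub hg).hasDerivAt_dx j x)
    have h2 := (hf.hasDerivAt_dx j x).sub (hg.hasDerivAt_dx j x)
    have : dx j (fun y => f y - g y) = dx j f - dx j g := by
      funext y; simpa using ih y
    rw [this] at h1
    exact h1.unique h2

section Integral

variable {f g : ℝ → ℝ}

lemma per_add (hf : Continuous f) (hg : Continuous g) :
    per (fun x => f x + g x) = per f + per g :=
  intervalIntegral.integral_add (hf.intervalIntegrable _ _) (hg.intervalIntegrable _ _)

lemma per_sub (hf : Continuous f) (hg : Continuous g) :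
    per (fun x => f x - g x) = per f - per g :=
  intervalIntegral.integral_sub (hf.intervalIntegrable _ _) (hg.intervalIntegrable _ _)

lemma per_const_mul (c : ℝ) (f : ℝ → ℝ) : per (fun x => c * f x) = c * per f :=
  intervalIntegral.integral_const_mul _ _

lemma per_const (c : ℝ) : per (fun _ => c) = 2 * π * c := by
  simp [per]

lemma per_sum {ι : Type*} {s : Finset ι} {F : ι → ℝ → ℝ} (h : ∀ i ∈ s, Continuous (F i)) :
    per (fun x => ∑ i ∈ s, F i x) = ∑ i ∈ s, per (F i) :=
  intervalIntegral.integral_finsetSum fun i hi => (h i hi).intervalIntegrable _ _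

lemma per_mono (hf : Continuous f) (hg : Continuous g) (h : ∀ x, f x ≤ g x) :
    per f ≤ per g :=
  intervalIntegral.integral_mono_on (by positivity) (hf.intervalIntegrable _ _)
    (hg.intervalIntegrable _ _) fun x _ => h x

lemma per_nonneg (h : ∀ x, 0 ≤ f x) : 0 ≤ per f :=
  intervalIntegral.integral_nonneg (by positivity) fun x _ => h x

lemma per_sq_nonneg (f : ℝ → ℝ) : 0 ≤ per (fun x => f x ^ 2) :=
  per_nonneg fun _ => sq_nonneg _

lemma per_deriv_eq_zero {F F' : ℝ → ℝ} (hF : ∀ x, HasDerivAt F (F' x) x)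
    (hF' : Continuous F') (hper : Function.Periodic F (2 * π)) : per F' = 0 := by
  rw [per, intervalIntegral.integral_eq_sub_of_hasDerivAt (fun x _ => hF x)
    (hF'.intervalIntegrable _ _)]
  simpa using sub_eq_zero.2 (hper 0)

lemma per_parts (hf : SmoothPer f) (hg : SmoothPer g) :
    per (fun x => dx 1 f x * g x) = - per (fun x => f x * dx 1 g x) := by
  have h := per_deriv_eq_zero (F := fun x => f x * g x)
    (F' := fun x => dx 1 f x * g x + f x * dx 1 g x)
    (fun x => (hf.hasDerivAt x).mul (hg.hasDerivAt x))
    (((hf.dx 1).continuous.mul hg.continuous).add (hf.continuous.mul (hg.dx 1).continuous))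
    (hf.mul hg).2
  have h' := per_add ((hf.dx 1).continuous.mul hg.continuous)
    (hf.continuous.mul (hg.dx 1).continuous)
  simp only [Pi.mul_apply] at h'
  rw [h'] at h
  exact eq_neg_of_add_eq_zero_left h

lemma sob_nonneg (m : ℕ) (f : ℝ → ℝ) : 0 ≤ sob m f :=
  Finset.sum_nonneg fun _ _ => per_sq_nonneg _

lemma per_dx_sq_le_sob {m j : ℕ} (hj : j ≤ m) (f : ℝ → ℝ) :
    per (fun x => dx j f x ^ 2) ≤ sob m f :=
  Finset.single_le_sum (f := fun j => per (fun x => dx j f x ^ 2))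
    (fun _ _ => per_sq_nonneg _) (Finset.mem_range.2 (by omega))

lemma sob_mono {m n : ℕ} (h : m ≤ n) (f : ℝ → ℝ) : sob m f ≤ sob n f :=
  Finset.sum_le_sum_of_subset_of_nonneg (Finset.range_mono (by omega))
    fun _ _ _ => per_sq_nonneg _

lemma sq_le_of_smoothPer (hf : SmoothPer f) (x : ℝ) :
    f x ^ 2 ≤ 2 * (per (fun y => f y ^ 2) + per (fun y => dx 1 f y ^ 2)) := by
  have hc := hf.continuous
  have hc1 := (hf.dx 1).continuous
  have hpi : 0 < 2 * π := by positivity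
  -- reduce to the fundamental interval
  wlog hx : x ∈ Ico 0 (2 * π) generalizing x
  · obtain ⟨y, hy, hxy⟩ := hf.2.exists_mem_Ico₀ hpi x
    rw [hxy]; exact this y hy
  have key : ∀ y ∈ Icc 0 (2 * π), f x ^ 2 ≤ f y ^ 2 +
      (per (fun y => f y ^ 2) + per (fun y => dx 1 f y ^ 2)) := by
    intro y hy
    have h1 : f x ^ 2 - f y ^ 2 = ∫ z in y..x, 2 * f z * dx 1 f z := by
      rw [intervalIntegral.integral_eq_sub_of_hasDerivAt (f := fun z => f z ^ 2)]
      · intro z _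
        refine ((hf.hasDerivAt z).pow 2).congr_deriv (by simp)
      · exact Continuous.intervalIntegrable (by fun_prop) _ _
    have h2 : ‖∫ z in y..x, 2 * f z * dx 1 f z‖ ≤
        ∫ z in Ι y x, ‖2 * f z * dx 1 f z‖ :=
      intervalIntegral.norm_integral_le_integral_norm_uIoc
    have hsub : Ι y x ⊆ Ioc 0 (2 * π) := by
      intro z hz
      rcases mem_uIoc.1 hz with h | h
      · exact ⟨hy.1.trans_lt h.1, h.2.trans hx.2.le⟩
      · exact ⟨hx.1.trans_lt h.1, h.2.trans hy.2⟩
    have hcont : Continuous fun z => f z ^ 2 + dx 1 f z ^ 2 := by fun_prop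
    have h3 : ∫ z in Ι y x, ‖2 * f z * dx 1 f z‖ ≤
        ∫ z in Ι y x, (f z ^ 2 + dx 1 f z ^ 2) := by
      apply integral_mono
      · exact (Continuous.integrableOn_uIoc (by fun_prop))
      · exact hcont.integrableOn_uIoc
      · intro z
        simp only [Real.norm_eq_abs, abs_le]
        constructor <;> nlinarith [sq_nonneg (f z - dx 1 f z), sq_nonneg (f z + dx 1 f z)]
    have h4 : ∫ z in Ι y x, (f z ^ 2 + dx 1 f z ^ 2) ≤
        ∫ z in Ioc 0 (2 * π), (f z ^ 2 + dx 1 f z ^ 2) := by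
      apply setIntegral_mono_set hcont.integrableOn_Ioc
      · exact Filter.Eventually.of_forall fun z => by positivity
      · exact hsub.eventuallyLE
    rw [← intervalIntegral.integral_of_le hpi.le] at h4
    have h5 : ∫ z in (0:ℝ)..(2 * π), (f z ^ 2 + dx 1 f z ^ 2) =
      per (fun y => f y ^ 2) + per (fun y => dx 1 f y ^ 2) :=
      per_add (f := fun z => f z ^ 2) (by fun_prop) (by fun_prop)
    have := le_abs_self (∫ z in y..x, 2 * f z * dx 1 f z)
    rw [Real.norm_eq_abs] at h2
    linarith
  have h6 : per (fun _ => f x ^ 2) ≤ per (fun y => f y ^ 2 +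
      (per (fun y => f y ^ 2) + per (fun y => dx 1 f y ^ 2))) :=
    intervalIntegral.integral_mono_on hpi.le (by simp)
      (Continuous.intervalIntegrable (by fun_prop) _ _) key
  rw [per_add (by fun_prop) (by fun_prop), per_const, per_const] at h6
  have h7 := per_sq_nonneg f
  have h8 := per_sq_nonneg (dx 1 f)
  have h9 : (1:ℝ) ≤ 2 * π := by linarith [pi_gt_three]
  have : 2 * π * f x ^ 2 ≤ 2 * π * (2 * (per (fun y => f y ^ 2) + per (fun y => dx 1 f y ^ 2))) := by
    nlinarith
  exact le_of_mul_le_mul_left this hpi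

/-- Sobolev embedding. -/
lemma dx_sq_le_sob (hf : SmoothPer f) {j m : ℕ} (h : j + 1 ≤ m) (x : ℝ) :
    dx j f x ^ 2 ≤ 2 * sob m f := by
  have h1 := sq_le_of_smoothPer (hf.dx j) x
  rw [dx_dx, add_comm 1 j] at h1
  have h2 : per (fun y => dx j f y ^ 2) + per (fun y => dx (j + 1) f y ^ 2) ≤ sob m f := by
    refine le_trans ?_ (sob_mono h f)
    rw [sob, Finset.sum_range_succ, add_le_add_iff_right]
    exact Finset.single_le_sum (f := fun j => per (fun x => dx j f x ^ 2))
      (fun _ _ => per_sq_nonneg _) (Finset.mem_range.2 (by omega))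
  linarith

end Integral

end Periodic

section Hartley

open Real MeasureTheory Set

/-- The Hartley basis `cos (kx) + sin (kx)`, orthogonal on the circle. -/
noncomputable def cas (k : ℤ) (x : ℝ) : ℝ := cos (k * x) + sin (k * x)

/-- Coefficients in the Hartley basis. -/
noncomputable def hc (f : ℝ → ℝ) (k : ℤ) : ℝ := (2 * π)⁻¹ * per (fun x => f x * cas k x)

/-- Frequencies of modulus at most `M`. -/
noncomputable def freq (M : ℕ) : Finset ℤ := Finset.Icc (-(M : ℤ)) M

/-- Trigonometric polynomial of degree `M` with Hartley coefficients `c`. -/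
noncomputable def tp (M : ℕ) (c : ℤ → ℝ) (x : ℝ) : ℝ := ∑ k ∈ freq M, c k * cas k x

/-- Fourier projection onto trigonometric polynomials of degree `M`. -/
noncomputable def proj (M : ℕ) (f : ℝ → ℝ) : ℝ → ℝ := tp M (hc f)

/-- Action of the space derivative on Hartley coefficients. -/
def hderiv (c : ℤ → ℝ) (k : ℤ) : ℝ := -k * c (-k)

lemma mem_freq {M : ℕ} {k : ℤ} : k ∈ freq M ↔ |k| ≤ M := by
  rw [freq, Finset.mem_Icc, abs_le]

lemma neg_mem_freq {M : ℕ} {k : ℤ} : -k ∈ freq M ↔ k ∈ freq M := by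
  simp [mem_freq]

lemma sum_freq_neg (M : ℕ) (F : ℤ → ℝ) : ∑ k ∈ freq M, F (-k) = ∑ k ∈ freq M, F k :=
  Finset.sum_nbij' (fun k => -k) (fun k => -k) (fun _ h => neg_mem_freq.2 h)
    (fun _ h => neg_mem_freq.2 h) (by simp) (by simp) (by simp)

lemma smoothPer_cas (k : ℤ) : SmoothPer (cas k) := by
  refine ⟨?_, fun x => ?_⟩
  · unfold cas; fun_prop
  · have h1 : (k:ℝ) * (x + 2 * π) = k * x + k * (2 * π) := by ring
    simp only [cas, h1, cos_add_int_mul_two_pi, sin_add_int_mul_two_pi]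

@[fun_prop]
lemma continuous_cas (k : ℤ) : Continuous (cas k) := (smoothPer_cas k).continuous

lemma dx_one_cas (k : ℤ) (x : ℝ) : dx 1 (cas k) x = k * cas (-k) x := by
  rw [dx_one]
  have h : HasDerivAt (cas k) (-sin (k * x) * (k * 1) + cos (k * x) * (k * 1)) x :=
    (((hasDerivAt_id x).const_mul (k:ℝ)).cos).add (((hasDerivAt_id x).const_mul (k:ℝ)).sin)
  have h1 : ((-k : ℤ) : ℝ) * x = -(k * x) := by push_cast; ring
  rw [h.deriv, cas, h1, cos_neg, sin_neg]
  ring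

lemma abs_cas_le (k : ℤ) (x : ℝ) : |cas k x| ≤ 2 := by
  refine (abs_add_le _ _).trans ?_
  linarith [abs_cos_le_one (k * x), abs_sin_le_one (k * x)]

lemma dx_succ_cas (j : ℕ) (k : ℤ) (x : ℝ) :
    dx (j + 1) (cas k) x = k * dx j (cas (-k)) x := by
  have h : dx 1 (cas k) = fun x => (k:ℝ) * cas (-k) x := funext (dx_one_cas k)
  rw [← dx_dx j 1, h]
  simp only [dx]
  rw [iteratedDeriv_const_mul_field]

lemma abs_dx_cas_le (j : ℕ) (k : ℤ) (x : ℝ) : |dx j (cas k) x| ≤ 2 * |(k:ℝ)| ^ j := by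
  induction j generalizing k with
  | zero => simpa [dx_zero] using abs_cas_le k x
  | succ j ih =>
    rw [dx_succ_cas, abs_mul, pow_succ]
    have := ih (-k)
    push_cast at this
    rw [abs_neg] at this
    nlinarith [abs_nonneg (k:ℝ)]

lemma per_cas_mul_cas (k l : ℤ) :
    per (fun x => cas k x * cas l x) = if k = l then 2 * π else 0 := by
  have hcos : ∀ m : ℤ, per (fun x => cos (m * x)) = if m = 0 then 2 * π else 0 := by
    intro m
    split_ifs with h
    · simp [h, per]
    · have hm : (m:ℝ) ≠ 0 := by exact_mod_cast h
      refine per_deriv_eq_zero (F := fun x => (m:ℝ)⁻¹ * sin (m * x)) (fun x => ?_)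
        (by fun_prop) (fun x => ?_)
      · refine ((((hasDerivAt_id x).const_mul (m:ℝ)).sin).const_mul _).congr_deriv ?_
        simp only [id]; field_simp
      · have h1 : (m:ℝ) * (x + 2 * π) = m * x + m * (2 * π) := by ring
        simp only [h1, sin_add_int_mul_two_pi]
  have hsin : ∀ m : ℤ, per (fun x => sin (m * x)) = 0 := by
    intro m
    by_cases h : m = 0
    · simp [h, per]
    · have hm : (m:ℝ) ≠ 0 := by exact_mod_cast h
      refine per_deriv_eq_zero (F := fun x => -(m:ℝ)⁻¹ * cos (m * x)) (fun x => ?_)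
        (by fun_prop) (fun x => ?_)
      · refine ((((hasDerivAt_id x).const_mul (m:ℝ)).cos).const_mul _).congr_deriv ?_
        simp only [id]; field_simp
      · have h1 : (m:ℝ) * (x + 2 * π) = m * x + m * (2 * π) := by ring
        simp only [h1, cos_add_int_mul_two_pi]
  have h : (fun x => cas k x * cas l x) =
      fun x => cos (((k - l : ℤ) : ℝ) * x) + sin (((k + l : ℤ) : ℝ) * x) := by
    funext x
    push_cast
    rw [sub_mul, add_mul, cos_sub, sin_add, cas, cas]
    ring
  rw [h, per_add (by fun_prop) (by fun_prop), hcos, hsin, add_zero]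
  simp [sub_eq_zero]

lemma smoothPer_tp (M : ℕ) (c : ℤ → ℝ) : SmoothPer (tp M c) :=
  SmoothPer.sum fun k _ => (smoothPer_cas k).const_mul (c k)

lemma smoothPer_proj (M : ℕ) (f : ℝ → ℝ) : SmoothPer (proj M f) := smoothPer_tp _ _

lemma dx_tp_eq_sum (j M : ℕ) (c : ℤ → ℝ) (x : ℝ) :
    dx j (tp M c) x = ∑ k ∈ freq M, c k * dx j (cas k) x := by
  have h : tp M c = fun x => ∑ k ∈ freq M, c k * cas k x := rfl
  rw [h, dx, iteratedDeriv_fun_sum]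
  · refine Finset.sum_congr rfl fun k _ => ?_
    rw [iteratedDeriv_const_mul_field]; rfl
  · intro k _
    exact (((smoothPer_cas k).const_mul (c k)).1.of_le (by exact_mod_cast le_top)).contDiffAt

lemma dx_one_tp (M : ℕ) (c : ℤ → ℝ) : dx 1 (tp M c) = tp M (hderiv c) := by
  funext x
  rw [dx_tp_eq_sum, tp, ← sum_freq_neg]
  refine Finset.sum_congr rfl fun k _ => ?_
  rw [dx_one_cas, hderiv]
  push_cast
  rw [neg_neg]
  ring

lemma dx_tp (j M : ℕ) (c : ℤ → ℝ) : dx j (tp M c) = tp M (hderiv^[j] c) := by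
  induction j with
  | zero => simp [dx_zero]
  | succ j ih =>
    rw [add_comm j 1, ← dx_dx 1 j, ih, dx_one_tp, add_comm 1 j, Function.iterate_succ_apply']

lemma tp_congr {M : ℕ} {c c' : ℤ → ℝ} (h : ∀ k ∈ freq M, c k = c' k) : tp M c = tp M c' := by
  funext x
  exact Finset.sum_congr rfl fun k hk => by rw [h k hk]

lemma tp_sub (M : ℕ) (c c' : ℤ → ℝ) (x : ℝ) :
    tp M (fun k => c k - c' k) x = tp M c x - tp M c' x := by
  simp only [tp, sub_mul, Finset.sum_sub_distrib]

lemma tp_extend {M M' : ℕ} (h : M ≤ M') {c : ℤ → ℝ} (hc : ∀ k ∉ freq M, c k = 0) :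
    tp M' c = tp M c := by
  funext x
  refine (Finset.sum_subset (Finset.Icc_subset_Icc (by omega) (by omega)) ?_).symm
  intro k _ hk
  rw [hc k hk, zero_mul]

lemma per_mul_tp {f : ℝ → ℝ} (hf : Continuous f) (M : ℕ) (c : ℤ → ℝ) :
    per (fun x => f x * tp M c x) = 2 * π * ∑ k ∈ freq M, hc f k * c k := by
  have h : (fun x => f x * tp M c x) = fun x => ∑ k ∈ freq M, c k * (f x * cas k x) := by
    funext x
    rw [tp, Finset.mul_sum]
    exact Finset.sum_congr rfl fun k _ => by ring
  rw [h, per_sum (fun k _ => by fun_prop), Finset.mul_sum]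
  refine Finset.sum_congr rfl fun k _ => ?_
  rw [per_const_mul, hc]
  field_simp

lemma hc_tp (M : ℕ) (c : ℤ → ℝ) (k : ℤ) : hc (tp M c) k = if k ∈ freq M then c k else 0 := by
  have h : (fun x => tp M c x * cas k x) = fun x => ∑ l ∈ freq M, c l * (cas l x * cas k x) := by
    funext x
    rw [tp, Finset.sum_mul]
    exact Finset.sum_congr rfl fun l _ => by ring
  rw [hc, h, per_sum (fun k _ => by fun_prop)]
  simp only [per_const_mul, per_cas_mul_cas, mul_ite, mul_zero, Finset.sum_ite_eq']
  split_ifs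
  · field_simp
  · simp

lemma hc_of_mem {M : ℕ} {c : ℤ → ℝ} {k : ℤ} (h : k ∈ freq M) : hc (tp M c) k = c k := by
  rw [hc_tp, if_pos h]

lemma per_tp_mul_tp (M : ℕ) (c c' : ℤ → ℝ) :
    per (fun x => tp M c x * tp M c' x) = 2 * π * ∑ k ∈ freq M, c k * c' k := by
  rw [per_mul_tp (smoothPer_tp M c).continuous]
  congr 1
  exact Finset.sum_congr rfl fun k hk => by rw [hc_of_mem hk]

lemma sum_hderiv_sq (M j : ℕ) (c : ℤ → ℝ) :
    ∑ k ∈ freq M, (hderiv^[j] c k) ^ 2 = ∑ k ∈ freq M, (k:ℝ) ^ (2 * j) * c k ^ 2 := by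
  induction j generalizing c with
  | zero => simp
  | succ j ih =>
    rw [Function.iterate_succ_apply, ih, ← sum_freq_neg]
    refine Finset.sum_congr rfl fun k _ => ?_
    rw [hderiv]
    push_cast
    rw [neg_neg, neg_neg, Even.neg_pow (even_two_mul j)]
    ring

lemma per_dx_tp_sq (M j : ℕ) (c : ℤ → ℝ) :
    per (fun x => dx j (tp M c) x ^ 2) = 2 * π * ∑ k ∈ freq M, (k:ℝ) ^ (2 * j) * c k ^ 2 := by
  rw [← sum_hderiv_sq, dx_tp]
  simp only [sq]
  exact per_tp_mul_tp M _ _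

lemma sob_tp (m M : ℕ) (c : ℤ → ℝ) :
    sob m (tp M c) =
      2 * π * ∑ k ∈ freq M, (∑ j ∈ Finset.range (m + 1), (k:ℝ) ^ (2 * j)) * c k ^ 2 := by
  simp only [sob, per_dx_tp_sq, ← Finset.mul_sum, Finset.sum_mul]
  rw [Finset.sum_comm]

lemma geom_le_weight (m : ℕ) (k : ℝ) :
    ∑ j ∈ Finset.range (m + 1), k ^ (2 * j) ≤ (1 + k ^ 2) ^ m := by
  rw [add_comm (1:ℝ), add_pow]
  refine Finset.sum_le_sum fun j hj => ?_
  rw [← pow_mul, one_pow, mul_one]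
  have h1 : (1:ℝ) ≤ (m.choose j : ℝ) := by
    exact_mod_cast Nat.choose_pos (by simpa [Nat.lt_succ_iff] using hj)
  have h2 : 0 ≤ k ^ (2 * j) := Even.pow_nonneg (even_two_mul j) k
  nlinarith

lemma weight_le_geom (m : ℕ) (k : ℝ) :
    (1 + k ^ 2) ^ m ≤ 2 ^ m * ∑ j ∈ Finset.range (m + 1), k ^ (2 * j) := by
  rw [add_comm (1:ℝ), add_pow, Finset.mul_sum]
  refine Finset.sum_le_sum fun j hj => ?_
  rw [← pow_mul, one_pow, mul_one, mul_comm]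
  have h1 : (m.choose j : ℝ) ≤ 2 ^ m := by
    have := Nat.choose_le_two_pow m j
    exact_mod_cast this
  have h2 : 0 ≤ k ^ (2 * j) := Even.pow_nonneg (even_two_mul j) k
  exact mul_le_mul_of_nonneg_right h1 h2

/-- Top and bottom derivatives control all intermediate ones for trigonometric polynomials. -/
lemma sob_tp_le (m M : ℕ) (c : ℤ → ℝ) :
    sob m (tp M c) ≤ (m + 1) * (per (fun x => tp M c x ^ 2) +
      per (fun x => dx m (tp M c) x ^ 2)) := by
  have h0 := per_dx_tp_sq M 0 c
  rw [dx_zero] at h0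
  have e : ((m:ℝ) + 1) * (2 * π * ∑ k ∈ freq M, (k:ℝ) ^ (2 * 0) * c k ^ 2 +
      2 * π * ∑ k ∈ freq M, (k:ℝ) ^ (2 * m) * c k ^ 2) = 2 * π * ∑ k ∈ freq M,
        (m + 1) * ((k:ℝ) ^ (2 * 0) + (k:ℝ) ^ (2 * m)) * c k ^ 2 := by
    rw [← mul_add, ← Finset.sum_add_distrib, mul_left_comm, Finset.mul_sum _ _ ((m:ℝ) + 1)]
    congr 1
    exact Finset.sum_congr rfl fun k _ => by ring
  rw [sob_tp, h0, per_dx_tp_sq, e]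
  have h2 : 0 ≤ 2 * π := by positivity
  refine mul_le_mul_of_nonneg_left (Finset.sum_le_sum fun k _ => ?_) h2
  refine mul_le_mul_of_nonneg_right ?_ (sq_nonneg _)
  have : ∀ j ∈ Finset.range (m + 1), (k:ℝ) ^ (2 * j) ≤ (k:ℝ) ^ (2 * 0) + (k:ℝ) ^ (2 * m) := by
    intro j hj
    simp only [pow_mul, pow_zero]
    have hk : 0 ≤ (k:ℝ) ^ 2 := sq_nonneg _
    have hm : 0 ≤ ((k:ℝ) ^ 2) ^ m := pow_nonneg hk m
    rcases le_total ((k:ℝ) ^ 2) 1 with h | h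
    · have hj : ((k:ℝ) ^ 2) ^ j ≤ 1 := pow_le_one₀ hk h
      linarith
    · linarith [pow_le_pow_right₀ h (Nat.lt_succ_iff.1 (Finset.mem_range.1 hj))]
  calc _ ≤ ∑ j ∈ Finset.range (m + 1), ((k:ℝ) ^ (2 * 0) + (k:ℝ) ^ (2 * m)) :=
        Finset.sum_le_sum this
    _ = _ := by simp; ring

lemma fc_eq {f : ℝ → ℝ} (hf : Continuous f) (k : ℤ) :
    fc f k = (((hc f k + hc f (-k)) / 2 : ℝ) : ℂ) -
      Complex.I * (((hc f k - hc f (-k)) / 2 : ℝ) : ℂ) := by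
  have e1 : (hc f k + hc f (-k)) / 2 = (2 * π)⁻¹ * per (fun x => f x * cos (k * x)) := by
    rw [hc, hc, ← mul_add, ← per_add (by fun_prop) (by fun_prop), mul_div_assoc]
    congr 1
    rw [div_eq_inv_mul, ← per_const_mul]
    congr 1; funext x
    simp only [cas]; push_cast
    rw [neg_mul, cos_neg, sin_neg]; ring
  have e2 : (hc f k - hc f (-k)) / 2 = (2 * π)⁻¹ * per (fun x => f x * sin (k * x)) := by
    rw [hc, hc, ← mul_sub, ← per_sub (by fun_prop) (by fun_prop), mul_div_assoc]
    congr 1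
    rw [div_eq_inv_mul, ← per_const_mul]
    congr 1; funext x
    simp only [cas]; push_cast
    rw [neg_mul, cos_neg, sin_neg]; ring
  rw [e1, e2, fc, per, per]
  push_cast
  rw [← intervalIntegral.integral_ofReal, ← intervalIntegral.integral_ofReal, mul_left_comm,
    ← mul_sub, ← intervalIntegral.integral_const_mul Complex.I, ← intervalIntegral.integral_sub]
  · congr 1
    refine intervalIntegral.integral_congr fun x _ => ?_
    have : -Complex.I * (k:ℂ) * (x:ℂ) = (((-(k * x) : ℝ)) : ℂ) * Complex.I := by
      push_cast; ring
    rw [this, Complex.exp_mul_I, ← Complex.ofReal_cos, ← Complex.ofReal_sin, cos_neg, sin_neg]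
    push_cast; ring
  · exact Continuous.intervalIntegrable (by fun_prop) _ _
  · exact Continuous.intervalIntegrable (by fun_prop) _ _

lemma norm_fc_sq {f : ℝ → ℝ} (hf : Continuous f) (k : ℤ) :
    ‖fc f k‖ ^ 2 = (hc f k ^ 2 + hc f (-k) ^ 2) / 2 := by
  rw [fc_eq hf, Complex.sq_norm, Complex.normSq_apply]
  simp only [Complex.sub_re, Complex.ofReal_re, Complex.mul_re, Complex.I_re, Complex.I_im,
    Complex.ofReal_im, Complex.sub_im, Complex.mul_im]
  ring

lemma hasSum_weight_fc {f : ℝ → ℝ} (hf : Continuous f) {ω : ℤ → ℝ}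
    (hω : ∀ k, ω (-k) = ω k) {S : ℝ} (h : HasSum (fun k => ω k * hc f k ^ 2) S) :
    HasSum (fun k => ω k * ‖fc f k‖ ^ 2) S := by
  have h' : HasSum (fun k => ω k * hc f (-k) ^ 2) S := by
    have := (Equiv.neg ℤ).hasSum_iff.2 h
    simpa [Function.comp_def, hω] using this
  have h2 := (h.add h').div_const 2
  rw [add_self_div_two] at h2
  have e : (fun k => ω k * ‖fc f k‖ ^ 2) =
      fun k => (ω k * hc f k ^ 2 + ω k * hc f (-k) ^ 2) / 2 := by
    funext k; rw [norm_fc_sq hf]; ring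
  rwa [e]

lemma summable_weight_hc {f : ℝ → ℝ} (hf : Continuous f) {ω : ℤ → ℝ} (hω0 : ∀ k, 0 ≤ ω k)
    (h : Summable (fun k => ω k * ‖fc f k‖ ^ 2)) : Summable (fun k => ω k * hc f k ^ 2) := by
  refine Summable.of_nonneg_of_le (fun k => mul_nonneg (hω0 k) (sq_nonneg _)) (fun k => ?_)
    (h.mul_left 2)
  rw [norm_fc_sq hf]
  nlinarith [mul_nonneg (hω0 k) (sq_nonneg (hc f (-k)))]

end Hartley

section Parseval

open Real MeasureTheory Set

lemma hc_dx_one {f : ℝ → ℝ} (hf : SmoothPer f) (k : ℤ) : hc (dx 1 f) k = hderiv (hc f) k := by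
  rw [hderiv, hc, hc, per_parts hf (smoothPer_cas k)]
  simp only [dx_one_cas, mul_left_comm _ (k:ℝ), per_const_mul]
  ring

lemma hc_dx {f : ℝ → ℝ} (hf : SmoothPer f) (j : ℕ) : hc (dx j f) = hderiv^[j] (hc f) := by
  induction j with
  | zero => simp [dx_zero]
  | succ j ih =>
    funext k
    rw [add_comm j 1, ← dx_dx 1 j, hc_dx_one (hf.dx j), ih, add_comm 1 j,
      Function.iterate_succ_apply']

lemma dx_proj {f : ℝ → ℝ} (hf : SmoothPer f) (j M : ℕ) : dx j (proj M f) = proj M (dx j f) := by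
  rw [proj, dx_tp, proj, hc_dx hf]

lemma fc_eq_fourierCoeffOn (f : ℝ → ℝ) (k : ℤ) :
    fc f k = fourierCoeffOn two_pi_pos (fun x => (f x : ℂ)) k := by
  rw [fourierCoeffOn_eq_integral, fc, Complex.real_smul]
  congr 1
  · push_cast; simp
  · refine intervalIntegral.integral_congr fun x _ => ?_
    simp only [fourier_coe_apply, smul_eq_mul]
    rw [mul_comm]
    congr 2
    push_cast
    have : (π : ℂ) ≠ 0 := by exact_mod_cast pi_ne_zero
    field_simp
    ring

lemma hasSum_norm_fc_sq {f : ℝ → ℝ} (hf : Continuous f) :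
    HasSum (fun k => ‖fc f k‖ ^ 2) ((2 * π)⁻¹ * per (fun x => f x ^ 2)) := by
  have hL : MemLp (fun x => (f x : ℂ)) 2 (volume.restrict (Ioc 0 (2 * π))) := by
    have hc : Continuous fun x => (f x : ℂ) := by fun_prop
    obtain ⟨C, hC⟩ := isCompact_Icc.exists_bound_of_continuousOn (hc.continuousOn (s := Icc 0 (2 * π)))
    refine MemLp.of_bound hc.aestronglyMeasurable C ?_
    exact (ae_restrict_iff' measurableSet_Ioc).2 (.of_forall fun x hx => hC x ⟨hx.1.le, hx.2⟩)
  have h := hasSum_sq_fourierCoeffOn two_pi_pos hL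
  simpa [fc_eq_fourierCoeffOn, per] using h

/-- Parseval's identity in the Hartley basis. -/
lemma hasSum_hc_sq {f : ℝ → ℝ} (hf : Continuous f) :
    HasSum (fun k => hc f k ^ 2) ((2 * π)⁻¹ * per (fun x => f x ^ 2)) := by
  have h := hasSum_norm_fc_sq hf
  have h1 : Summable fun k => hc f k ^ 2 := by
    simpa using summable_weight_hc hf (ω := fun _ => 1) (by simp) (by simpa using h.summable)
  have h2 := hasSum_weight_fc hf (ω := fun _ => 1) (by simp) (by simpa using h1.hasSum)
  rw [h.unique (by simpa using h2)]
  exact h1.hasSum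

lemma eq_zero_of_per_sq {f : ℝ → ℝ} (hf : Continuous f) (hp : Function.Periodic f (2 * π))
    (h : per (fun x => f x ^ 2) = 0) (x : ℝ) : f x = 0 := by
  have hI : ∀ y ∈ Icc 0 (2 * π), f y = 0 := by
    intro y hy
    by_contra hne
    have := intervalIntegral.integral_pos two_pi_pos (f := fun x => f x ^ 2) (by fun_prop)
      (fun x _ => sq_nonneg _) ⟨y, hy, by positivity⟩
    exact this.ne' h
  obtain ⟨y, hy, e⟩ := hp.exists_mem_Ico₀ two_pi_pos x
  rw [e]
  exact hI y ⟨hy.1, hy.2.le⟩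

lemma eq_of_hc_eq {f g : ℝ → ℝ} (hf : Continuous f) (hg : Continuous g)
    (hfp : Function.Periodic f (2 * π)) (hgp : Function.Periodic g (2 * π))
    (h : ∀ k, hc f k = hc g k) : f = g := by
  have hs : ∀ k, hc (fun x => f x - g x) k = 0 := by
    intro k
    have := h k
    simp only [hc, sub_mul] at this ⊢
    rw [per_sub (by fun_prop) (by fun_prop), mul_sub, this, sub_self]
  have h1 := hasSum_hc_sq (hf.sub hg)
  have h2 : HasSum (fun k => hc (f - g) k ^ 2) 0 := by
    have e : (fun k => hc (f - g) k ^ 2) = fun _ => 0 := by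
      funext k
      have := hs k
      change hc (fun x => f x - g x) k ^ 2 = 0
      rw [this]; ring
    rw [e]; exact hasSum_zero
  have h3 := h1.unique h2
  have h4 : per (fun x => (f x - g x) ^ 2) = 0 := by
    have := two_pi_pos
    rcases mul_eq_zero.1 h3 with h | h
    · exact absurd h (by positivity)
    · exact h
  funext x
  exact sub_eq_zero.1 (eq_zero_of_per_sq (hf.sub hg) (hfp.sub hgp) h4 x)

lemma hc_sub {f g : ℝ → ℝ} (hf : Continuous f) (hg : Continuous g) (k : ℤ) :
    hc (fun x => f x - g x) k = hc f k - hc g k := by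
  simp only [hc, sub_mul]
  rw [per_sub (by fun_prop) (by fun_prop), mul_sub]

lemma per_sub_proj_mul_tp {f : ℝ → ℝ} (hf : Continuous f) (M : ℕ) (c : ℤ → ℝ) :
    per (fun x => (f x - proj M f x) * tp M c x) = 0 := by
  have hp := (smoothPer_proj M f).continuous
  rw [per_mul_tp (by fun_prop)]
  refine mul_eq_zero_of_right _ (Finset.sum_eq_zero fun k hk => ?_)
  rw [hc_sub hf hp, proj, hc_of_mem hk]
  ring

lemma per_sq_eq_proj_add {f : ℝ → ℝ} (hf : Continuous f) (M : ℕ) :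
    per (fun x => f x ^ 2) =
      per (fun x => proj M f x ^ 2) + per (fun x => (f x - proj M f x) ^ 2) := by
  have hp := (smoothPer_proj M f).continuous
  have h0 := per_sub_proj_mul_tp hf M (hc f)
  change per (fun x => (f x - proj M f x) * proj M f x) = 0 at h0
  have e : (fun x => f x ^ 2) = fun x => proj M f x ^ 2 + (f x - proj M f x) ^ 2 +
      2 * ((f x - proj M f x) * proj M f x) := by funext x; ring
  rw [e, per_add (by fun_prop) (by fun_prop), per_add (by fun_prop) (by fun_prop),
    per_const_mul, h0]
  ring

lemma per_proj_sq_le {f : ℝ → ℝ} (hf : Continuous f) (M : ℕ) :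
    per (fun x => proj M f x ^ 2) ≤ per (fun x => f x ^ 2) := by
  rw [per_sq_eq_proj_add hf M]
  linarith [per_sq_nonneg (fun x => f x - proj M f x)]

/-- High frequencies are controlled by the derivative. -/
lemma per_sub_proj_sq_le_dx {f : ℝ → ℝ} (hf : SmoothPer f) (M : ℕ) :
    (M + 1) ^ 2 * per (fun x => (f x - proj M f x) ^ 2) ≤ per (fun x => dx 1 f x ^ 2) := by
  have hp := smoothPer_proj M f
  have h1 := hasSum_hc_sq (hf.sub hp).continuous
  have h2 := hasSum_hc_sq (hf.dx 1).continuous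
  have h3 := (Equiv.neg ℤ).hasSum_iff.2 h2
  have h4 := hasSum_le (fun k => ?_) (h1.mul_left (((M:ℝ) + 1) ^ 2)) h3
  · rw [mul_left_comm] at h4
    exact le_of_mul_le_mul_left h4 (by positivity)
  simp only [Function.comp, Equiv.neg_apply]
  rw [hc_dx_one hf, hderiv, neg_neg, hc_sub hf.continuous hp.continuous, proj, hc_tp]
  split_ifs with h
  · rw [sub_self, zero_pow two_ne_zero, mul_zero]; positivity
  · rw [mem_freq, not_le] at h
    have h5 : ((M:ℝ) + 1) ≤ |(k:ℝ)| := by exact_mod_cast h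
    rw [sub_zero, mul_pow]
    refine mul_le_mul_of_nonneg_right ?_ (sq_nonneg _)
    push_cast
    rw [neg_neg, ← sq_abs (k:ℝ)]
    exact pow_le_pow_left₀ (by positivity) h5 2

lemma per_sub_proj_mul {f g : ℝ → ℝ} (hf : Continuous f) (hg : Continuous g) (M : ℕ) :
    per (fun x => (f x - proj M f x) * g x) = per (fun x => f x * (g x - proj M g x)) := by
  have hp := (smoothPer_proj M f).continuous
  have hq := (smoothPer_proj M g).continuous
  have h1 := per_sub_proj_mul_tp hf M (hc g)
  have h2 := per_sub_proj_mul_tp hg M (hc f)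
  change per (fun x => (f x - proj M f x) * proj M g x) = 0 at h1
  change per (fun x => (g x - proj M g x) * proj M f x) = 0 at h2
  have e : (fun x => (f x - proj M f x) * g x) = fun x => f x * (g x - proj M g x) +
      (f x - proj M f x) * proj M g x - (g x - proj M g x) * proj M f x := by
    funext x; ring
  rw [e, per_sub (by fun_prop) (by fun_prop), per_add (by fun_prop) (by fun_prop), h1, h2]
  ring

end Parseval

section DiffPoly

open Real MeasureTheory Set

/-- Differential polynomial in a function, `X i` standing for the `i`-th space derivative. -/
noncomputable def ev (p : MvPolynomial ℕ ℝ) (f : ℝ → ℝ) (x : ℝ) : ℝ :=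
  MvPolynomial.eval (fun i => dx i f x) p

/-- The total space derivative of differential polynomials. -/
noncomputable def DX : Derivation ℝ (MvPolynomial ℕ ℝ) (MvPolynomial ℕ ℝ) :=
  MvPolynomial.mkDerivation ℝ fun i => MvPolynomial.X (i + 1)

/-- Differential polynomials of order at most `m`. -/
noncomputable abbrev ordLE (m : ℕ) : Subalgebra ℝ (MvPolynomial ℕ ℝ) :=
  MvPolynomial.supported ℝ (Iic m)

open MvPolynomial (X C pderiv)

@[simp] lemma DX_X (i : ℕ) : DX (X i) = X (i + 1) := MvPolynomial.mkDerivation_X _ _ _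

section ev

variable (p q : MvPolynomial ℕ ℝ) (f : ℝ → ℝ) (x : ℝ)

@[simp] lemma ev_add : ev (p + q) f x = ev p f x + ev q f x := map_add _ _ _
@[simp] lemma ev_mul : ev (p * q) f x = ev p f x * ev q f x := map_mul _ _ _
@[simp] lemma ev_X (i : ℕ) : ev (X i) f x = dx i f x := MvPolynomial.eval_X _
@[simp] lemma ev_C (r : ℝ) : ev (C r) f x = r := MvPolynomial.eval_C _

lemma ev_sum {ι : Type*} (s : Finset ι) (P : ι → MvPolynomial ℕ ℝ) :
    ev (∑ i ∈ s, P i) f x = ∑ i ∈ s, ev (P i) f x := map_sum _ _ _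

end ev

lemma smoothPer_ev (p : MvPolynomial ℕ ℝ) {f : ℝ → ℝ} (hf : SmoothPer f) : SmoothPer (ev p f) := by
  induction p using MvPolynomial.induction_on with
  | C r =>
    have e : ev (C r) f = fun _ => r := funext fun x => ev_C f x r
    rw [e]; exact SmoothPer.const r
  | add p q hp hq =>
    have e : ev (p + q) f = fun x => ev p f x + ev q f x := funext fun x => ev_add p q f x
    rw [e]; exact hp.add hq
  | mul_X p i hp =>
    have e : ev (p * X i) f = fun x => ev p f x * dx i f x := by funext x; simp
    rw [e]; exact hp.mul (hf.dx i)

lemma hasDerivAt_ev (p : MvPolynomial ℕ ℝ) {f : ℝ → ℝ} (hf : SmoothPer f) (x : ℝ) :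
    HasDerivAt (ev p f) (ev (DX p) f x) x := by
  induction p using MvPolynomial.induction_on with
  | C r =>
    have e : ev (C r) f = fun _ => r := funext fun x => ev_C f x r
    have e2 : DX (C r) = 0 := DX.map_algebraMap r
    rw [e, e2]; simpa [ev] using hasDerivAt_const x r
  | add p q hp hq =>
    have e : ev (p + q) f = fun x => ev p f x + ev q f x := funext fun x => ev_add p q f x
    rw [e, map_add, ev_add]; exact hp.add hq
  | mul_X p i hp =>
    have e : ev (p * X i) f = fun x => ev p f x * dx i f x := by funext x; simp
    rw [e, Derivation.leibniz]
    refine (hp.mul (hf.hasDerivAt_dx i x)).congr_deriv ?_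
    simp only [smul_eq_mul, DX_X, ev_add, ev_mul, ev_X]
    ring

lemma dx_ev (p : MvPolynomial ℕ ℝ) {f : ℝ → ℝ} (hf : SmoothPer f) (j : ℕ) :
    dx j (ev p f) = ev (DX^[j] p) f := by
  induction j with
  | zero => simp [dx_zero]
  | succ j ih =>
    funext x
    rw [dx_succ, ih, Function.iterate_succ_apply', (hasDerivAt_ev _ hf x).deriv]

lemma X_mem_ordLE {i m : ℕ} (h : i ≤ m) : (X i : MvPolynomial ℕ ℝ) ∈ ordLE m :=
  Algebra.subset_adjoin ⟨i, h, rfl⟩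

lemma ordLE_mono {m n : ℕ} (h : m ≤ n) {p : MvPolynomial ℕ ℝ} (hp : p ∈ ordLE m) : p ∈ ordLE n :=
  MvPolynomial.supported_mono (Iic_subset_Iic.2 h) hp

lemma mem_ordLE_induction {m : ℕ} {P : MvPolynomial ℕ ℝ → Prop} (hC : ∀ r, P (C r))
    (hX : ∀ i ≤ m, P (X i)) (hadd : ∀ p q, P p → P q → P (p + q))
    (hmul : ∀ p q, P p → P q → P (p * q)) {p : MvPolynomial ℕ ℝ} (hp : p ∈ ordLE m) : P p := by
  refine Algebra.adjoin_induction (p := fun p _ => P p) ?_ hC (fun p q _ _ => hadd p q)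
    (fun p q _ _ => hmul p q) hp
  rintro _ ⟨i, hi, rfl⟩
  exact hX i hi

lemma derivation_sum_apply {ι : Type*} (s : Finset ι)
    (D : ι → Derivation ℝ (MvPolynomial ℕ ℝ) (MvPolynomial ℕ ℝ)) (p : MvPolynomial ℕ ℝ) :
    (∑ i ∈ s, D i) p = ∑ i ∈ s, D i p := by
  classical
  induction s using Finset.induction_on with
  | empty => simp
  | insert i s hi ih => rw [Finset.sum_insert hi, Finset.sum_insert hi, Derivation.add_apply, ih]

/-- The chain rule: a derivation is determined by its values on the variables. -/
lemma derivation_eq_sum {m : ℕ} (D : Derivation ℝ (MvPolynomial ℕ ℝ) (MvPolynomial ℕ ℝ))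
    {p : MvPolynomial ℕ ℝ} (hp : p ∈ ordLE m) :
    D p = ∑ i ∈ Finset.range (m + 1), D (X i) * pderiv i p := by
  have h := Derivation.eqOn_adjoin (s := X '' Iic m) (D1 := D)
    (D2 := ∑ i ∈ Finset.range (m + 1), D (X i) • pderiv (R := ℝ) i) ?_ hp
  · rw [h]
    rw [derivation_sum_apply]
    rfl
  rintro _ ⟨i, hi, rfl⟩
  simp only [mem_Iic] at hi
  rw [derivation_sum_apply]
  simp only [Derivation.smul_apply, smul_eq_mul, MvPolynomial.pderiv_X]
  rw [Finset.sum_eq_single i]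
  · simp
  · intro j _ hj
    simp [hj.symm]
  · intro h
    exact absurd (Finset.mem_range.2 (by omega)) h

lemma DX_mem {m : ℕ} {p : MvPolynomial ℕ ℝ} (hp : p ∈ ordLE m) : DX p ∈ ordLE (m + 1) := by
  have h : p ∈ ordLE (m + 1) ∧ DX p ∈ ordLE (m + 1) := by
    refine mem_ordLE_induction (P := fun p => p ∈ ordLE (m + 1) ∧ DX p ∈ ordLE (m + 1))
      ?_ ?_ ?_ ?_ hp
    · intro r
      refine ⟨Subalgebra.algebraMap_mem _ r, ?_⟩
      rw [show DX (C r) = 0 from DX.map_algebraMap r]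
      exact Subalgebra.zero_mem _
    · intro i hi
      exact ⟨X_mem_ordLE (by omega), by rw [DX_X]; exact X_mem_ordLE (by omega)⟩
    · rintro p q ⟨hp, hp'⟩ ⟨hq, hq'⟩
      exact ⟨add_mem hp hq, by rw [map_add]; exact add_mem hp' hq'⟩
    · rintro p q ⟨hp, hp'⟩ ⟨hq, hq'⟩
      refine ⟨mul_mem hp hq, ?_⟩
      rw [Derivation.leibniz]
      exact add_mem (mul_mem hp hq') (mul_mem hq hp')
  exact h.2

lemma iterate_DX_mem {m : ℕ} {p : MvPolynomial ℕ ℝ} (hp : p ∈ ordLE m) (j : ℕ) :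
    DX^[j] p ∈ ordLE (m + j) := by
  induction j with
  | zero => simpa using hp
  | succ j ih => rw [Function.iterate_succ_apply']; exact DX_mem ih

lemma pderiv_mem {m : ℕ} (i : ℕ) {p : MvPolynomial ℕ ℝ} (hp : p ∈ ordLE m) :
    pderiv i p ∈ ordLE m := by
  have h : p ∈ ordLE m ∧ pderiv i p ∈ ordLE m := by
    refine mem_ordLE_induction (P := fun p => p ∈ ordLE m ∧ pderiv i p ∈ ordLE m) ?_ ?_ ?_ ?_ hp
    · intro r
      exact ⟨Subalgebra.algebraMap_mem _ r, by simp⟩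
    · intro j hj
      refine ⟨X_mem_ordLE hj, ?_⟩
      rw [MvPolynomial.pderiv_X, Pi.single_apply]
      split_ifs
      · exact one_mem _
      · exact zero_mem _
    · rintro p q ⟨hp, hp'⟩ ⟨hq, hq'⟩
      exact ⟨add_mem hp hq, by rw [map_add]; exact add_mem hp' hq'⟩
    · rintro p q ⟨hp, hp'⟩ ⟨hq, hq'⟩
      refine ⟨mul_mem hp hq, ?_⟩
      rw [Derivation.leibniz]
      exact add_mem (mul_mem hp hq') (mul_mem hq hp')
  exact h.2

lemma pderiv_eq_zero {m i : ℕ} (h : m < i) {p : MvPolynomial ℕ ℝ} (hp : p ∈ ordLE m) :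
    pderiv i p = 0 := by
  rw [derivation_eq_sum (pderiv i) hp]
  refine Finset.sum_eq_zero fun j hj => ?_
  have : j ≠ i := by have := Finset.mem_range.1 hj; omega
  rw [MvPolynomial.pderiv_X_of_ne this, zero_mul]

/-- A polynomial none of whose derivatives of order `≥ n` survives has order less than `n`. -/
lemma mem_ordLE_of_pderiv {n : ℕ} {p : MvPolynomial ℕ ℝ}
    (h : ∀ m, n < m → pderiv m p = 0) : p ∈ ordLE n := by
  rw [MvPolynomial.mem_supported]
  intro i hi
  by_contra hin
  obtain ⟨d, hd, hdi⟩ := MvPolynomial.mem_vars_iff_mem_support i |>.1 (by simpa using hi)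
  have h1 : d i ≠ 0 := by simpa using hdi
  have h2 := congrArg (MvPolynomial.coeff (d - Finsupp.single i 1)) (h i (by simpa using hin))
  have h3 : d - Finsupp.single i 1 + Finsupp.single i 1 = d := by
    refine tsub_add_cancel_of_le ?_
    rw [Finsupp.single_le_iff]; omega
  rw [MvPolynomial.coeff_pderiv, h3, MvPolynomial.coeff_zero] at h2
  rcases mul_eq_zero.1 h2 with h | h
  · exact (MvPolynomial.mem_support_iff.1 hd) h
  · have : (0:ℝ) ≤ ((d - Finsupp.single i 1 : ℕ →₀ ℕ) i : ℝ) := by positivity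
    linarith

lemma pderiv_succ_DX (m : ℕ) (p : MvPolynomial ℕ ℝ) :
    pderiv (m + 1) (DX p) = DX (pderiv (m + 1) p) + pderiv m p := by
  have h : ⁅pderiv (R := ℝ) (m + 1), DX⁆ = pderiv m := by
    refine MvPolynomial.derivation_ext fun i => ?_
    rw [Derivation.commutator_apply, DX_X, MvPolynomial.pderiv_X, MvPolynomial.pderiv_X,
      MvPolynomial.pderiv_X]
    have : DX (Pi.single (M := fun _ => MvPolynomial ℕ ℝ) (m + 1) 1 i) = 0 := by
      rw [Pi.single_apply]; split_ifs <;> simp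
    rw [this, sub_zero, Pi.single_apply, Pi.single_apply]
    simp
  have h2 := congrArg (fun D => D p) h
  simp only [Derivation.commutator_apply] at h2
  rw [← h2]; ring

end DiffPoly

section Expansion

open Real MeasureTheory Set
open MvPolynomial (X C pderiv)

lemma pderiv_iterate_DX_eq_zero {N : MvPolynomial ℕ ℝ} (hN : N ∈ ordLE 3) {n m : ℕ}
    (h : n + 3 < m) : pderiv m (DX^[n] N) = 0 :=
  pderiv_eq_zero (by omega) (iterate_DX_mem hN n)

lemma pderiv_add_three {N : MvPolynomial ℕ ℝ} (hN : N ∈ ordLE 3) (n : ℕ) :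
    pderiv (n + 3) (DX^[n] N) = pderiv 3 N := by
  induction n with
  | zero => simp
  | succ n ih =>
    rw [Function.iterate_succ_apply', show n + 1 + 3 = n + 3 + 1 by ring, pderiv_succ_DX, ih,
      pderiv_iterate_DX_eq_zero hN (by omega), map_zero, zero_add]

lemma pderiv_add_two {N : MvPolynomial ℕ ℝ} (hN : N ∈ ordLE 3) (n : ℕ) :
    pderiv (n + 2) (DX^[n] N) = pderiv 2 N + (n : ℝ) • DX (pderiv 3 N) := by
  induction n with
  | zero => simp
  | succ n ih =>
    rw [Function.iterate_succ_apply', show n + 1 + 2 = n + 2 + 1 by ring, pderiv_succ_DX, ih,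
      pderiv_add_three hN]
    push_cast
    rw [add_smul, one_smul]
    abel

lemma pderiv_add_one_mem {N : MvPolynomial ℕ ℝ} (hN : N ∈ ordLE 3) (n : ℕ) :
    pderiv (n + 1) (DX^[n] N) ∈ ordLE 5 := by
  induction n with
  | zero => exact ordLE_mono (by omega) (pderiv_mem _ hN)
  | succ n ih =>
    rw [Function.iterate_succ_apply', show n + 1 + 1 = n + 1 + 1 by ring, pderiv_succ_DX]
    refine add_mem ?_ ih
    rw [show n + 1 + 1 = n + 2 by ring, pderiv_add_two hN]
    refine DX_mem (m := 4) (add_mem (ordLE_mono (by omega) (pderiv_mem _ hN)) ?_)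
    exact Subalgebra.smul_mem _ (DX_mem (pderiv_mem _ hN)) _

lemma pderiv_iterate_mem {N : MvPolynomial ℕ ℝ} (hN : N ∈ ordLE 3) (n : ℕ) :
    pderiv n (DX^[n] N) ∈ ordLE 6 := by
  induction n with
  | zero => exact ordLE_mono (by omega) (pderiv_mem _ hN)
  | succ n ih =>
    rw [Function.iterate_succ_apply', pderiv_succ_DX]
    exact add_mem (DX_mem (pderiv_add_one_mem hN n)) ih

/-- Structure of the top order terms in the derivatives of the nonlinearity. -/
lemma iterate_DX_expansion {N : MvPolynomial ℕ ℝ} (hN : N ∈ ordLE 3) {n : ℕ} (hn : 7 ≤ n) :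
    ∃ c1 ∈ ordLE 5, ∃ c0 ∈ ordLE 6, ∃ Q ∈ ordLE (n - 1),
      DX^[n] N = pderiv 3 N * X (n + 3) + (pderiv 2 N + (n : ℝ) • DX (pderiv 3 N)) * X (n + 2) +
        c1 * X (n + 1) + c0 * X n + Q := by
  have hA : pderiv 3 N ∈ ordLE 6 := ordLE_mono (by omega) (pderiv_mem _ hN)
  have hB : pderiv 2 N + (n : ℝ) • DX (pderiv 3 N) ∈ ordLE 6 :=
    ordLE_mono (m := 4) (by omega) (add_mem (ordLE_mono (by omega) (pderiv_mem _ hN))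
      (Subalgebra.smul_mem _ (DX_mem (pderiv_mem _ hN)) _))
  have h1 := pderiv_add_one_mem hN n
  have h0 := pderiv_iterate_mem hN n
  have h16 := ordLE_mono (n := 6) (by omega) h1
  refine ⟨_, h1, _, h0, _, mem_ordLE_of_pderiv (n := n - 1) (p := DX^[n] N -
    (pderiv 3 N * X (n + 3) + (pderiv 2 N + (n : ℝ) • DX (pderiv 3 N)) * X (n + 2) +
      pderiv (n + 1) (DX^[n] N) * X (n + 1) + pderiv n (DX^[n] N) * X n)) ?_, by ring⟩
  intro m hm
  have z : ∀ {p}, p ∈ ordLE 6 → pderiv m p = 0 := fun hp => pderiv_eq_zero (by omega) hp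
  have l : ∀ {p}, p ∈ ordLE 6 → ∀ i, pderiv m (p * X i) = p * pderiv m (X i) := by
    intro p hp i
    rw [Derivation.leibniz, z hp]; simp
  rw [map_sub, map_add, map_add, map_add, l hA, l hB, l h16, l h0, sub_eq_zero]
  have x : ∀ i, m ≠ i → pderiv (R := ℝ) m (X i) = 0 := fun i hi =>
    MvPolynomial.pderiv_X_of_ne hi.symm
  rcases (show m = n ∨ m = n + 1 ∨ m = n + 2 ∨ m = n + 3 ∨ n + 3 < m by omega) with
    h | h | h | h | h
  · rw [x (n + 3) (by omega), x (n + 2) (by omega), x (n + 1) (by omega), h]; simp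
  · rw [x (n + 3) (by omega), x (n + 2) (by omega), x n (by omega), h]; simp
  · rw [x (n + 3) (by omega), x (n + 1) (by omega), x n (by omega), h, pderiv_add_two hN]; simp
  · rw [x (n + 2) (by omega), x (n + 1) (by omega), x n (by omega), h, pderiv_add_three hN]; simp
  · rw [x (n + 3) (by omega), x (n + 2) (by omega), x (n + 1) (by omega), x n (by omega),
      pderiv_iterate_DX_eq_zero hN h]; simp

/-- The linearization of a differential polynomial of order at most `m`. -/
noncomputable def lin (m : ℕ) (p : MvPolynomial ℕ ℝ) (y z : ℕ → ℝ) : ℝ :=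
  ∑ i ∈ Finset.range (m + 1), MvPolynomial.eval y (pderiv i p) * z i

section lin

variable (m : ℕ) (p q : MvPolynomial ℕ ℝ) (y z : ℕ → ℝ)

lemma lin_add : lin m (p + q) y z = lin m p y z + lin m q y z := by
  simp only [lin, map_add, add_mul, Finset.sum_add_distrib]

lemma lin_mul : lin m (p * q) y z =
    MvPolynomial.eval y p * lin m q y z + MvPolynomial.eval y q * lin m p y z := by
  simp only [lin, Derivation.leibniz, map_add, smul_eq_mul, map_mul, Finset.mul_sum,
    ← Finset.sum_add_distrib]
  exact Finset.sum_congr rfl fun i _ => by ring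

lemma lin_C (r : ℝ) : lin m (C r) y z = 0 := by simp [lin]

variable {m} in
lemma lin_X {i : ℕ} (hi : i ≤ m) : lin m (X i) y z = z i := by
  rw [lin, Finset.sum_eq_single i]
  · simp
  · intro j _ hj
    rw [MvPolynomial.pderiv_X_of_ne hj.symm]; simp
  · intro h
    exact absurd (Finset.mem_range.2 (by omega)) h

end lin

lemma hasDerivAt_eval {m : ℕ} {p : MvPolynomial ℕ ℝ} (hp : p ∈ ordLE m) {y : ℝ → ℕ → ℝ}
    {z : ℕ → ℝ} {t : ℝ} (h : ∀ i ≤ m, HasDerivAt (fun τ => y τ i) (z i) t) :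
    HasDerivAt (fun τ => MvPolynomial.eval (y τ) p) (lin m p (y t) z) t := by
  refine mem_ordLE_induction (P := fun p => HasDerivAt (fun τ => MvPolynomial.eval (y τ) p)
    (lin m p (y t) z) t) ?_ ?_ ?_ ?_ hp
  · intro r
    simpa [lin_C] using hasDerivAt_const t r
  · intro i hi
    simpa [lin_X _ _ hi] using h i hi
  · intro p q hp hq
    simp only [lin_add, map_add]
    exact hp.add hq
  · intro p q hp hq
    simp only [lin_mul, map_mul]
    exact (hp.mul hq).congr_deriv (by ring)

lemma eval_bound {m : ℕ} {p : MvPolynomial ℕ ℝ} (hp : p ∈ ordLE m) (R : ℝ) :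
    ∃ C, 0 ≤ C ∧ ∀ y : ℕ → ℝ, (∀ i ≤ m, |y i| ≤ R) → |MvPolynomial.eval y p| ≤ C := by
  refine mem_ordLE_induction (P := fun p => ∃ C, 0 ≤ C ∧ ∀ y : ℕ → ℝ, (∀ i ≤ m, |y i| ≤ R) →
    |MvPolynomial.eval y p| ≤ C) ?_ ?_ ?_ ?_ hp
  · intro r
    exact ⟨|r|, abs_nonneg _, fun y _ => by simp⟩
  · intro i hi
    exact ⟨|R|, abs_nonneg _, fun y hy => by simpa using (hy i hi).trans (le_abs_self R)⟩
  · rintro p q ⟨a, ha, hpa⟩ ⟨b, hb, hqb⟩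
    refine ⟨a + b, by positivity, fun y hy => ?_⟩
    rw [map_add]
    exact (abs_add_le _ _).trans (add_le_add (hpa y hy) (hqb y hy))
  · rintro p q ⟨a, ha, hpa⟩ ⟨b, hb, hqb⟩
    refine ⟨a * b, by positivity, fun y hy => ?_⟩
    rw [map_mul, abs_mul]
    exact mul_le_mul (hpa y hy) (hqb y hy) (abs_nonneg _) ha

/-- Second order Taylor estimate for polynomials on bounded sets. -/
lemma eval_taylor {m : ℕ} {p : MvPolynomial ℕ ℝ} (hp : p ∈ ordLE m) (R : ℝ) :
    ∃ C, 0 ≤ C ∧ ∀ y y' : ℕ → ℝ, (∀ i ≤ m, |y i| ≤ R) → (∀ i ≤ m, |y' i| ≤ R) →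
      |MvPolynomial.eval y' p - MvPolynomial.eval y p - lin m p y (fun i => y' i - y i)| ≤
        C * (∑ i ∈ Finset.range (m + 1), |y' i - y i|) ^ 2 := by
  have key : ∃ C, 0 ≤ C ∧ ∀ y y' : ℕ → ℝ, (∀ i ≤ m, |y i| ≤ R) → (∀ i ≤ m, |y' i| ≤ R) →
      |MvPolynomial.eval y p| ≤ C ∧ |MvPolynomial.eval y' p| ≤ C ∧
      |MvPolynomial.eval y' p - MvPolynomial.eval y p| ≤
        C * ∑ i ∈ Finset.range (m + 1), |y' i - y i| ∧
      |lin m p y (fun i => y' i - y i)| ≤ C * ∑ i ∈ Finset.range (m + 1), |y' i - y i| ∧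
      |MvPolynomial.eval y' p - MvPolynomial.eval y p - lin m p y (fun i => y' i - y i)| ≤
        C * (∑ i ∈ Finset.range (m + 1), |y' i - y i|) ^ 2 := by
    refine mem_ordLE_induction (P := fun p => ∃ C, 0 ≤ C ∧ ∀ y y' : ℕ → ℝ,
      (∀ i ≤ m, |y i| ≤ R) → (∀ i ≤ m, |y' i| ≤ R) →
      |MvPolynomial.eval y p| ≤ C ∧ |MvPolynomial.eval y' p| ≤ C ∧
      |MvPolynomial.eval y' p - MvPolynomial.eval y p| ≤
        C * ∑ i ∈ Finset.range (m + 1), |y' i - y i| ∧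
      |lin m p y (fun i => y' i - y i)| ≤ C * ∑ i ∈ Finset.range (m + 1), |y' i - y i| ∧
      |MvPolynomial.eval y' p - MvPolynomial.eval y p - lin m p y (fun i => y' i - y i)| ≤
        C * (∑ i ∈ Finset.range (m + 1), |y' i - y i|) ^ 2) ?_ ?_ ?_ ?_ hp
    · intro r
      refine ⟨|r|, abs_nonneg _, fun y y' _ _ => ?_⟩
      have : 0 ≤ ∑ i ∈ Finset.range (m + 1), |y' i - y i| :=
        Finset.sum_nonneg fun _ _ => abs_nonneg _
      simp only [MvPolynomial.eval_C, lin_C, sub_self, abs_zero]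
      exact ⟨le_rfl, le_rfl, by positivity, by positivity, by positivity⟩
    · intro i hi
      refine ⟨|R| + 1, by positivity, fun y y' hy hy' => ?_⟩
      have hs : |y' i - y i| ≤ ∑ i ∈ Finset.range (m + 1), |y' i - y i| :=
        Finset.single_le_sum (f := fun i => |y' i - y i|) (fun _ _ => abs_nonneg _)
          (Finset.mem_range.2 (by omega))
      have h0 : 0 ≤ ∑ i ∈ Finset.range (m + 1), |y' i - y i| := (abs_nonneg _).trans hs
      have hR := le_abs_self R
      have hm : |y' i - y i| ≤ (|R| + 1) * ∑ i ∈ Finset.range (m + 1), |y' i - y i| := by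
        nlinarith [mul_nonneg (abs_nonneg R) h0]
      simp only [MvPolynomial.eval_X, lin_X _ _ hi, sub_self, abs_zero]
      exact ⟨by linarith [hy i hi], by linarith [hy' i hi], hm, hm, by positivity⟩
    · rintro p q ⟨a, ha, hpa⟩ ⟨b, hb, hqb⟩
      refine ⟨a + b, by positivity, fun y y' hy hy' => ?_⟩
      obtain ⟨p1, p2, p3, p4, p5⟩ := hpa y y' hy hy'
      obtain ⟨q1, q2, q3, q4, q5⟩ := hqb y y' hy hy'
      simp only [map_add, lin_add, add_mul]
      refine ⟨(abs_add_le _ _).trans (add_le_add p1 q1), (abs_add_le _ _).trans (add_le_add p2 q2),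
        ?_, (abs_add_le _ _).trans (add_le_add p4 q4), ?_⟩
      · rw [add_sub_add_comm]
        exact (abs_add_le _ _).trans (add_le_add p3 q3)
      · rw [add_sub_add_comm, add_sub_add_comm]
        exact (abs_add_le _ _).trans (add_le_add p5 q5)
    · rintro p q ⟨a, ha, hpa⟩ ⟨b, hb, hqb⟩
      refine ⟨3 * (a * b) , by positivity, fun y y' hy hy' => ?_⟩
      obtain ⟨p1, p2, p3, p4, p5⟩ := hpa y y' hy hy'
      obtain ⟨q1, q2, q3, q4, q5⟩ := hqb y y' hy hy'
      simp only [map_mul, lin_mul]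
      set S := ∑ i ∈ Finset.range (m + 1), |y' i - y i|
      have hS : 0 ≤ S := Finset.sum_nonneg fun _ _ => abs_nonneg _
      set P := MvPolynomial.eval y p
      set P' := MvPolynomial.eval y' p
      set Q := MvPolynomial.eval y q
      set Q' := MvPolynomial.eval y' q
      set dP := lin m p y (fun i => y' i - y i)
      set dQ := lin m q y (fun i => y' i - y i)
      have mm : ∀ {u v α β : ℝ}, |u| ≤ α → |v| ≤ β → |u * v| ≤ α * β := by
        intro u v α β hu hv
        rw [abs_mul]
        exact mul_le_mul hu hv (abs_nonneg _) ((abs_nonneg _).trans hu)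
      have hab : 0 ≤ a * b := by positivity
      have habS : 0 ≤ a * b * S := by positivity
      refine ⟨(mm p1 q1).trans (by linarith), (mm p2 q2).trans (by linarith), ?_, ?_, ?_⟩
      · rw [show P' * Q' - P * Q = P' * (Q' - Q) + (P' - P) * Q by ring]
        refine (abs_add_le _ _).trans ((add_le_add (mm p2 q3) (mm p3 q1)).trans ?_)
        linarith
      · refine (abs_add_le _ _).trans ((add_le_add (mm p1 q4) (mm q1 p4)).trans ?_)
        linarith
      · rw [show P' * Q' - P * Q - (P * dQ + Q * dP) =
          P * (Q' - Q - dQ) + (P' - P - dP) * Q' + dP * (Q' - Q) by ring]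
        refine (abs_add_le _ _).trans ((add_le_add ((abs_add_le _ _).trans
          (add_le_add (mm p1 q5) (mm p5 q2))) (mm p4 q3)).trans ?_)
        exact le_of_eq (by ring)
  obtain ⟨C, h0, h⟩ := key
  exact ⟨C, h0, fun y y' hy hy' => (h y y' hy hy').2.2.2.2⟩

end Expansion

section StaticEnergy

open Real MeasureTheory Set

/-- `F` is smooth and periodic with derivative `F'`. -/
def SD (F F' : ℝ → ℝ) : Prop := SmoothPer F ∧ ∀ x, HasDerivAt F (F' x) x

namespace SD

variable {F F' H H' : ℝ → ℝ}

lemma dx {f : ℝ → ℝ} (hf : SmoothPer f) (j : ℕ) : SD (dx j f) (FifthOrderStmt0.dx (j + 1) f) :=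
  ⟨hf.dx j, hf.hasDerivAt_dx j⟩

lemma add (h : SD F F') (h2 : SD H H') : SD (fun x => F x + H x) (fun x => F' x + H' x) :=
  ⟨h.1.add h2.1, fun x => (h.2 x).add (h2.2 x)⟩

lemma mul (h : SD F F') (h2 : SD H H') :
    SD (fun x => F x * H x) (fun x => F' x * H x + F x * H' x) :=
  ⟨h.1.mul h2.1, fun x => (h.2 x).mul (h2.2 x)⟩

lemma const_mul (r : ℝ) (h : SD F F') : SD (fun x => r * F x) (fun x => r * F' x) :=
  ⟨h.1.const_mul r, fun x => (h.2 x).const_mul r⟩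

lemma eq_dx (h : SD F F') : F' = FifthOrderStmt0.dx 1 F :=
  funext fun x => (h.2 x).unique (h.1.hasDerivAt x)

lemma continuous (h : SD F F') : Continuous F' := by
  rw [h.eq_dx]; exact (h.1.dx 1).continuous

lemma per_eq_zero (h : SD F F') : per F' = 0 := per_deriv_eq_zero h.2 h.continuous h.1.2

end SD

/-- Adding a total derivative does not change the integral. -/
lemma per_eq_of_flux {F F' I J : ℝ → ℝ} (h : SD F F') (hJ : Continuous J)
    (e : ∀ x, I x = J x + F' x) : per I = per J := by
  rw [funext e, per_add hJ h.continuous, h.per_eq_zero, add_zero]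

lemma energy_identity (γ0 γ1 γ2 : ℝ) {g a b c w R Z G : ℝ → ℝ} (hg : SmoothPer g)
    (ha : SmoothPer a) (hb : SmoothPer b) (hc : SmoothPer c) (hw : SmoothPer w)
    (hR : SmoothPer R) (hZ : SmoothPer Z)
    (hG : ∀ x, G x = -γ0 * dx 5 g x - γ1 * dx 3 g x - γ2 * dx 1 g x + a x * dx 3 g x +
      b x * dx 2 g x + c x * dx 1 g x + R x + Z x)
    (hwab : ∀ x, 5 * γ0 * dx 1 w x = b x - 1 / 2 * dx 1 a x) :
    per (fun x => -(dx 2 g x) * G x + 2 * (w x * g x * G x)) =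
      per (fun x => (1 / 2 * dx 1 c x - 5 * γ0 * dx 3 w x - 3 * γ1 * dx 1 w x +
            3 * (dx 1 w x * a x + w x * dx 1 a x) - 2 * (w x * b x)) * dx 1 g x ^ 2 +
          (-2 * γ0 * dx 4 w x - 2 * γ1 * dx 2 w x - 2 * γ2 * w x +
            2 * (dx 2 w x * a x + 2 * (dx 1 w x * dx 1 a x) + w x * dx 2 a x) -
            2 * (dx 1 w x * b x + w x * dx 1 b x) + 2 * (w x * c x)) * (g x * dx 1 g x) +
          dx 1 g x * dx 1 R x + 2 * (w x * g x * R x) +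
          (-(dx 2 g x) * Z x + 2 * (w x * g x * Z x))) := by
  have G' := SD.dx hg
  have A := SD.dx ha
  have B := SD.dx hb
  have C := SD.dx hc
  have W := SD.dx hw
  have R' := SD.dx hR
  have f1 := (((G' 2).mul (G' 4)).add (((G' 3).mul (G' 3)).const_mul (-1/2))).const_mul γ0
  have f2 := ((G' 2).mul (G' 2)).const_mul (γ1/2)
  have f3 := ((G' 1).mul (G' 1)).const_mul (γ2/2)
  have f4 := ((A 0).mul ((G' 2).mul (G' 2))).const_mul (-1/2)
  have f5 := ((C 0).mul ((G' 1).mul (G' 1))).const_mul (-1/2)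
  have f6 := ((G' 1).mul (R' 0)).const_mul (-1)
  have f7 := ((((((((W 0).mul ((G' 0).mul (G' 4))).add
      (((W 1).mul ((G' 0).mul (G' 3))).const_mul (-1))).add
      (((W 0).mul ((G' 1).mul (G' 3))).const_mul (-1))).add
      ((W 2).mul ((G' 0).mul (G' 2)))).add
      (((W 1).mul ((G' 1).mul (G' 2))).const_mul 2)).add
      (((W 0).mul ((G' 2).mul (G' 2))).const_mul (1/2))).add
      (((W 3).mul ((G' 0).mul (G' 1))).const_mul (-1))).add
      (((W 2).mul ((G' 1).mul (G' 1))).const_mul (-3/2)) |>.const_mul (-2*γ0)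
  have f8 := ((((W 0).mul ((G' 0).mul (G' 2))).add
      (((W 1).mul ((G' 0).mul (G' 1))).const_mul (-1))).add
      (((W 0).mul ((G' 1).mul (G' 1))).const_mul (-1/2))).const_mul (-2*γ1)
  have f9 := (((((W 0).mul (A 0)).mul ((G' 0).mul (G' 2))).add
      (((((W 1).mul (A 0)).add ((W 0).mul (A 1))).mul ((G' 0).mul (G' 1))).const_mul (-1))).add
      ((((W 0).mul (A 0)).mul ((G' 1).mul (G' 1))).const_mul (-1/2))).const_mul 2
  have f10 := (((W 0).mul (B 0)).mul ((G' 0).mul (G' 1))).const_mul 2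
  have flux := ((((((((f1.add f2).add f3).add f4).add f5).add f6).add f7).add f8).add f9).add f10
  have hg' := fun j => (hg.dx j).continuous
  have ha' := fun j => (ha.dx j).continuous
  have hb' := fun j => (hb.dx j).continuous
  have hc' := fun j => (hc.dx j).continuous
  have hw' := fun j => (hw.dx j).continuous
  have hR' := fun j => (hR.dx j).continuous
  have hg0 := hg.continuous
  have ha0 := ha.continuous
  have hb0 := hb.continuous
  have hc0 := hc.continuous
  have hw0 := hw.continuous
  have hR0 := hR.continuous
  have hZ0 := hZ.continuous
  refine per_eq_of_flux flux (by fun_prop) fun x => ?_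
  rw [hG x]
  simp only [dx_zero]
  norm_num only
  linear_combination (dx 2 g x ^ 2) * hwab x

lemma abs_mul_le_mul {u v α β : ℝ} (hu : |u| ≤ α) (hv : |v| ≤ β) : |u * v| ≤ α * β := by
  rw [abs_mul]
  exact mul_le_mul hu hv (abs_nonneg _) ((abs_nonneg _).trans hu)

lemma quadratic_bound {α β w Ka Kb K1 g g1 R R1 : ℝ} (hα : |α| ≤ Ka) (hβ : |β| ≤ Kb)
    (hw : |w| ≤ K1) :
    α * g1 ^ 2 + β * (g * g1) + g1 * R1 + 2 * (w * g * R) ≤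
      (Ka + Kb + 1 + K1) * (g ^ 2 + g1 ^ 2 + R ^ 2 + R1 ^ 2) := by
  have hKa := (abs_nonneg α).trans hα
  have hKb := (abs_nonneg β).trans hβ
  have hK1 := (abs_nonneg w).trans hw
  have yg : ∀ u v : ℝ, |u * v| ≤ (u ^ 2 + v ^ 2) / 2 := by
    intro u v
    rw [abs_mul]
    nlinarith [sq_nonneg (|u| - |v|), sq_abs u, sq_abs v]
  have t1 : α * g1 ^ 2 ≤ Ka * g1 ^ 2 :=
    mul_le_mul_of_nonneg_right (le_of_abs_le hα) (sq_nonneg _)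
  have t2 := le_of_abs_le (abs_mul_le_mul hβ (yg g g1))
  have t3 := le_of_abs_le (yg g1 R1)
  have t4 := le_of_abs_le (abs_mul_le_mul hw (yg g R))
  rw [← mul_assoc] at t4
  have p1 := mul_nonneg hKa (add_nonneg (add_nonneg (sq_nonneg g) (sq_nonneg R)) (sq_nonneg R1))
  have p2 := mul_nonneg hKb (add_nonneg (add_nonneg (add_nonneg (sq_nonneg g) (sq_nonneg g1))
    (add_nonneg (sq_nonneg R) (sq_nonneg R1))) (add_nonneg (sq_nonneg R) (sq_nonneg R1)))
  have p3 := mul_nonneg hK1 (add_nonneg (sq_nonneg g1) (sq_nonneg R1))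
  linarith [sq_nonneg g, sq_nonneg R, sq_nonneg g1, sq_nonneg R1]

/-- The modified energy estimate for the linear equation with third order coefficient `a` and
second order coefficient `b`, the weight `w` cancelling the resonant second order terms. -/
lemma energy_static (γ0 γ1 γ2 : ℝ) {K1 : ℝ} (hK1 : 0 ≤ K1) :
    ∃ K, 0 ≤ K ∧ ∀ g a b c w R Z G : ℝ → ℝ, SmoothPer g → SmoothPer a → SmoothPer b →
      SmoothPer c → SmoothPer w → SmoothPer R → SmoothPer Z → SmoothPer G →
      (∀ j ≤ 2, ∀ x, |dx j a x| ≤ K1) → (∀ j ≤ 1, ∀ x, |dx j b x| ≤ K1) →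
      (∀ j ≤ 1, ∀ x, |dx j c x| ≤ K1) → (∀ j ≤ 4, ∀ x, |dx j w x| ≤ K1) →
      (∀ x, G x = -γ0 * dx 5 g x - γ1 * dx 3 g x - γ2 * dx 1 g x + a x * dx 3 g x +
        b x * dx 2 g x + c x * dx 1 g x + R x + Z x) →
      (∀ x, 5 * γ0 * dx 1 w x = b x - 1 / 2 * dx 1 a x) →
      per (fun x => dx 1 g x * dx 1 G x) + 2 * per (fun x => w x * g x * G x) ≤
        K * (per (fun x => g x ^ 2) + per (fun x => dx 1 g x ^ 2) + per (fun x => R x ^ 2) +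
          per (fun x => dx 1 R x ^ 2)) +
        per (fun x => -(dx 2 g x) * Z x + 2 * (w x * g x * Z x)) := by
  obtain ⟨Ka, hKa⟩ : ∃ k : ℝ, k = 1 / 2 * K1 + 5 * |γ0| * K1 + 3 * |γ1| * K1 + 3 * (K1 * K1 + K1 * K1) +
    2 * (K1 * K1) := ⟨_, rfl⟩
  obtain ⟨Kb, hKb⟩ : ∃ k : ℝ, k = 2 * |γ0| * K1 + 2 * |γ1| * K1 + 2 * |γ2| * K1 +
    2 * (K1 * K1 + 2 * (K1 * K1) + K1 * K1) + 2 * (K1 * K1 + K1 * K1) + 2 * (K1 * K1) := ⟨_, rfl⟩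
  have hKa0 : 0 ≤ Ka := by rw [hKa]; positivity
  have hKb0 : 0 ≤ Kb := by rw [hKb]; positivity
  refine ⟨Ka + Kb + 1 + K1, by positivity, ?_⟩
  intro g a b c w R Z G hg ha hb hc hw hR hZ hGs hab hbb hcb hwb hG hwab
  have hg' := fun j => (hg.dx j).continuous
  have hR' := fun j => (hR.dx j).continuous
  have hG' := fun j => (hGs.dx j).continuous
  have hg0 := hg.continuous
  have hw0 := hw.continuous
  have hR0 := hR.continuous
  have hZ0 := hZ.continuous
  have hG0 := hGs.continuous
  have h1 : per (fun x => dx 1 g x * dx 1 G x) = per (fun x => -(dx 2 g x) * G x) := by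
    have := per_parts (hg.dx 1) hGs
    rw [dx_dx] at this
    simp only [neg_mul]
    rw [show (fun x => -(dx 2 g x * G x)) = fun x => (-1) * (dx 2 g x * G x) by funext x; ring,
      per_const_mul, this]
    ring
  have h2 := energy_identity γ0 γ1 γ2 hg ha hb hc hw hR hZ hG hwab
  rw [h1, ← per_const_mul, ← per_add (by fun_prop) (by fun_prop), h2,
    ← per_add (by fun_prop) (by fun_prop), ← per_add (by fun_prop) (by fun_prop),
    ← per_add (by fun_prop) (by fun_prop), ← per_const_mul,
    ← per_add (by fun_prop) (by fun_prop)]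
  have ha' := fun j => (ha.dx j).continuous
  have hb' := fun j => (hb.dx j).continuous
  have hc' := fun j => (hc.dx j).continuous
  have hw' := fun j => (hw.dx j).continuous
  have ha0 := ha.continuous
  have hb0 := hb.continuous
  have hc0 := hc.continuous
  refine per_mono (by fun_prop) (by fun_prop) fun x => ?_
  have A0 := hab 0 (by omega) x
  have A1 := hab 1 (by omega) x
  have A2 := hab 2 (by omega) x
  have B0 := hbb 0 (by omega) x
  have B1 := hbb 1 (by omega) x
  have C0 := hcb 0 (by omega) x
  have C1 := hcb 1 (by omega) x
  have W0 := hwb 0 (by omega) x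
  have W1 := hwb 1 (by omega) x
  have W2 := hwb 2 (by omega) x
  have W3 := hwb 3 (by omega) x
  have W4 := hwb 4 (by omega) x
  rw [dx_zero] at A0 B0 C0 W0
  have sc : ∀ {r u α : ℝ}, |u| ≤ α → |r * u| ≤ |r| * α := fun h => abs_mul_le_mul le_rfl h
  have ad : ∀ {u v α β : ℝ}, |u| ≤ α → |v| ≤ β → |u + v| ≤ α + β := fun h h' =>
    (abs_add_le _ _).trans (add_le_add h h')
  have sb : ∀ {u v α β : ℝ}, |u| ≤ α → |v| ≤ β → |u - v| ≤ α + β := fun h h' =>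
    (abs_sub _ _).trans (add_le_add h h')
  have hα : |1 / 2 * dx 1 c x - 5 * γ0 * dx 3 w x - 3 * γ1 * dx 1 w x +
      3 * (dx 1 w x * a x + w x * dx 1 a x) - 2 * (w x * b x)| ≤ Ka := by
    refine (sb (ad (sb (sb (sc C1) (sc W3)) (sc W1)) (sc (ad (abs_mul_le_mul W1 A0)
      (abs_mul_le_mul W0 A1)))) (sc (abs_mul_le_mul W0 B0))).trans (le_of_eq ?_)
    simp only [abs_mul, hKa]; norm_num
  have hβ : |-2 * γ0 * dx 4 w x - 2 * γ1 * dx 2 w x - 2 * γ2 * w x +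
      2 * (dx 2 w x * a x + 2 * (dx 1 w x * dx 1 a x) + w x * dx 2 a x) -
      2 * (dx 1 w x * b x + w x * dx 1 b x) + 2 * (w x * c x)| ≤ Kb := by
    refine (ad (sb (ad (sb (sb (sc W4) (sc W2)) (sc W0)) (sc (ad (ad (abs_mul_le_mul W2 A0)
      (sc (abs_mul_le_mul W1 A1))) (abs_mul_le_mul W0 A2)))) (sc (ad (abs_mul_le_mul W1 B0)
      (abs_mul_le_mul W0 B1)))) (sc (abs_mul_le_mul W0 C0))).trans (le_of_eq ?_)
    simp only [abs_mul, hKb]; norm_num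
  have := quadratic_bound hα hβ W0 (g := g x) (g1 := dx 1 g x) (R := R x) (R1 := dx 1 R x)
  linarith

end StaticEnergy

section Bounds

open Real MeasureTheory Set
open MvPolynomial (X C pderiv)

lemma abs_dx_le_of_sob {f : ℝ → ℝ} (hf : SmoothPer f) {j m : ℕ} (h : j + 1 ≤ m) {R : ℝ}
    (hR : sob m f ≤ R) (x : ℝ) : |dx j f x| ≤ √(2 * R) := by
  rw [← sqrt_sq_eq_abs]
  exact sqrt_le_sqrt ((dx_sq_le_sob hf h x).trans (by linarith))

lemma ev_bound {m : ℕ} {p : MvPolynomial ℕ ℝ} (hp : p ∈ ordLE m) (R : ℝ) :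
    ∃ C, 0 ≤ C ∧ ∀ f, SmoothPer f → sob (m + 1) f ≤ R → ∀ x, |ev p f x| ≤ C := by
  obtain ⟨C, hC, h⟩ := eval_bound hp (√(2 * R))
  exact ⟨C, hC, fun f hf hR x => h _ fun i hi => abs_dx_le_of_sob hf (by omega) hR x⟩

lemma dx_ev_bound {m : ℕ} {p : MvPolynomial ℕ ℝ} (hp : p ∈ ordLE m) (R : ℝ) (J : ℕ) :
    ∃ C, 0 ≤ C ∧ ∀ f, SmoothPer f → sob (m + J + 1) f ≤ R → ∀ j ≤ J, ∀ x,
      |dx j (ev p f) x| ≤ C := by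
  have h : ∀ j, ∃ C, 0 ≤ C ∧ ∀ f, SmoothPer f → sob (m + j + 1) f ≤ R → ∀ x,
      |ev (DX^[j] p) f x| ≤ C := fun j => ev_bound (iterate_DX_mem hp j) R
  choose C hC h using h
  refine ⟨∑ j ∈ Finset.range (J + 1), C j, Finset.sum_nonneg fun j _ => hC j, ?_⟩
  intro f hf hR j hj x
  rw [dx_ev p hf]
  refine (h j f hf ((sob_mono (by omega) f).trans hR) x).trans ?_
  exact Finset.single_le_sum (f := C) (fun j _ => hC j) (Finset.mem_range.2 (by omega))

lemma per_sq_le_of_abs_le {f : ℝ → ℝ} (hf : Continuous f) {C : ℝ} (h : ∀ x, |f x| ≤ C) :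
    per (fun x => f x ^ 2) ≤ 2 * π * C ^ 2 := by
  rw [← per_const]
  exact per_mono (by fun_prop) (by fun_prop) fun x => sq_le_sq' (abs_le.1 (h x)).1 (abs_le.1 (h x)).2

/-- The primitive vanishing at the origin. -/
noncomputable def prim (h : ℝ → ℝ) (x : ℝ) : ℝ := ∫ y in (0:ℝ)..x, h y

lemma hasDerivAt_prim {h : ℝ → ℝ} (hh : Continuous h) (x : ℝ) : HasDerivAt (prim h) (h x) x :=
  intervalIntegral.integral_hasDerivAt_right (hh.intervalIntegrable _ _)
    hh.aestronglyMeasurable.stronglyMeasurableAtFilter hh.continuousAt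

lemma sd_prim {h : ℝ → ℝ} (hh : SmoothPer h) (h0 : per h = 0) : SD (prim h) h := by
  have hd := hasDerivAt_prim hh.continuous
  refine ⟨⟨?_, fun x => ?_⟩, hd⟩
  · refine (contDiff_infty_iff_deriv (𝕜 := ℝ)).2 ⟨fun x => (hd x).differentiableAt, ?_⟩
    rw [funext fun x => (hd x).deriv]
    exact hh.1
  · have hi := fun a b => hh.continuous.intervalIntegrable (μ := volume) a b
    rw [prim, ← intervalIntegral.integral_add_adjacent_intervals (hi 0 x) (hi x (x + 2 * π)),
      hh.2.intervalIntegral_add_eq x 0, zero_add]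
    change prim h x + per h = _
    rw [h0, add_zero]

lemma abs_prim_le_of_mem {h : ℝ → ℝ} {C : ℝ} (hC : ∀ x, |h x| ≤ C) {x : ℝ}
    (hx : x ∈ Icc 0 (2 * π)) : |prim h x| ≤ 2 * π * C := by
  have h1 := intervalIntegral.norm_integral_le_of_norm_le_const (a := 0) (b := x) (f := h)
    (C := C) fun y _ => hC y
  have hC0 := (abs_nonneg _).trans (hC 0)
  rw [sub_zero, abs_of_nonneg hx.1] at h1
  exact h1.trans (by nlinarith [hx.2])

lemma abs_prim_le {h : ℝ → ℝ} (hh : SmoothPer h) (h0 : per h = 0) {C : ℝ} (hC : ∀ x, |h x| ≤ C)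
    (x : ℝ) : |prim h x| ≤ 2 * π * C := by
  obtain ⟨y, hy, e⟩ := (sd_prim hh h0).1.2.exists_mem_Ico₀ two_pi_pos x
  rw [e]
  exact abs_prim_le_of_mem hC ⟨hy.1, hy.2.le⟩

end Bounds

section Weight

open Real MeasureTheory Set
open MvPolynomial (X C pderiv)

/-- The weight which compensates the second order terms. -/
noncomputable def wt (γ0 : ℝ) (N : MvPolynomial ℕ ℝ) (K0 ν : ℝ) (f : ℝ → ℝ) (x : ℝ) : ℝ :=
  K0 + 1 / (5 * γ0) * (prim (ev (pderiv 2 N) f) x + ν * ev (pderiv 3 N) f x)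

/-- Non-parabolic resonance for a differential polynomial. -/
def NonParabolic (N : MvPolynomial ℕ ℝ) : Prop :=
  N ∈ ordLE 3 ∧ ∀ f, SmoothPer f → per (ev (pderiv 2 N) f) = 0

variable {γ0 : ℝ} {N : MvPolynomial ℕ ℝ} {f : ℝ → ℝ}

lemma sd_wt (hN : NonParabolic N) (K0 ν : ℝ) (hf : SmoothPer f) :
    SD (wt γ0 N K0 ν f) (fun x => 1 / (5 * γ0) *
      (ev (pderiv 2 N) f x + ν * ev (DX (pderiv 3 N)) f x)) := by
  have h1 := sd_prim (smoothPer_ev (pderiv 2 N) hf) (hN.2 f hf)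
  have h2 : SD (ev (pderiv 3 N) f) (ev (DX (pderiv 3 N)) f) :=
    ⟨smoothPer_ev _ hf, hasDerivAt_ev _ hf⟩
  have h3 := (h1.add (h2.const_mul ν)).const_mul (1 / (5 * γ0))
  exact ⟨(SmoothPer.const K0).add h3.1, fun x => (h3.2 x).const_add K0⟩

lemma wt_dx_one (hγ : γ0 ≠ 0) (hN : NonParabolic N) (K0 ν : ℝ) (hf : SmoothPer f) (x : ℝ) :
    5 * γ0 * dx 1 (wt γ0 N K0 ν f) x =
      ev (pderiv 2 N) f x + ν * ev (DX (pderiv 3 N)) f x := by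
  rw [← (sd_wt hN K0 ν hf).eq_dx]
  field_simp

lemma wt_dx_bound (hN : NonParabolic N) (K0 ν R : ℝ) :
    ∃ C, 0 ≤ C ∧ ∀ f, SmoothPer f → sob 8 f ≤ R → ∀ j ≤ 4, ∀ x,
      |dx j (wt γ0 N K0 ν f) x| ≤ C := by
  have hA := pderiv_mem 3 hN.1
  have hB := pderiv_mem 2 hN.1
  obtain ⟨C1, h1, b1⟩ := dx_ev_bound hB R 4
  obtain ⟨C2, h2, b2⟩ := dx_ev_bound hA R 4
  have hq : pderiv 2 N + ν • DX (pderiv 3 N) ∈ ordLE 4 :=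
    add_mem (ordLE_mono (by omega) hB) (Subalgebra.smul_mem _ (DX_mem hA) _)
  obtain ⟨C3, h3, b3⟩ := dx_ev_bound hq R 3
  have p0 : 0 ≤ |1 / (5 * γ0)| * (2 * π * C1 + |ν| * C2) := by positivity
  have p1 : 0 ≤ |1 / (5 * γ0)| * C3 := by positivity
  refine ⟨|K0| + |1 / (5 * γ0)| * (2 * π * C1 + |ν| * C2) + |1 / (5 * γ0)| * C3, by positivity, ?_⟩
  intro f hf hR j hj x
  rcases j with _ | j
  · rw [dx_zero, wt]
    have c1 := abs_prim_le (smoothPer_ev (pderiv 2 N) hf) (hN.2 f hf)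
      (fun x => by simpa [dx_zero] using b1 f hf hR 0 (by omega) x) x
    have c2 : |ev (pderiv 3 N) f x| ≤ C2 := by simpa [dx_zero] using b2 f hf hR 0 (by omega) x
    refine (abs_add_le _ _).trans ?_
    have := abs_mul_le_mul (le_refl |1 / (5 * γ0)|) ((abs_add_le _ _).trans (add_le_add c1
      (abs_mul_le_mul (le_refl |ν|) c2)))
    linarith
  · have e : dx 1 (wt γ0 N K0 ν f) =
        fun x => 1 / (5 * γ0) * ev (pderiv 2 N + ν • DX (pderiv 3 N)) f x := by
      rw [← (sd_wt hN K0 ν hf).eq_dx]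
      funext x
      rw [ev_add, ev, ev, ev, MvPolynomial.smul_eval]
    rw [← dx_dx j 1, e, dx, iteratedDeriv_const_mul_field]
    have := abs_mul_le_mul (le_refl |1 / (5 * γ0)|) (b3 f hf hR j (by omega) x)
    have := abs_nonneg K0
    change |1 / (5 * γ0) * dx j _ x| ≤ _
    linarith

/-- The weight can be made positive uniformly on bounded sets. -/
lemma wt_pos (γ0 : ℝ) (hN : NonParabolic N) (ν R : ℝ) :
    ∃ K0 C, 0 ≤ C ∧ ∀ f, SmoothPer f → sob 4 f ≤ R → ∀ x,
      1 ≤ wt γ0 N K0 ν f x ∧ wt γ0 N K0 ν f x ≤ C := by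
  have hA := pderiv_mem 3 hN.1
  have hB := pderiv_mem 2 hN.1
  obtain ⟨C1, h1, b1⟩ := ev_bound hB R
  obtain ⟨C2, h2, b2⟩ := ev_bound hA R
  have p0 : 0 ≤ |1 / (5 * γ0)| * (2 * π * C1 + |ν| * C2) := by positivity
  refine ⟨1 + |1 / (5 * γ0)| * (2 * π * C1 + |ν| * C2),
    1 + 2 * (|1 / (5 * γ0)| * (2 * π * C1 + |ν| * C2)), by positivity, ?_⟩
  intro f hf hR x
  have c1 := abs_prim_le (smoothPer_ev (pderiv 2 N) hf) (hN.2 f hf) (b1 f hf hR) x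
  have := abs_le.1 (abs_mul_le_mul (le_refl |1 / (5 * γ0)|) ((abs_add_le _ _).trans (add_le_add c1
    (abs_mul_le_mul (le_refl |ν|) (b2 f hf hR x)))))
  rw [wt]
  constructor <;> linarith [this.1, this.2]

end Weight

section Viscosity

open Real MeasureTheory Set

lemma per_mul_le {f g : ℝ → ℝ} (hf : Continuous f) (hg : Continuous g) {l : ℝ} (hl : 0 < l) :
    2 * per (fun x => f x * g x) ≤ l * per (fun x => f x ^ 2) + l⁻¹ * per (fun x => g x ^ 2) := by
  rw [← per_const_mul, ← per_const_mul, ← per_const_mul, ← per_add (by fun_prop) (by fun_prop)]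
  refine per_mono (by fun_prop) (by fun_prop) fun x => ?_
  have h := mul_nonneg (inv_nonneg.2 hl.le) (sq_nonneg (l * f x - g x))
  have e : l⁻¹ * (l * f x - g x) ^ 2 = l * f x ^ 2 + l⁻¹ * g x ^ 2 - 2 * (f x * g x) := by
    field_simp; ring
  linarith

/-- The viscosity absorbs the error made by projecting the nonlinearity. -/
lemma viscosity_absorbs {g w F Z : ℝ → ℝ} {M : ℕ} (hg : SmoothPer g) (hgM : proj M g = g)
    (hw : SmoothPer w) (hF : SmoothPer F) {CF Y : ℝ} (hCF : 1 ≤ CF)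
    (hY : per (fun x => dx 1 g x ^ 2) ≤ Y)
    (hFY : per (fun x => F x ^ 2) ≤
      CF * (per (fun x => dx 3 g x ^ 2) + per (fun x => dx 2 g x ^ 2) + Y))
    (hZ : ∀ x, Z x = -((M:ℝ) + 1)⁻¹ * dx 4 g x - (F x - proj M F x)) :
    per (fun x => -(dx 2 g x) * Z x + 2 * (w x * g x * Z x)) ≤
      4 * (CF + 1) * per (fun x => dx 1 (fun x => w x * g x) x ^ 2) + Y := by
  set ε : ℝ := ((M:ℝ) + 1)⁻¹ with hε
  have hM : (0:ℝ) < (M:ℝ) + 1 := by positivity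
  have hε0 : 0 < ε := by positivity
  have hε1 : ε ≤ 1 := inv_le_one_of_one_le₀ (by linarith [(Nat.cast_nonneg M : (0:ℝ) ≤ M)])
  set h : ℝ → ℝ := fun x => w x * g x with hh
  have hhs : SmoothPer h := hw.mul hg
  have cg := fun j => (hg.dx j).continuous
  have ch := hhs.continuous
  have ch1 := (hhs.dx 1).continuous
  have cF := hF.continuous
  have cP := (smoothPer_proj M F).continuous
  have cPh := (smoothPer_proj M h).continuous
  have e : (fun x => -(dx 2 g x) * Z x + 2 * (w x * g x * Z x)) = fun x =>
      ε * (dx 2 g x * dx 4 g x) + (F x - proj M F x) * dx 2 g x -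
        2 * ε * (h x * dx 4 g x) - 2 * ((F x - proj M F x) * h x) := by
    funext x; rw [hZ, hh]; ring
  have i1 : per (fun x => dx 2 g x * dx 4 g x) = - per (fun x => dx 3 g x ^ 2) := by
    have := per_parts (hg.dx 2) (hg.dx 3)
    rw [dx_dx, dx_dx] at this
    simp only [sq]
    rw [this]; ring
  have i2 : per (fun x => (F x - proj M F x) * dx 2 g x) = 0 := by
    have := per_sub_proj_mul_tp cF M (hc (dx 2 g))
    rwa [show tp M (hc (dx 2 g)) = dx 2 g by
      rw [← proj.eq_1, ← dx_proj hg, hgM]] at this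
  have i3 : per (fun x => h x * dx 4 g x) = - per (fun x => dx 1 h x * dx 3 g x) := by
    have := per_parts hhs (hg.dx 3)
    rw [dx_dx] at this
    linarith
  have i4 := per_sub_proj_mul cF ch M
  have i5 : per (fun x => dx 2 g x ^ 2) = - per (fun x => dx 1 g x * dx 3 g x) := by
    have := per_parts (hg.dx 1) (hg.dx 2)
    rw [dx_dx, dx_dx] at this
    simp only [sq]
    exact this
  have b1 := per_mul_le ch1 (cg 3) (l := 4) (by norm_num)
  have b2 := per_mul_le (f := fun x => -dx 1 g x) (by fun_prop) (cg 3) (l := 1) (by norm_num)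
  simp only [neg_mul, neg_sq] at b2
  have b2' : per (fun x => -(dx 1 g x * dx 3 g x)) = - per (fun x => dx 1 g x * dx 3 g x) := by
    have := per_const_mul (-1) (fun x => dx 1 g x * dx 3 g x)
    simpa using this
  have hl : 0 < 4 * CF * ((M:ℝ) + 1) := by positivity
  have b3 := per_mul_le (f := fun x => -(h x - proj M h x)) (by fun_prop) cF hl
  have b3' : per (fun x => -(h x - proj M h x) * F x) = - per (fun x => F x * (h x - proj M h x)) := by
    have := per_const_mul (-1) (fun x => F x * (h x - proj M h x))
    rw [neg_one_mul] at this
    rw [← this]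
    congr 1; funext x; ring
  simp only [neg_sq] at b3
  have b4 := per_sub_proj_sq_le_dx hhs M
  have n3 := per_sq_nonneg (dx 3 g)
  have n2 := per_sq_nonneg (dx 2 g)
  have n1 := per_sq_nonneg (dx 1 g)
  have nh := per_sq_nonneg (dx 1 h)
  have b5 : 4 * CF * ((M:ℝ) + 1) * per (fun x => (h x - proj M h x) ^ 2) ≤
      4 * CF * per (fun x => dx 1 h x ^ 2) := by
    have q0 := per_sq_nonneg (fun x => h x - proj M h x)
    have : ((M:ℝ) + 1) * per (fun x => (h x - proj M h x) ^ 2) ≤ per (fun x => dx 1 h x ^ 2) := by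
      refine le_trans ?_ b4
      have : (1:ℝ) ≤ (M:ℝ) + 1 := by linarith [(Nat.cast_nonneg M : (0:ℝ) ≤ M)]
      nlinarith [mul_nonneg (mul_nonneg hM.le q0) (sub_nonneg.2 this)]
    nlinarith
  have b6 : (4 * CF * ((M:ℝ) + 1))⁻¹ * per (fun x => F x ^ 2) ≤
      ε / 4 * (per (fun x => dx 3 g x ^ 2) + per (fun x => dx 2 g x ^ 2) + Y) := by
    have : (4 * CF * ((M:ℝ) + 1))⁻¹ = ε / 4 * CF⁻¹ := by rw [hε]; field_simp
    rw [this, mul_assoc]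
    refine mul_le_mul_of_nonneg_left ?_ (by positivity)
    rw [inv_mul_le_iff₀ (by linarith)]
    exact hFY
  rw [e, per_sub (by fun_prop) (by fun_prop), per_sub (by fun_prop) (by fun_prop),
    per_add (by fun_prop) (by fun_prop), per_const_mul, per_const_mul, per_const_mul, i1, i2, i3,
    i4]
  rw [b3'] at b3
  rw [b2', ← i5] at b2
  have b7 := mul_le_mul_of_nonneg_left b1 hε0.le
  have b8 := mul_le_mul_of_nonneg_left b2 hε0.le
  have b9 : ε * per (fun x => dx 1 h x ^ 2) ≤ per (fun x => dx 1 h x ^ 2) := by nlinarith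
  have b10 : ε * Y ≤ Y := by nlinarith
  have b11 : ε * per (fun x => dx 1 g x ^ 2) ≤ ε * Y := mul_le_mul_of_nonneg_left hY hε0.le
  have b12 : 0 ≤ ε * per (fun x => dx 3 g x ^ 2) := by positivity
  simp only [inv_one, one_mul] at b8
  norm_num at b7
  linarith

end Viscosity

section VectorField

open Real MeasureTheory Set
open MvPolynomial (X C pderiv)

/-- The coefficients and the nonlinearity of an equation of non-parabolic resonance type. -/
structure Eqn where
  γ0 : ℝ
  γ1 : ℝ
  γ2 : ℝ
  N : MvPolynomial ℕ ℝ
  ne_zero : γ0 ≠ 0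
  nonpar : NonParabolic N

/-- The vector field of the regularized Galerkin approximation of degree `M`. -/
noncomputable def vf (P : Eqn) (M : ℕ) (f : ℝ → ℝ) (x : ℝ) : ℝ :=
  -P.γ0 * dx 5 f x - P.γ1 * dx 3 f x - P.γ2 * dx 1 f x - ((M:ℝ) + 1)⁻¹ * dx 4 f x +
    proj M (ev P.N f) x

variable (P : Eqn) (M : ℕ) {f : ℝ → ℝ}

lemma sd_dx_vf (hf : SmoothPer f) (n : ℕ) :
    SD (fun x => -P.γ0 * dx (n + 5) f x + (-P.γ1 * dx (n + 3) f x + (-P.γ2 * dx (n + 1) f x +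
        (-((M:ℝ) + 1)⁻¹ * dx (n + 4) f x + dx n (proj M (ev P.N f)) x))))
      (fun x => -P.γ0 * dx (n + 1 + 5) f x + (-P.γ1 * dx (n + 1 + 3) f x +
        (-P.γ2 * dx (n + 1 + 1) f x +
        (-((M:ℝ) + 1)⁻¹ * dx (n + 1 + 4) f x + dx (n + 1) (proj M (ev P.N f)) x)))) := by
  have e : ∀ i, n + 1 + i = n + i + 1 := fun i => by ring
  simp only [e]
  exact ((SD.dx hf _).const_mul _).add (((SD.dx hf _).const_mul _).add
    (((SD.dx hf _).const_mul _).add (((SD.dx hf _).const_mul _).add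
      (SD.dx (smoothPer_proj M _) n))))

lemma vf_eq : vf P M f = fun x => -P.γ0 * dx (0 + 5) f x + (-P.γ1 * dx (0 + 3) f x +
    (-P.γ2 * dx (0 + 1) f x + (-((M:ℝ) + 1)⁻¹ * dx (0 + 4) f x +
      dx 0 (proj M (ev P.N f)) x))) := by
  funext x
  rw [vf, dx_zero]
  ring

lemma smoothPer_vf (hf : SmoothPer f) : SmoothPer (vf P M f) := by
  rw [vf_eq]; exact (sd_dx_vf P M hf 0).1

lemma dx_vf (hf : SmoothPer f) (n : ℕ) : dx n (vf P M f) =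
    fun x => -P.γ0 * dx (n + 5) f x + (-P.γ1 * dx (n + 3) f x + (-P.γ2 * dx (n + 1) f x +
      (-((M:ℝ) + 1)⁻¹ * dx (n + 4) f x + proj M (ev (DX^[n] P.N) f) x))) := by
  have h : dx n (vf P M f) = fun x => -P.γ0 * dx (n + 5) f x + (-P.γ1 * dx (n + 3) f x +
      (-P.γ2 * dx (n + 1) f x + (-((M:ℝ) + 1)⁻¹ * dx (n + 4) f x +
        dx n (proj M (ev P.N f)) x))) := by
    induction n with
    | zero => rw [dx_zero]; exact vf_eq P M
    | succ n ih => rw [add_comm n 1, ← dx_dx, ih, add_comm 1 n, ← (sd_dx_vf P M hf n).eq_dx]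
  rw [h, dx_proj (smoothPer_ev _ hf), dx_ev _ hf]

lemma per_add_sq_le {f g : ℝ → ℝ} (hf : Continuous f) (hg : Continuous g) :
    per (fun x => (f x + g x) ^ 2) ≤
      2 * (per (fun x => f x ^ 2) + per (fun x => g x ^ 2)) := by
  rw [← per_add (by fun_prop) (by fun_prop), ← per_const_mul]
  exact per_mono (by fun_prop) (by fun_prop) fun x => by nlinarith [sq_nonneg (f x - g x)]

lemma per_const_mul_sq (r : ℝ) (f : ℝ → ℝ) :
    per (fun x => (r * f x) ^ 2) = r ^ 2 * per (fun x => f x ^ 2) := by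
  simp only [mul_pow, per_const_mul]

lemma per_mul_sq_le {f g : ℝ → ℝ} (hf : Continuous f) (hg : Continuous g) {C : ℝ}
    (h : ∀ x, |f x| ≤ C) :
    per (fun x => (f x * g x) ^ 2) ≤ C ^ 2 * per (fun x => g x ^ 2) := by
  rw [← per_const_mul]
  refine per_mono (by fun_prop) (by fun_prop) fun x => ?_
  rw [mul_pow]
  exact mul_le_mul_of_nonneg_right (sq_le_sq' (abs_le.1 (h x)).1 (abs_le.1 (h x)).2) (sq_nonneg _)

lemma inv_succ_sq_le (M : ℕ) : (-((M:ℝ) + 1)⁻¹) ^ 2 ≤ 1 := by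
  have h1 : ((M:ℝ) + 1)⁻¹ ≤ 1 := inv_le_one_of_one_le₀ (by linarith [(Nat.cast_nonneg M : (0:ℝ) ≤ M)])
  have h0 : (0:ℝ) ≤ ((M:ℝ) + 1)⁻¹ := by positivity
  nlinarith

lemma sob_vf_bound (m : ℕ) (R : ℝ) :
    ∃ C, 0 ≤ C ∧ ∀ M f, SmoothPer f → sob (m + 5) f ≤ R → sob m (vf P M f) ≤ C := by
  have h : ∀ n, ∃ C, 0 ≤ C ∧ ∀ f, SmoothPer f → sob (3 + n + 1) f ≤ R → ∀ x,
      |ev (DX^[n] P.N) f x| ≤ C := fun n => ev_bound (iterate_DX_mem P.nonpar.1 n) R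
  choose C hC h using h
  refine ⟨∑ j ∈ Finset.range (m + 1), (2 * P.γ0 ^ 2 * |R| + 4 * P.γ1 ^ 2 * |R| +
    8 * P.γ2 ^ 2 * |R| + 16 * |R| + 16 * (2 * π * C j ^ 2)),
    Finset.sum_nonneg fun j _ => by positivity, ?_⟩
  intro M f hf hR
  refine Finset.sum_le_sum fun j hj => ?_
  have hj := Finset.mem_range.1 hj
  have cf := fun i => (hf.dx i).continuous
  have cp := (smoothPer_proj M (ev (DX^[j] P.N) f)).continuous
  have ce := (smoothPer_ev (DX^[j] P.N) hf).continuous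
  have b : ∀ i ≤ m + 5, per (fun x => dx i f x ^ 2) ≤ |R| := fun i hi =>
    (per_dx_sq_le_sob hi f).trans (hR.trans (le_abs_self R))
  have b1 := (per_proj_sq_le ce M).trans
    (per_sq_le_of_abs_le ce (h j f hf ((sob_mono (by omega) f).trans hR)))
  rw [dx_vf P M hf]
  have s1 := per_add_sq_le (f := fun x => -((M:ℝ) + 1)⁻¹ * dx (j + 4) f x) (by fun_prop) cp
  have s2 := per_add_sq_le (f := fun x => -P.γ2 * dx (j + 1) f x)
    (g := fun x => -((M:ℝ) + 1)⁻¹ * dx (j + 4) f x + proj M (ev (DX^[j] P.N) f) x)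
    (by fun_prop) (by fun_prop)
  have s3 := per_add_sq_le (f := fun x => -P.γ1 * dx (j + 3) f x)
    (g := fun x => -P.γ2 * dx (j + 1) f x + (-((M:ℝ) + 1)⁻¹ * dx (j + 4) f x +
      proj M (ev (DX^[j] P.N) f) x)) (by fun_prop) (by fun_prop)
  refine (per_add_sq_le (f := fun x => -P.γ0 * dx (j + 5) f x)
    (g := fun x => -P.γ1 * dx (j + 3) f x + (-P.γ2 * dx (j + 1) f x +
      (-((M:ℝ) + 1)⁻¹ * dx (j + 4) f x + proj M (ev (DX^[j] P.N) f) x)))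
      (by fun_prop) (by fun_prop)).trans ?_
  rw [per_const_mul_sq] at s1 s2 s3 ⊢
  rw [neg_sq] at s2 s3 ⊢
  have t0 := mul_le_mul_of_nonneg_left (b (j + 5) (by omega)) (sq_nonneg P.γ0)
  have t1 := mul_le_mul_of_nonneg_left (b (j + 3) (by omega)) (sq_nonneg P.γ1)
  have t2 := mul_le_mul_of_nonneg_left (b (j + 1) (by omega)) (sq_nonneg P.γ2)
  have t3 := mul_le_mul (inv_succ_sq_le M) (b (j + 4) (by omega)) (per_sq_nonneg _) zero_le_one
  linarith

end VectorField

section WeightDerivative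

open Real MeasureTheory Set
open MvPolynomial (X C pderiv)

/-- The linearization of a differential polynomial. -/
noncomputable def linev (m : ℕ) (p : MvPolynomial ℕ ℝ) (f v : ℝ → ℝ) (x : ℝ) : ℝ :=
  lin m p (fun i => dx i f x) (fun i => dx i v x)

/-- The derivative of the weight along `v`. -/
noncomputable def wtDeriv (P : Eqn) (ν : ℝ) (f v : ℝ → ℝ) (x : ℝ) : ℝ :=
  1 / (5 * P.γ0) * (prim (linev 3 (pderiv 2 P.N) f v) x + ν * linev 3 (pderiv 3 P.N) f v x)

lemma smoothPer_linev (m : ℕ) (p : MvPolynomial ℕ ℝ) {f v : ℝ → ℝ} (hf : SmoothPer f)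
    (hv : SmoothPer v) : SmoothPer (linev m p f v) := by
  have h := SmoothPer.sum (s := Finset.range (m + 1)) (F := fun i x => ev (pderiv i p) f x * dx i v x)
    fun i _ => (smoothPer_ev (pderiv i p) hf).mul (hv.dx i)
  exact h

lemma continuous_prim {h : ℝ → ℝ} (hh : Continuous h) : Continuous (prim h) :=
  continuous_iff_continuousAt.2 fun x => (hasDerivAt_prim hh x).continuousAt

lemma continuous_wtDeriv (P : Eqn) (ν : ℝ) {f v : ℝ → ℝ} (hf : SmoothPer f)
    (hv : SmoothPer v) : Continuous (wtDeriv P ν f v) := by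
  have h1 := continuous_prim (smoothPer_linev 3 (pderiv 2 P.N) hf hv).continuous
  have h2 := (smoothPer_linev 3 (pderiv 3 P.N) hf hv).continuous
  unfold wtDeriv
  fun_prop

lemma linev_bound (P : Eqn) {p : MvPolynomial ℕ ℝ} (hp : p ∈ ordLE 3) (R : ℝ) :
    ∃ C, 0 ≤ C ∧ ∀ M f, SmoothPer f → sob 9 f ≤ R → ∀ x, |linev 3 p f (vf P M f) x| ≤ C := by
  obtain ⟨D, hD, hd⟩ := sob_vf_bound P 4 R
  have h : ∀ i, ∃ C, 0 ≤ C ∧ ∀ f, SmoothPer f → sob (3 + 1) f ≤ R → ∀ x,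
      |ev (pderiv i p) f x| ≤ C := fun i => ev_bound (pderiv_mem i hp) R
  choose C hC h using h
  refine ⟨∑ i ∈ Finset.range 4, C i * √(2 * D),
    Finset.sum_nonneg fun i _ => mul_nonneg (hC i) (sqrt_nonneg _), fun M f hf hR x => ?_⟩
  rw [linev, lin]
  refine (Finset.abs_sum_le_sum_abs _ _).trans (Finset.sum_le_sum fun i hi => ?_)
  exact abs_mul_le_mul (h i f hf ((sob_mono (by omega) f).trans hR) x)
    (abs_dx_le_of_sob (smoothPer_vf P M hf) (by have := Finset.mem_range.1 hi; omega)
      (hd M f hf hR) x)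

lemma wtDeriv_bound (P : Eqn) (ν R : ℝ) :
    ∃ C, 0 ≤ C ∧ ∀ M f, SmoothPer f → sob 9 f ≤ R → ∀ x ∈ Icc 0 (2 * π),
      |wtDeriv P ν f (vf P M f) x| ≤ C := by
  obtain ⟨C1, h1, b1⟩ := linev_bound P (pderiv_mem 2 P.nonpar.1) R
  obtain ⟨C2, h2, b2⟩ := linev_bound P (pderiv_mem 3 P.nonpar.1) R
  refine ⟨|1 / (5 * P.γ0)| * (2 * π * C1 + |ν| * C2), by positivity, fun M f hf hR x hx => ?_⟩
  exact abs_mul_le_mul le_rfl ((abs_add_le _ _).trans (add_le_add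
    (abs_prim_le_of_mem (b1 M f hf hR) hx) (abs_mul_le_mul le_rfl (b2 M f hf hR x))))

lemma per_mono_on {f g : ℝ → ℝ} (hf : Continuous f) (hg : Continuous g)
    (h : ∀ x ∈ Icc 0 (2 * π), f x ≤ g x) : per f ≤ per g :=
  intervalIntegral.integral_mono_on (by positivity) (hf.intervalIntegrable _ _)
    (hg.intervalIntegrable _ _) h

lemma per_wtDeriv_le (P : Eqn) (ν R : ℝ) :
    ∃ C, 0 ≤ C ∧ ∀ M f, SmoothPer f → sob 9 f ≤ R → ∀ g, Continuous g →
      per (fun x => wtDeriv P ν f (vf P M f) x * g x ^ 2) ≤ C * per (fun x => g x ^ 2) := by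
  obtain ⟨C, hC, h⟩ := wtDeriv_bound P ν R
  refine ⟨C, hC, fun M f hf hR g hg => ?_⟩
  have := continuous_wtDeriv P ν hf (smoothPer_vf P M hf)
  rw [← per_const_mul]
  exact per_mono_on (by fun_prop) (by fun_prop) fun x hx =>
    mul_le_mul_of_nonneg_right ((le_abs_self _).trans (h M f hf hR x hx)) (sq_nonneg _)

end WeightDerivative

section EnergyLevel

open Real MeasureTheory Set
open MvPolynomial (X C pderiv)

lemma per_ev_DX_sq_le {n : ℕ} {Q : MvPolynomial ℕ ℝ} (hn : 1 ≤ n) (hQ : Q ∈ ordLE (n - 1)) (R : ℝ) :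
    ∃ C, 0 ≤ C ∧ ∀ f, SmoothPer f → sob n f ≤ R →
      per (fun x => ev (DX Q) f x ^ 2) ≤ C * sob n f := by
  have h : ∀ i, ∃ C, 0 ≤ C ∧ ∀ f, SmoothPer f → sob (n - 1 + 1) f ≤ R → ∀ x,
      |ev (pderiv i Q) f x| ≤ C := fun i => ev_bound (pderiv_mem i hQ) R
  choose C hC h using h
  refine ⟨∑ i ∈ Finset.range n, C i ^ 2, Finset.sum_nonneg fun i _ => sq_nonneg _, ?_⟩
  intro f hf hR
  have e : ∀ x, ev (DX Q) f x =
      ∑ i ∈ Finset.range n, ev (pderiv i Q) f x * dx (i + 1) f x := by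
    intro x
    rw [derivation_eq_sum DX hQ, ev_sum, show n - 1 + 1 = n by omega]
    exact Finset.sum_congr rfl fun i _ => by rw [DX_X, ev_mul, ev_X, mul_comm]
  have cd := fun i => (hf.dx i).continuous
  have ce := fun p => (smoothPer_ev p hf).continuous
  have b : per (fun x => ev (DX Q) f x ^ 2) ≤ per (fun x => (∑ i ∈ Finset.range n, C i ^ 2) *
      ∑ i ∈ Finset.range n, dx (i + 1) f x ^ 2) := by
    refine per_mono (by have := ce (DX Q); fun_prop) (by fun_prop) fun x => ?_
    rw [e]
    refine (Finset.sum_mul_sq_le_sq_mul_sq _ _ _).trans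
      (mul_le_mul_of_nonneg_right ?_ (Finset.sum_nonneg fun _ _ => sq_nonneg _))
    refine Finset.sum_le_sum fun i _ => ?_
    have := abs_le.1 (h i f hf (by rwa [show n - 1 + 1 = n by omega]) x)
    exact sq_le_sq' this.1 this.2
  refine b.trans ?_
  rw [per_const_mul, per_sum fun i _ => by fun_prop]
  refine mul_le_mul_of_nonneg_left ?_ (Finset.sum_nonneg fun i _ => sq_nonneg _)
  rw [sob, Finset.sum_range_succ']
  linarith [per_sq_nonneg (dx 0 f)]

/-- The `H¹` size of the lower order terms. -/
lemma lower_order_bound {n : ℕ} (hn : 8 ≤ n) {c0 Q : MvPolynomial ℕ ℝ} (hc0 : c0 ∈ ordLE 6)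
    (hQ : Q ∈ ordLE (n - 1)) (R : ℝ) :
    ∃ C, 0 ≤ C ∧ ∀ f, SmoothPer f → sob n f ≤ R →
      per (fun x => ev (c0 * X n + Q) f x ^ 2) +
        per (fun x => dx 1 (ev (c0 * X n + Q) f) x ^ 2) ≤ C * (1 + sob (n + 1) f) := by
  obtain ⟨C0, p0, h0⟩ := dx_ev_bound hc0 R 1
  obtain ⟨C1, p1, h1⟩ := ev_bound hQ R
  obtain ⟨C2, p2, h2⟩ := per_ev_DX_sq_le (by omega) hQ R
  refine ⟨10 * C0 ^ 2 + 2 * (2 * π * C1 ^ 2) + 4 * C2, by positivity, fun f hf hR => ?_⟩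
  have cd := fun i => (hf.dx i).continuous
  have ce := fun p => (smoothPer_ev p hf).continuous
  have q0 := h0 f hf ((sob_mono (by omega) f).trans hR)
  have q00 : ∀ x, |ev c0 f x| ≤ C0 := fun x => by simpa [dx_zero] using q0 0 (by omega) x
  have q01 : ∀ x, |ev (DX c0) f x| ≤ C0 := fun x => by
    have := q0 1 le_rfl x
    rwa [dx_ev _ hf] at this
  have q1 := h1 f hf (by rwa [show n - 1 + 1 = n by omega])
  have q2 := h2 f hf hR
  have e0 : ev (c0 * X n + Q) f = fun x => ev c0 f x * dx n f x + ev Q f x := by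
    funext x; rw [ev_add, ev_mul, ev_X]
  have e1 : dx 1 (ev (c0 * X n + Q) f) = fun x => ev c0 f x * dx (n + 1) f x +
      (ev (DX c0) f x * dx n f x + ev (DX Q) f x) := by
    rw [dx_ev _ hf]
    funext x
    simp only [Function.iterate_one, map_add, Derivation.leibniz, DX_X, smul_eq_mul, ev_add, ev_mul,
      ev_X]
    ring
  have s0 := sob_mono (show n ≤ n + 1 by omega) f
  have s1 := per_dx_sq_le_sob (show n ≤ n + 1 by omega) f
  have s2 := per_dx_sq_le_sob (le_refl (n + 1)) f
  have s3 := sob_nonneg (n + 1) f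
  have a1 := per_add_sq_le (f := fun x => ev c0 f x * dx n f x) (g := ev Q f) (by fun_prop) (ce Q)
  have a2 := per_mul_sq_le (ce c0) (cd n) q00
  have a3 := per_sq_le_of_abs_le (ce Q) q1
  have a4 := per_add_sq_le (f := fun x => ev c0 f x * dx (n + 1) f x)
    (g := fun x => ev (DX c0) f x * dx n f x + ev (DX Q) f x) (by fun_prop) (by fun_prop)
  have a5 := per_mul_sq_le (ce c0) (cd (n + 1)) q00
  have a6 := per_add_sq_le (f := fun x => ev (DX c0) f x * dx n f x) (g := ev (DX Q) f)
    (by fun_prop) (ce (DX Q))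
  have a7 := per_mul_sq_le (ce (DX c0)) (cd n) q01
  rw [e1, e0]
  have t1 := mul_le_mul_of_nonneg_left s1 (sq_nonneg C0)
  have t2 := mul_le_mul_of_nonneg_left s2 (sq_nonneg C0)
  have t3 := mul_le_mul_of_nonneg_left s0 p2
  have t4 : 0 ≤ 2 * (2 * π * C1 ^ 2) * sob (n + 1) f := by positivity
  have t5 : 0 ≤ C0 ^ 2 * sob (n + 1) f := by positivity
  have t6 := sq_nonneg C0
  linarith

lemma energy_level (P : Eqn) {n : ℕ} (hn : 9 ≤ n) (K0 R : ℝ) :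
    ∃ K, 0 ≤ K ∧ ∀ M f, SmoothPer f → proj M f = f → sob n f ≤ R →
      per (fun x => dx 1 (dx n f) x * dx 1 (dx n (vf P M f)) x) +
        2 * per (fun x => wt P.γ0 P.N K0 (n - 1 / 2) f x * dx n f x * dx n (vf P M f) x) +
        per (fun x => wtDeriv P (n - 1 / 2) f (vf P M f) x * dx n f x ^ 2) ≤
      K * (1 + sob (n + 1) f) := by
  obtain ⟨c1, hc1, c0, hc0, Q, hQ, hexp⟩ := iterate_DX_expansion P.nonpar.1 (show 7 ≤ n by omega)
  set A := pderiv 3 P.N with hA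
  set B := pderiv 2 P.N + (n : ℝ) • DX A with hB
  have mA : A ∈ ordLE 3 := pderiv_mem 3 P.nonpar.1
  have mB : B ∈ ordLE 4 :=
    add_mem (ordLE_mono (by omega) (pderiv_mem 2 P.nonpar.1)) (Subalgebra.smul_mem _ (DX_mem mA) _)
  obtain ⟨CA, pA, bA⟩ := dx_ev_bound mA R 2
  obtain ⟨CB, pB, bB⟩ := dx_ev_bound mB R 1
  obtain ⟨CC, pC, bC⟩ := dx_ev_bound hc1 R 1
  obtain ⟨CW, pW, bW⟩ := wt_dx_bound (γ0 := P.γ0) P.nonpar K0 (n - 1 / 2) R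
  obtain ⟨CL, pL, bL⟩ := lower_order_bound (by omega) hc0 hQ R
  obtain ⟨CD, pD, bD⟩ := per_wtDeriv_le P (n - 1 / 2) R
  set K1 := CA + CB + CC + CW with hK1
  obtain ⟨K, pK, bK⟩ := energy_static P.γ0 P.γ1 P.γ2 (K1 := K1) (by positivity)
  set CF := 1 + 8 * (K1 ^ 2 + CL) with hCF
  refine ⟨K * (2 + CL) + (4 * (CF + 1) * (4 * K1 ^ 2) + 1) + CD, by positivity, ?_⟩
  intro M f hf hM hR
  have hR9 : ∀ i ≤ 9, sob i f ≤ R := fun i hi => (sob_mono (by omega) f).trans hR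
  have se := fun p => smoothPer_ev p hf
  have sg := hf.dx n
  have sw := (sd_wt (γ0 := P.γ0) P.nonpar K0 (n - 1 / 2) hf).1
  have sV := smoothPer_vf P M hf
  have cd := fun i => (hf.dx i).continuous
  have ce := fun p => (se p).continuous
  have cw := sw.continuous
  set g := dx n f with hg
  set w := wt P.γ0 P.N K0 (n - 1 / 2) f with hw
  have eg : ∀ i, dx i g = dx (n + i) f := fun i => by rw [hg, dx_dx, add_comm]
  have hF : ∀ x, ev (DX^[n] P.N) f x = ev A f x * dx 3 g x + ev B f x * dx 2 g x +
      ev c1 f x * dx 1 g x + ev (c0 * X n + Q) f x := by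
    intro x
    rw [hexp]
    simp only [ev_add, ev_mul, ev_X, eg]
    ring
  set Z : ℝ → ℝ := fun x => -((M:ℝ) + 1)⁻¹ * dx 4 g x -
    (ev (DX^[n] P.N) f x - proj M (ev (DX^[n] P.N) f) x) with hZ
  have sZ : SmoothPer Z := ((sg.dx 4).const_mul _).sub ((se _).sub (smoothPer_proj M _))
  have k1 : ∀ i ≤ 2, ∀ x, |dx i (ev A f) x| ≤ K1 := fun i hi x =>
    (bA f hf (hR9 _ (by omega)) i hi x).trans (by rw [hK1]; linarith)
  have k2 : ∀ i ≤ 1, ∀ x, |dx i (ev B f) x| ≤ K1 := fun i hi x =>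
    (bB f hf (hR9 _ (by omega)) i hi x).trans (by rw [hK1]; linarith)
  have k3 : ∀ i ≤ 1, ∀ x, |dx i (ev c1 f) x| ≤ K1 := fun i hi x =>
    (bC f hf (hR9 _ (by omega)) i hi x).trans (by rw [hK1]; linarith)
  have k4 : ∀ i ≤ 4, ∀ x, |dx i w x| ≤ K1 := fun i hi x =>
    (bW f hf (hR9 _ (by omega)) i hi x).trans (by rw [hK1]; linarith)
  have hst := bK g (ev A f) (ev B f) (ev c1 f) w (ev (c0 * X n + Q) f) Z (dx n (vf P M f))
    sg (se _) (se _) (se _) sw (se _) sZ (sV.dx n) k1 k2 k3 k4 ?_ ?_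
  rotate_left
  · intro x
    rw [dx_vf P M hf, hZ, eg, eg, eg, eg, eg]
    simp only
    rw [hF]
    simp only [eg]
    ring
  · intro x
    rw [wt_dx_one P.ne_zero P.nonpar K0 _ hf, dx_ev _ hf, Function.iterate_one, hB, ev_add]
    have : ev ((n:ℝ) • DX A) f x = n * ev (DX A) f x := by simp [ev]
    rw [this]
    ring
  set Y := sob (n + 1) f with hY
  have y0 : 0 ≤ Y := sob_nonneg _ _
  have yg : per (fun x => g x ^ 2) ≤ Y := per_dx_sq_le_sob (by omega) f
  have yg1 : per (fun x => dx 1 g x ^ 2) ≤ Y := by rw [eg]; exact per_dx_sq_le_sob le_rfl f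
  have yL := bL f hf hR
  rw [← hY] at yL
  have nL0 := per_sq_nonneg (ev (c0 * X n + Q) f)
  have nL1 := per_sq_nonneg (dx 1 (ev (c0 * X n + Q) f))
  have cg := fun i => (sg.dx i).continuous
  have hvisc := viscosity_absorbs (Y := 1 + Y) (CF := CF) sg
    (by rw [hg, ← dx_proj hf, hM]) sw (se (DX^[n] P.N)) (Z := Z)
    (by rw [hCF]; nlinarith [sq_nonneg K1]) (by linarith) ?_ (fun x => rfl)
  swap
  · rw [funext hF]
    have k1' : ∀ x, |ev A f x| ≤ K1 := fun x => by simpa [dx_zero] using k1 0 (by omega) x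
    have k2' : ∀ x, |ev B f x| ≤ K1 := fun x => by simpa [dx_zero] using k2 0 (by omega) x
    have k3' : ∀ x, |ev c1 f x| ≤ K1 := fun x => by simpa [dx_zero] using k3 0 (by omega) x
    have a1 := per_add_sq_le (f := fun x => ev A f x * dx 3 g x + ev B f x * dx 2 g x +
      ev c1 f x * dx 1 g x) (g := ev (c0 * X n + Q) f) (by fun_prop) (ce _)
    have a2 := per_add_sq_le (f := fun x => ev A f x * dx 3 g x + ev B f x * dx 2 g x)
      (g := fun x => ev c1 f x * dx 1 g x) (by fun_prop) (by fun_prop)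
    have a3 := per_add_sq_le (f := fun x => ev A f x * dx 3 g x)
      (g := fun x => ev B f x * dx 2 g x) (by fun_prop) (by fun_prop)
    have a4 := per_mul_sq_le (ce A) (cg 3) k1'
    have a5 := per_mul_sq_le (ce B) (cg 2) k2'
    have a6 := per_mul_sq_le (ce c1) (cg 1) k3'
    have n3 := per_sq_nonneg (dx 3 g)
    have n2 := per_sq_nonneg (dx 2 g)
    have t1 := mul_le_mul_of_nonneg_left yg1 (sq_nonneg K1)
    have t2 : 0 ≤ K1 ^ 2 * (1 + Y) := by positivity
    have t3 : 0 ≤ CL * per (fun x => dx 3 g x ^ 2) := by positivity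
    have t4 : 0 ≤ CL * per (fun x => dx 2 g x ^ 2) := by positivity
    have t5 : 0 ≤ K1 ^ 2 * per (fun x => dx 3 g x ^ 2) := by positivity
    have t6 : 0 ≤ K1 ^ 2 * per (fun x => dx 2 g x ^ 2) := by positivity
    have t7 : 0 ≤ CL * (1 + Y) := by positivity
    rw [hCF]
    linarith [sq_nonneg K1]
  have hwg : per (fun x => dx 1 (fun x => w x * g x) x ^ 2) ≤ 4 * K1 ^ 2 * (1 + Y) := by
    have e : dx 1 (fun x => w x * g x) = fun x => dx 1 w x * g x + w x * dx 1 g x := by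
      have := (SD.dx sw 0).mul (SD.dx sg 0)
      simp only [dx_zero] at this
      exact this.eq_dx.symm
    rw [e]
    have cw1 := (sw.dx 1).continuous
    have cg0 := sg.continuous
    have a1 := per_add_sq_le (f := fun x => dx 1 w x * g x) (g := fun x => w x * dx 1 g x)
      (by fun_prop) (by fun_prop)
    have a2 := per_mul_sq_le cw1 cg0 (k4 1 (by omega))
    have a3 := per_mul_sq_le cw (cg 1) (fun x => by simpa [dx_zero] using k4 0 (by omega) x)
    have t1 := mul_le_mul_of_nonneg_left yg (sq_nonneg K1)
    have t2 := mul_le_mul_of_nonneg_left yg1 (sq_nonneg K1)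
    linarith [sq_nonneg K1]
  have hD := bD M f hf (hR9 9 le_rfl) g sg.continuous
  have r1 : K * (per (fun x => g x ^ 2) + per (fun x => dx 1 g x ^ 2) +
      per (fun x => ev (c0 * X n + Q) f x ^ 2) +
      per (fun x => dx 1 (ev (c0 * X n + Q) f) x ^ 2)) ≤ K * ((2 + CL) * (1 + Y)) :=
    mul_le_mul_of_nonneg_left (by linarith) pK
  have r2 := mul_le_mul_of_nonneg_left hwg (show 0 ≤ 4 * (CF + 1) by positivity)
  have r3 := mul_le_mul_of_nonneg_left yg pD
  linarith

end EnergyLevel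

section Separable

open Real MeasureTheory Set
open MvPolynomial (X C pderiv)

variable {V : Type*} [NormedAddCommGroup V] [NormedSpace ℝ V]

/-- Finite sums of products of a `C¹` function of the parameter and a continuous function
of the space variable. -/
inductive Sep : (V → ℝ → ℝ) → Prop
  | base {p : V → ℝ} {φ : ℝ → ℝ} (hp : ContDiff ℝ 1 p) (hφ : Continuous φ) :
      Sep fun c x => p c * φ x
  | add {h k : V → ℝ → ℝ} (hh : Sep h) (hk : Sep k) : Sep fun c x => h c x + k c x

namespace Sep

variable {h k : V → ℝ → ℝ}

lemma continuous (hh : Sep h) (c : V) : Continuous (h c) := by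
  induction hh with
  | base hp hφ => fun_prop
  | add _ _ ih1 ih2 => exact ih1.add ih2

lemma contDiff_integral (hh : Sep h) (y : ℝ) : ContDiff ℝ 1 fun c => ∫ x in (0:ℝ)..y, h c x := by
  induction hh with
  | @base p φ hp hφ =>
    rw [show (fun c => ∫ x in (0:ℝ)..y, p c * φ x) = fun c => p c * ∫ x in (0:ℝ)..y, φ x from
      funext fun c => intervalIntegral.integral_const_mul _ _]
    exact hp.mul contDiff_const
  | @add h k h1 h2 ih1 ih2 =>
    rw [show (fun c => ∫ x in (0:ℝ)..y, (h c x + k c x)) =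
        fun c => (∫ x in (0:ℝ)..y, h c x) + ∫ x in (0:ℝ)..y, k c x from
      funext fun c => intervalIntegral.integral_add ((h1.continuous c).intervalIntegrable 0 y)
        ((h2.continuous c).intervalIntegrable 0 y)]
    exact ih1.add ih2

lemma contDiff_per (hh : Sep h) : ContDiff ℝ 1 fun c => per (h c) := hh.contDiff_integral _

lemma exists_deriv (hh : Sep h) {c : ℝ → V} {c' : V} {t : ℝ} (hc : HasDerivAt c c' t) :
    ∃ D : ℝ → ℝ, Continuous D ∧ (∀ x, HasDerivAt (fun τ => h (c τ) x) (D x) t) ∧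
      ∀ y, HasDerivAt (fun τ => ∫ x in (0:ℝ)..y, h (c τ) x) (∫ x in (0:ℝ)..y, D x) t := by
  induction hh with
  | @base p φ hp hφ =>
    have hd := ((hp.differentiable one_ne_zero) (c t)).hasFDerivAt.comp_hasDerivAt t hc
    refine ⟨fun x => fderiv ℝ p (c t) c' * φ x, by fun_prop, fun x => hd.mul_const _, fun y => ?_⟩
    rw [show (fun τ => ∫ x in (0:ℝ)..y, p (c τ) * φ x) = fun τ => p (c τ) * ∫ x in (0:ℝ)..y, φ x
      from funext fun c => intervalIntegral.integral_const_mul _ _,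
      intervalIntegral.integral_const_mul]
    exact hd.mul_const _
  | @add h k h1 h2 ih1 ih2 =>
    obtain ⟨D1, d1, e1, f1⟩ := ih1
    obtain ⟨D2, d2, e2, f2⟩ := ih2
    refine ⟨fun x => D1 x + D2 x, d1.add d2, fun x => (e1 x).add (e2 x), fun y => ?_⟩
    rw [show (fun τ => ∫ x in (0:ℝ)..y, (h (c τ) x + k (c τ) x)) =
        fun τ => (∫ x in (0:ℝ)..y, h (c τ) x) + ∫ x in (0:ℝ)..y, k (c τ) x from
      funext fun τ => intervalIntegral.integral_add
        ((h1.continuous (c τ)).intervalIntegrable 0 y)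
        ((h2.continuous (c τ)).intervalIntegrable 0 y),
      intervalIntegral.integral_add (d1.intervalIntegrable _ _) (d2.intervalIntegrable _ _)]
    exact (f1 y).add (f2 y)

lemma hasDerivAt_integral (hh : Sep h) {c : ℝ → V} {c' : V} {t : ℝ} (hc : HasDerivAt c c' t)
    {D : ℝ → ℝ} (hD : ∀ x, HasDerivAt (fun τ => h (c τ) x) (D x) t) (y : ℝ) :
    HasDerivAt (fun τ => ∫ x in (0:ℝ)..y, h (c τ) x) (∫ x in (0:ℝ)..y, D x) t := by
  obtain ⟨D', _, h1, h2⟩ := hh.exists_deriv hc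
  rw [show D = D' from funext fun x => (hD x).unique (h1 x)]
  exact h2 y

lemma congr (hh : Sep h) (e : ∀ c x, h c x = k c x) : Sep k := by
  rwa [show k = h from funext fun c => funext fun x => (e c x).symm]

lemma const (φ : ℝ → ℝ) (hφ : Continuous φ) : Sep fun (_ : V) x => φ x :=
  (base (p := fun _ : V => 1) contDiff_const hφ).congr fun _ _ => one_mul _

lemma coef_mul {p : V → ℝ} (hp : ContDiff ℝ 1 p) (hh : Sep h) : Sep fun c x => p c * h c x := by
  induction hh with
  | base hq hφ => exact (base (hp.mul hq) hφ).congr fun c x => by ring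
  | add _ _ ih1 ih2 => exact (ih1.add ih2).congr fun c x => by ring

lemma mul_const {φ : ℝ → ℝ} (hφ : Continuous φ) (hh : Sep h) : Sep fun c x => φ x * h c x := by
  induction hh with
  | base hq hψ => exact (base hq (hφ.mul hψ)).congr fun c x => by simp only [Pi.mul_apply]; ring
  | add _ _ ih1 ih2 => exact (ih1.add ih2).congr fun c x => by ring

lemma mul (hh : Sep h) (hk : Sep k) : Sep fun c x => h c x * k c x := by
  induction hh with
  | base hp hφ => exact (coef_mul hp (mul_const hφ hk)).congr fun c x => by ring
  | add _ _ ih1 ih2 => exact (ih1.add ih2).congr fun c x => by ring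

lemma const_mul (r : ℝ) (hh : Sep h) : Sep fun c x => r * h c x := coef_mul contDiff_const hh

lemma sub (hh : Sep h) (hk : Sep k) : Sep fun c x => h c x - k c x :=
  (hh.add (hk.const_mul (-1))).congr fun c x => by ring

lemma pow (hh : Sep h) (n : ℕ) : Sep fun c x => h c x ^ n := by
  induction n with
  | zero => simpa using const (V := V) (fun _ => 1) continuous_const
  | succ n ih => exact (ih.mul hh).congr fun c x => (pow_succ _ _).symm

lemma sum {ι : Type*} (s : Finset ι) {H : ι → V → ℝ → ℝ} (hH : ∀ i ∈ s, Sep (H i)) :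
    Sep fun c x => ∑ i ∈ s, H i c x := by
  classical
  induction s using Finset.induction_on with
  | empty => simpa using const (V := V) (fun _ => 0) continuous_const
  | insert i s hi ih =>
    refine ((hH i (by simp)).add (ih fun j hj => hH j (by simp [hj]))).congr fun c x => ?_
    rw [Finset.sum_insert hi]

lemma prim (hh : Sep h) : Sep fun c => prim (h c) := by
  induction hh with
  | @base p φ hp hφ =>
    refine (base hp (continuous_prim hφ)).congr fun c x => ?_
    rw [FifthOrderStmt0.prim, FifthOrderStmt0.prim, intervalIntegral.integral_const_mul]
  | add h1 h2 ih1 ih2 =>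
    refine (ih1.add ih2).congr fun c x => ?_
    rw [FifthOrderStmt0.prim, FifthOrderStmt0.prim, FifthOrderStmt0.prim,
      intervalIntegral.integral_add ((h1.continuous c).intervalIntegrable _ _)
      ((h2.continuous c).intervalIntegrable _ _)]

lemma comp {W : Type*} [NormedAddCommGroup W] [NormedSpace ℝ W] (hh : Sep h) {q : W → V}
    (hq : ContDiff ℝ 1 q) : Sep fun c => h (q c) := by
  induction hh with
  | base hp hφ => exact base (hp.comp hq) hφ
  | add _ _ ih1 ih2 => exact ih1.add ih2

lemma ev {F : V → ℝ → ℝ} (hF : ∀ j, Sep fun c => dx j (F c)) (p : MvPolynomial ℕ ℝ) :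
    Sep fun c => ev p (F c) := by
  induction p using MvPolynomial.induction_on with
  | C r => exact (const (V := V) (fun _ => r) continuous_const).congr fun c x => (ev_C _ _ _).symm
  | add p q hp hq => exact (hp.add hq).congr fun c x => (ev_add _ _ _ _).symm
  | mul_X p i hp => exact (hp.mul (hF i)).congr fun c x => by rw [ev_mul, ev_X]

lemma wt {F : V → ℝ → ℝ} (hF : ∀ j, Sep fun c => dx j (F c)) (γ0 K0 ν : ℝ)
    (N : MvPolynomial ℕ ℝ) : Sep fun c => wt γ0 N K0 ν (F c) :=
  (const (V := V) (fun _ => K0) continuous_const).add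
    (((Sep.ev hF _).prim.add ((Sep.ev hF _).const_mul ν)).const_mul _)

end Sep

end Separable

section Galerkin

open Real MeasureTheory Set
open MvPolynomial (X C pderiv)

/-- Trigonometric polynomials of degree `M`, parametrized by a finite dimensional space. -/
noncomputable def emb (M : ℕ) (c : freq M → ℝ) : ℝ → ℝ :=
  tp M fun k => if h : k ∈ freq M then c ⟨k, h⟩ else 0

lemma emb_restrict (M : ℕ) (a : ℤ → ℝ) : emb M (fun k => a k) = tp M a :=
  tp_congr fun k hk => by simp [hk]

lemma dx_emb (M j : ℕ) (c : freq M → ℝ) (x : ℝ) :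
    dx j (emb M c) x = ∑ k : freq M, c k * dx j (cas k) x := by
  rw [emb, dx_tp_eq_sum, ← Finset.sum_coe_sort]
  exact Finset.sum_congr rfl fun k _ => by rw [dif_pos k.2]

lemma smoothPer_emb (M : ℕ) (c : freq M → ℝ) : SmoothPer (emb M c) := smoothPer_tp _ _

lemma sep_emb (M j : ℕ) : Sep fun c => dx j (emb M c) :=
  (Sep.sum Finset.univ (H := fun (k : freq M) (c : freq M → ℝ) x => c k * dx j (cas k) x)
    fun k _ => Sep.base (contDiff_apply ℝ ℝ k) ((smoothPer_cas k).dx j).continuous).congr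
      fun c x => (dx_emb M j c x).symm

lemma sep_vf (P : Eqn) (M : ℕ) : Sep fun c => vf P M (emb M c) := by
  have h1 : Sep fun c => proj M (ev P.N (emb M c)) :=
    Sep.sum (freq M) fun k _ => Sep.base (p := fun c => hc (ev P.N (emb M c)) k)
      (contDiff_const.mul ((Sep.ev (sep_emb M) P.N).mul
        (Sep.const _ (continuous_cas k))).contDiff_per) (continuous_cas k)
  exact ((((((sep_emb M 5).const_mul (-P.γ0)).sub ((sep_emb M 3).const_mul P.γ1)).sub
    ((sep_emb M 1).const_mul P.γ2)).sub ((sep_emb M 4).const_mul _)).add h1)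

lemma contDiff_sob (M m : ℕ) : ContDiff ℝ 1 fun c => sob m (emb M c) :=
  ContDiff.sum fun j _ => ((sep_emb M j).pow 2).contDiff_per

lemma proj_tp (M : ℕ) (c : ℤ → ℝ) : proj M (tp M c) = tp M c :=
  tp_congr fun _ hk => hc_of_mem hk

lemma proj_emb (M : ℕ) (c : freq M → ℝ) : proj M (emb M c) = emb M c := proj_tp _ _

lemma proj_vf (P : Eqn) (M : ℕ) {f : ℝ → ℝ} (hf : proj M f = f) :
    proj M (vf P M f) = vf P M f := by
  have h : vf P M f = tp M fun k => -P.γ0 * hderiv^[5] (hc f) k - P.γ1 * hderiv^[3] (hc f) k -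
      P.γ2 * hderiv^[1] (hc f) k - ((M:ℝ) + 1)⁻¹ * hderiv^[4] (hc f) k + hc (ev P.N f) k := by
    have e : ∀ j, dx j f = tp M (hderiv^[j] (hc f)) := fun j => by
      conv_lhs => rw [← hf]
      rw [proj, dx_tp]
    funext x
    rw [vf, e, e, e, e, proj]
    simp only [tp, Finset.mul_sum, ← Finset.sum_sub_distrib, ← Finset.sum_add_distrib]
    exact Finset.sum_congr rfl fun k _ => by ring
  rw [h, proj_tp]

/-- The truncated vector field in coordinates. -/
noncomputable def field (P : Eqn) (M : ℕ) (R : ℝ) (c : freq M → ℝ) (k : freq M) : ℝ :=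
  smoothTransition (R + 1 - sob 12 (emb M c)) * hc (vf P M (emb M c)) k

lemma contDiff_field (P : Eqn) (M : ℕ) (R : ℝ) : ContDiff ℝ 1 (field P M R) := by
  refine contDiff_pi.2 fun k => ?_
  exact (smoothTransition.contDiff.comp (contDiff_const.sub (contDiff_sob M 12))).mul
    (contDiff_const.mul ((sep_vf P M).mul (Sep.const _ (continuous_cas k))).contDiff_per)

lemma hasCompactSupport_field (P : Eqn) (M : ℕ) (R : ℝ) : HasCompactSupport (field P M R) := by
  refine HasCompactSupport.intro (isCompact_closedBall (0 : freq M → ℝ) (|R| + 1)) fun c hc' => ?_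
  suffices h : R + 1 ≤ sob 12 (emb M c) by
    funext k
    rw [field, smoothTransition.zero_of_nonpos (by linarith), zero_mul]; rfl
  by_contra! hlt
  refine hc' (mem_closedBall_zero_iff.2 ((pi_norm_le_iff_of_nonneg (by positivity)).2 fun k => ?_))
  have h1 := per_dx_sq_le_sob (show 0 ≤ 12 by omega) (emb M c)
  rw [emb, per_dx_tp_sq] at h1
  have h2 := Finset.single_le_sum (s := freq M) (f := fun l : ℤ => (l:ℝ) ^ (2 * 0) *
    (if h : l ∈ freq M then c ⟨l, h⟩ else (0:ℝ)) ^ 2)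
    (fun l _ => mul_nonneg (by simp) (sq_nonneg _)) k.2
  simp only [mul_zero, pow_zero, one_mul, k.2, dif_pos] at h1 h2
  rw [← emb] at h1
  have h3 : c k ^ 2 ≤ (|R| + 1) ^ 2 := by
    have hpi := Real.pi_gt_three
    have h4 : c k ^ 2 ≤ |R| + 1 := by
      have := le_abs_self R
      nlinarith [sq_nonneg (c k)]
    nlinarith [abs_nonneg R]
  exact abs_le_of_sq_le_sq h3 (by positivity)

lemma exists_curve (P : Eqn) (M : ℕ) (R : ℝ) (c0 : freq M → ℝ) :
    ∃ c : ℝ → freq M → ℝ, c 0 = c0 ∧ ∀ t ∈ Ioo (-2 : ℝ) 2, HasDerivAt c (field P M R (c t)) t := by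
  have hC := contDiff_field P M R
  have hS := hasCompactSupport_field P M R
  obtain ⟨K, hK⟩ := hC.lipschitzWith_of_hasCompactSupport hS one_ne_zero
  obtain ⟨L, hL⟩ := hS.exists_bound_of_continuous hC.continuous
  have hL0 : 0 ≤ L := (norm_nonneg _).trans (hL c0)
  have hPL : IsPicardLindelof (fun _ => field P M R) (tmin := -2) (tmax := 2) ⟨0, by norm_num⟩ c0
      (⟨L, hL0⟩ * 2) 0 ⟨L, hL0⟩ K :=
    { lipschitzOnWith := fun _ _ => hK.lipschitzOnWith
      continuousOn := fun _ _ => continuousOn_const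
      norm_le := fun _ _ x _ => hL x
      mul_max_le := by simpa using (NNReal.coe_mul ⟨L, hL0⟩ 2).ge }
  obtain ⟨c, h0, h1⟩ := hPL.exists_eq_forall_mem_Icc_hasDerivWithinAt₀
  exact ⟨c, h0, fun t ht => (h1 t (Ioo_subset_Icc_self ht)).hasDerivAt
    (Icc_mem_nhds ht.1 ht.2)⟩

end Galerkin

section Apriori

open Real MeasureTheory Set
open MvPolynomial (X C pderiv)

lemma hasDerivAt_dx_emb {M : ℕ} {c : ℝ → freq M → ℝ} {v : ℝ → ℝ} (hv : proj M v = v) {t χ : ℝ}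
    (h : HasDerivAt c (fun k => χ * hc v k) t) (j : ℕ) (x : ℝ) :
    HasDerivAt (fun τ => dx j (emb M (c τ)) x) (χ * dx j v x) t := by
  simp_rw [dx_emb]
  have h1 := HasDerivAt.fun_sum (u := Finset.univ) fun (k : freq M) _ =>
    (hasDerivAt_pi.1 h k).mul_const (dx j (cas k) x)
  refine h1.congr_deriv ?_
  conv_rhs => rw [← hv, proj, dx_tp_eq_sum, ← Finset.sum_coe_sort, Finset.mul_sum]
  exact Finset.sum_congr rfl fun k _ => by ring

lemma hasDerivAt_wt (P : Eqn) {M : ℕ} {c : ℝ → freq M → ℝ} {v : ℝ → ℝ} (hvM : proj M v = v)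
    {t χ : ℝ} (h : HasDerivAt c (fun k => χ * hc v k) t) (K0 ν x : ℝ) :
    HasDerivAt (fun τ => wt P.γ0 P.N K0 ν (emb M (c τ)) x)
      (χ * wtDeriv P ν (emb M (c t)) v x) t := by
  have hl : ∀ p ∈ ordLE 3, ∀ x, HasDerivAt (fun τ => ev p (emb M (c τ)) x)
      (χ * linev 3 p (emb M (c t)) v x) t := fun p hp x => by
    have := hasDerivAt_eval hp (y := fun τ i => dx i (emb M (c τ)) x)
      (z := fun i => χ * dx i v x) (t := t) fun i _ => hasDerivAt_dx_emb hvM h i x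
    refine this.congr_deriv ?_
    rw [linev, lin, lin, Finset.mul_sum]
    exact Finset.sum_congr rfl fun k _ => by ring
  have h1 := (Sep.ev (sep_emb M) (pderiv 2 P.N)).hasDerivAt_integral h
    (hl _ (pderiv_mem 2 P.nonpar.1)) x
  rw [intervalIntegral.integral_const_mul] at h1
  have h2 := ((h1.add ((hl _ (pderiv_mem 3 P.nonpar.1) x).const_mul ν)).const_mul
    (1 / (5 * P.γ0))).const_add K0
  refine h2.congr_deriv ?_
  rw [wtDeriv, prim]
  ring

lemma hasDerivAt_energy {V : Type*} [NormedAddCommGroup V] [NormedSpace ℝ V]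
    {h1 h0 w : V → ℝ → ℝ} (s1 : Sep h1) (s0 : Sep h0) (sw : Sep w) {c : ℝ → V} {c' : V} {t : ℝ}
    (hc : HasDerivAt c c' t) {D1 D0 Dw : ℝ → ℝ}
    (k0 : Continuous D0) (kw : Continuous Dw)
    (d1 : ∀ x, HasDerivAt (fun τ => h1 (c τ) x) (D1 x) t)
    (d0 : ∀ x, HasDerivAt (fun τ => h0 (c τ) x) (D0 x) t)
    (dw : ∀ x, HasDerivAt (fun τ => w (c τ) x) (Dw x) t) :
    HasDerivAt (fun τ => 1 / 2 * per (fun x => h1 (c τ) x ^ 2) +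
        per (fun x => w (c τ) x * h0 (c τ) x ^ 2))
      (per (fun x => h1 (c t) x * D1 x) + 2 * per (fun x => w (c t) x * h0 (c t) x * D0 x) +
        per (fun x => Dw x * h0 (c t) x ^ 2)) t := by
  have e1 := (s1.pow 2).hasDerivAt_integral hc (fun x => (d1 x).pow 2) (2 * π)
  have e2 := (sw.mul (s0.pow 2)).hasDerivAt_integral hc (fun x => (dw x).mul ((d0 x).pow 2)) (2 * π)
  have c1 := s1.continuous (c t)
  have c0 := s0.continuous (c t)
  have cw := sw.continuous (c t)
  refine ((e1.const_mul (1 / 2)).add e2).congr_deriv ?_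
  have a1 : (∫ x in (0:ℝ)..2 * π, ((2:ℕ):ℝ) * h1 (c t) x ^ (2 - 1) * D1 x) =
      2 * per (fun x => h1 (c t) x * D1 x) := by
    rw [← per_const_mul]
    exact intervalIntegral.integral_congr fun x _ => by simp; ring
  have a2 : (∫ x in (0:ℝ)..2 * π, (Dw x * h0 (c t) x ^ 2 +
        w (c t) x * (((2:ℕ):ℝ) * h0 (c t) x ^ (2 - 1) * D0 x))) =
      2 * per (fun x => w (c t) x * h0 (c t) x * D0 x) + per (fun x => Dw x * h0 (c t) x ^ 2) := by
    rw [← per_const_mul, ← per_add (by fun_prop) (by fun_prop)]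
    exact intervalIntegral.integral_congr fun x _ => by simp; ring
  rw [a1, a2]
  ring

lemma hasDerivAt_sob {M : ℕ} {c : ℝ → freq M → ℝ} {v : ℝ → ℝ} (sv : SmoothPer v)
    (hv : proj M v = v) {t χ : ℝ} (h : HasDerivAt c (fun k => χ * hc v k) t) (m : ℕ) :
    ∃ E', HasDerivAt (fun τ => sob m (emb M (c τ))) (χ * E') t ∧
      E' ≤ sob m (emb M (c t)) + sob m v := by
  refine ⟨∑ j ∈ Finset.range (m + 1), per (fun x => 2 * (dx j (emb M (c t)) x * dx j v x)), ?_, ?_⟩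
  · rw [Finset.mul_sum]
    refine HasDerivAt.fun_sum fun j _ => ?_
    refine (((sep_emb M j).pow 2).hasDerivAt_integral h
      (fun x => (hasDerivAt_dx_emb hv h j x).pow 2) (2 * π)).congr_deriv ?_
    rw [← per_const_mul]
    exact intervalIntegral.integral_congr fun x _ => by simp; ring
  · rw [sob, sob, ← Finset.sum_add_distrib]
    refine Finset.sum_le_sum fun j _ => ?_
    have c1 := ((smoothPer_emb M (c t)).dx j).continuous
    have c2 := (sv.dx j).continuous
    rw [← per_add (by fun_prop) (by fun_prop)]
    exact per_mono (by fun_prop) (by fun_prop) fun x => by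
      nlinarith [sq_nonneg (dx j (emb M (c t)) x - dx j v x)]

lemma le_add_mul_of_hasDerivAt {E E' : ℝ → ℝ} {T K : ℝ}
    (h : ∀ t ∈ Icc 0 T, HasDerivAt E (E' t) t) (b : ∀ t ∈ Icc 0 T, E' t ≤ K)
    {t : ℝ} (ht : t ∈ Icc 0 T) : E t ≤ E 0 + K * t := by
  have hd : ∀ τ ∈ Icc 0 T, HasDerivAt (fun τ => E τ - K * τ) (E' τ - K) τ := fun τ hτ => 
    ((h τ hτ).fun_sub ((hasDerivAt_id τ).const_mul K)).congr_deriv (by ring)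
  have := antitoneOn_of_deriv_nonpos (convex_Icc 0 T)
    (fun τ hτ => (hd τ hτ).continuousAt.continuousWithinAt)
    (fun τ hτ => (hd τ (interior_subset hτ)).differentiableAt.differentiableWithinAt)
    (fun τ hτ => by rw [(hd τ (interior_subset hτ)).deriv]; linarith [b τ (interior_subset hτ)])
    (left_mem_Icc.2 (ht.1.trans ht.2)) ht ht.1
  simp only at this
  linarith

lemma gronwall_of_hasDerivAt {E E' : ℝ → ℝ} {T K A : ℝ}
    (h : ∀ t ∈ Icc 0 T, HasDerivAt E (E' t) t) (b : ∀ t ∈ Icc 0 T, E' t ≤ K * (A + E t))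
    {t : ℝ} (ht : t ∈ Icc 0 T) : A + E t ≤ (A + E 0) * exp (K * t) := by
  have hd : ∀ τ ∈ Icc 0 T, HasDerivAt (fun τ => (A + E τ) * exp (-(K * τ)))
      ((E' τ - K * (A + E τ)) * exp (-(K * τ))) τ := fun τ hτ => by
    have h1 : HasDerivAt (fun τ => exp (-(K * τ))) (exp (-(K * τ)) * -K) τ := by
      simpa using (((hasDerivAt_id τ).const_mul K).neg).exp
    refine (((h τ hτ).const_add A).mul h1).congr_deriv (by ring)
  have := le_add_mul_of_hasDerivAt (K := 0) hd (fun τ hτ =>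
    mul_nonpos_of_nonpos_of_nonneg (by linarith [b τ hτ]) (exp_pos _).le) ht
  simp only [mul_zero, neg_zero, exp_zero, mul_one, zero_mul, add_zero] at this
  calc A + E t = (A + E t) * exp (-(K * t)) * exp (K * t) := by
        rw [mul_assoc, ← exp_add]; simp
    _ ≤ _ := mul_le_mul_of_nonneg_right this (exp_pos _).le

/-- The energy of order `n`. -/
noncomputable def energy (P : Eqn) (K0 : ℝ) (n : ℕ) (f : ℝ → ℝ) : ℝ :=
  1 / 2 * per (fun x => dx 1 (dx n f) x ^ 2) +
    per (fun x => wt P.γ0 P.N K0 (n - 1 / 2) f x * dx n f x ^ 2)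

lemma hasDerivAt_energy_emb (P : Eqn) {n : ℕ} (hn : 9 ≤ n) (K0 R : ℝ) :
    ∃ K, 0 ≤ K ∧ ∀ M, ∀ c : ℝ → freq M → ℝ, ∀ t χ, 0 ≤ χ →
      HasDerivAt c (fun k => χ * hc (vf P M (emb M (c t))) k) t →
      (0 < χ → sob n (emb M (c t)) ≤ R) →
      ∃ E', HasDerivAt (fun τ => energy P K0 n (emb M (c τ))) E' t ∧
        E' ≤ χ * (K * (1 + sob (n + 1) (emb M (c t)))) := by
  obtain ⟨K, hK, h⟩ := energy_level P hn K0 R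
  refine ⟨K, hK, fun M c t χ hχ hc' hR => ?_⟩
  have sf := smoothPer_emb M (c t)
  have sv := smoothPer_vf P M sf
  have hv := proj_vf P M (proj_emb M (c t))
  have c2 := (sv.dx n).continuous
  have cw := continuous_wtDeriv P ((n:ℝ) - 1 / 2) sf sv
  refine ⟨_, hasDerivAt_energy (h1 := fun c => dx 1 (dx n (emb M c))) (h0 := fun c => dx n (emb M c))
    (w := fun c => wt P.γ0 P.N K0 (n - 1 / 2) (emb M c)) ((sep_emb M (1 + n)).congr fun c x => by
      rw [dx_dx]) (sep_emb M n) (Sep.wt (sep_emb M) _ _ _ _) hc'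
    (D1 := fun x => χ * dx 1 (dx n (vf P M (emb M (c t)))) x)
    (D0 := fun x => χ * dx n (vf P M (emb M (c t))) x)
    (Dw := fun x => χ * wtDeriv P (n - 1 / 2) (emb M (c t)) (vf P M (emb M (c t))) x)
    (by fun_prop) (by fun_prop) (fun x => ?_)
    (fun x => hasDerivAt_dx_emb hv hc' n x) (fun x => hasDerivAt_wt P hv hc' K0 _ x), ?_⟩
  · simp only [dx_dx]
    exact hasDerivAt_dx_emb hv hc' _ x
  have e1 : ∀ f g : ℝ → ℝ, per (fun x => f x * (χ * g x)) = χ * per (fun x => f x * g x) :=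
    fun f g => by rw [← per_const_mul]; congr 1; funext x; ring
  have e2 : ∀ f g : ℝ → ℝ, per (fun x => χ * f x * g x) = χ * per (fun x => f x * g x) :=
    fun f g => by rw [← per_const_mul]; congr 1; funext x; ring
  rw [e1, e1, e2]
  rcases hχ.eq_or_lt with h0 | h0
  · simp [← h0]
  · have := mul_le_mul_of_nonneg_left (h M _ sf (proj_emb M _) (hR h0)) hχ
    linarith

lemma sob_emb_le (M m : ℕ) (c : freq M → ℝ) : sob m (emb M c) ≤
    (m + 1) * (per (fun x => emb M c x ^ 2) + per (fun x => dx m (emb M c) x ^ 2)) :=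
  sob_tp_le _ _ _

/-- Galerkin solutions on `[0, T]`. -/
def IsGal (P : Eqn) (M : ℕ) (T : ℝ) (c : ℝ → freq M → ℝ) : Prop :=
  ∀ t ∈ Icc 0 T, HasDerivAt c (fun k => hc (vf P M (emb M (c t))) k) t

lemma sob_zero (f : ℝ → ℝ) : sob 0 f = per (fun x => f x ^ 2) := by
  simp [sob, dx_zero]

lemma energy_bounds (P : Eqn) {K0 C R : ℝ} {n : ℕ}
    (hw : ∀ f, SmoothPer f → sob 4 f ≤ R → ∀ x, 1 ≤ wt P.γ0 P.N K0 (n - 1 / 2) f x ∧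
      wt P.γ0 P.N K0 (n - 1 / 2) f x ≤ C) {f : ℝ → ℝ} (hf : SmoothPer f) (hR : sob 4 f ≤ R) :
    1 / 2 * per (fun x => dx (n + 1) f x ^ 2) + per (fun x => dx n f x ^ 2) ≤ energy P K0 n f ∧
      energy P K0 n f ≤ (1 / 2 + C) * sob (n + 1) f := by
  have c1 : Continuous (wt P.γ0 P.N K0 (n - 1 / 2) f) := (sd_wt P.nonpar K0 _ hf).1.continuous
  have c2 := (hf.dx n).continuous
  have h1 : per (fun x => dx n f x ^ 2) ≤
      per (fun x => wt P.γ0 P.N K0 (n - 1 / 2) f x * dx n f x ^ 2) :=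
    per_mono (by fun_prop) (by fun_prop) fun x => by nlinarith [(hw f hf hR x).1, sq_nonneg (dx n f x)]
  have h2 : per (fun x => wt P.γ0 P.N K0 (n - 1 / 2) f x * dx n f x ^ 2) ≤
      C * per (fun x => dx n f x ^ 2) := by
    rw [← per_const_mul]
    exact per_mono (by fun_prop) (by fun_prop) fun x =>
      mul_le_mul_of_nonneg_right (hw f hf hR x).2 (sq_nonneg _)
  have hC : 0 ≤ C := by linarith [(hw f hf hR 0).1, (hw f hf hR 0).2]
  have h3 := mul_le_mul_of_nonneg_left (per_dx_sq_le_sob (show n ≤ n + 1 by omega) f) hC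
  have h4 := per_dx_sq_le_sob (le_refl (n + 1)) f
  rw [energy, dx_dx, add_comm 1 n]
  constructor <;> linarith

theorem exists_isGal (P : Eqn) (r : ℝ) : ∃ T R, 0 < T ∧ T ≤ 1 ∧ ∀ M c0, sob 12 (emb M c0) ≤ r →
    ∃ c, c 0 = c0 ∧ IsGal P M T c ∧ ∀ t ∈ Icc 0 T, sob 12 (emb M (c t)) ≤ R := by
  obtain ⟨K0, C0, hC0, hw⟩ := wt_pos P.γ0 P.nonpar ((11:ℕ) - 1 / 2) (r + 1)
  set R := 26 * ((1 / 2 + C0 + 1) * r + 2) with hRdef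
  obtain ⟨K, hK, hE⟩ := hasDerivAt_energy_emb P (show 9 ≤ 11 by norm_num) K0 (R + 1)
  obtain ⟨K', hK', hV⟩ := sob_vf_bound P 4 (R + 1)
  set L := |K * (1 + (R + 1))| + |R + 1 + K'| + 1 with hL
  have L0 : 0 < L := by positivity
  refine ⟨min 1 (1 / L), R, by positivity, min_le_left _ _, fun M c0 h0 => ?_⟩
  obtain ⟨c, hc0, hcd⟩ := exists_curve P M R c0
  have hT : ∀ t ∈ Icc 0 (min 1 (1 / L)), t ∈ Ioo (-2 : ℝ) 2 ∧ L * t ≤ 1 := fun t ht => by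
    have h1 := ht.2.trans (min_le_left _ _)
    have h2 := ht.2.trans (min_le_right _ _)
    refine ⟨⟨by linarith [ht.1], by linarith⟩, ?_⟩
    calc L * t ≤ L * (1 / L) := mul_le_mul_of_nonneg_left h2 L0.le
      _ = 1 := by field_simp
  set χ : ℝ → ℝ := fun t => smoothTransition (R + 1 - sob 12 (emb M (c t))) with hχ
  have χ0 : ∀ t, 0 ≤ χ t := fun t => smoothTransition.nonneg _
  have χ1 : ∀ t, χ t ≤ 1 := fun t => smoothTransition.le_one _
  have χs : ∀ t, 0 < χ t → sob 12 (emb M (c t)) ≤ R + 1 := fun t ht => by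
    by_contra! hlt
    exact ht.ne' (smoothTransition.zero_of_nonpos (by linarith))
  have hd : ∀ t ∈ Icc 0 (min 1 (1 / L)),
      HasDerivAt c (fun k => χ t * hc (vf P M (emb M (c t))) k) t := fun t ht => hcd t (hT t ht).1
  have χmul : ∀ {a b : ℝ} (t), 0 ≤ b → (0 < χ t → a ≤ b) → χ t * a ≤ b := fun {a b} t hb hab => by
    rcases (χ0 t).eq_or_lt with h | h
    · rw [← h, zero_mul]; exact hb
    · exact (mul_le_mul_of_nonneg_left (hab h) (χ0 t)).trans (by nlinarith [χ1 t])
  have hsob : ∀ m ≤ 4, ∀ t ∈ Icc 0 (min 1 (1 / L)), sob m (emb M (c t)) ≤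
      sob m (emb M c0) + |R + 1 + K'| * t := fun m hm t ht => by
    have hex := fun t (ht : t ∈ Icc 0 (min 1 (1 / L))) =>
      hasDerivAt_sob (smoothPer_vf P M (smoothPer_emb M (c t)))
        (proj_vf P M (proj_emb M (c t))) (hd t ht) m
    choose! E' e1 e2 using hex
    rw [← hc0]
    refine le_add_mul_of_hasDerivAt (K := |R + 1 + K'|) e1 (fun t ht => χmul t (abs_nonneg _) fun hp => ?_) ht
    have s1 := χs t hp
    have s2 := sob_mono (show m ≤ 12 by omega) (emb M (c t))
    have s3 := hV M _ (smoothPer_emb M (c t)) ((sob_mono (by norm_num) _).trans s1)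
    have s4 := sob_mono hm (vf P M (emb M (c t)))
    exact (e2 t ht).trans (le_trans (by linarith) (le_abs_self _))
  have hex := fun t (ht : t ∈ Icc 0 (min 1 (1 / L))) =>
    hE M c t (χ t) (χ0 t) (hd t ht) fun hp => (sob_mono (by norm_num) _).trans (χs t hp)
  choose! E' e1 e2 using hex
  have hfin : ∀ t ∈ Icc 0 (min 1 (1 / L)), sob 12 (emb M (c t)) ≤ R := fun t ht => by
    have hLt := (hT t ht).2
    have p1 : |R + 1 + K'| * t ≤ 1 := le_trans (mul_le_mul_of_nonneg_right
      (by rw [hL]; linarith [abs_nonneg (K * (1 + (R + 1)))]) ht.1) hLt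
    have p2 : |K * (1 + (R + 1))| * t ≤ 1 := le_trans (mul_le_mul_of_nonneg_right
      (by rw [hL]; linarith [abs_nonneg (R + 1 + K')]) ht.1) hLt
    have q1 := hsob 4 le_rfl t ht
    have q2 := hsob 0 (by norm_num) t ht
    have q3 := sob_mono (show 4 ≤ 12 by norm_num) (emb M c0)
    have q4 := sob_mono (show 0 ≤ 12 by norm_num) (emb M c0)
    have q5 := le_add_mul_of_hasDerivAt (K := |K * (1 + (R + 1))|) e1
      (fun t ht => (e2 t ht).trans (χmul t (abs_nonneg _) fun hp =>
        le_trans (mul_le_mul_of_nonneg_left (by linarith [χs t hp]) hK) (le_abs_self _))) ht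
    have b0 := (energy_bounds P hw (smoothPer_emb M c0) (by linarith)).2
    have bt := (energy_bounds P hw (smoothPer_emb M (c t)) (by linarith)).1
    have b1 := sob_emb_le M 12 (c t)
    have b2 := per_sq_nonneg (dx 11 (emb M (c t)))
    rw [sob_zero, sob_zero] at *
    rw [hc0] at q5
    norm_num at b0 bt b1
    have b3 : (1 / 2 + C0) * sob 12 (emb M c0) ≤ (1 / 2 + C0) * r :=
      mul_le_mul_of_nonneg_left h0 (by positivity)
    rw [hRdef]
    have q6 : per (fun x => emb M c0 x ^ 2) ≤ r := by linarith
    have b4 := per_sq_nonneg (emb M (c t))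
    linarith
  refine ⟨c, hc0, fun t ht => ?_, hfin⟩
  have h1 : χ t = 1 := smoothTransition.one_of_one_le (by linarith [hfin t ht])
  simpa [h1] using hd t ht

theorem IsGal.propagate (P : Eqn) {m : ℕ} (hm : 12 ≤ m) (R : ℝ) : ∃ K, 0 ≤ K ∧
    ∀ M T c, T ≤ 1 → IsGal P M T c → (∀ t ∈ Icc 0 T, sob m (emb M (c t)) ≤ R) →
      ∀ t ∈ Icc 0 T, sob (m + 1) (emb M (c t)) ≤ K * (1 + sob (m + 1) (emb M (c 0))) := by
  obtain ⟨K0, C0, hC0, hw⟩ := wt_pos P.γ0 P.nonpar (m - 1 / 2) R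
  obtain ⟨K, hK, hE⟩ := hasDerivAt_energy_emb P (show 9 ≤ m by omega) K0 R
  have hR' : 0 ≤ |R| := abs_nonneg R
  refine ⟨2 * (m + 2) * ((1 + |R| + 1 / 2 + C0) * exp (K * (2 * (m + 2)))), by positivity,
    fun M T c hT hG hR t ht => ?_⟩
  have hR4 := fun t ht => (sob_mono (show 4 ≤ m by omega) (emb M (c t))).trans (hR t ht)
  have hex := fun t (ht : t ∈ Icc 0 T) => hE M c t 1 zero_le_one (by simpa using hG t ht)
    fun _ => hR t ht
  choose! E' e1 e2 using hex
  have key : ∀ t ∈ Icc 0 T, sob (m + 1) (emb M (c t)) ≤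
      2 * (m + 2) * (|R| + energy P K0 m (emb M (c t))) := fun t ht => by
    have bt := (energy_bounds P hw (smoothPer_emb M (c t)) (hR4 t ht)).1
    have b1 := sob_emb_le M (m + 1) (c t)
    have b2 := (sob_mono (show 0 ≤ m by omega) (emb M (c t))).trans (hR t ht)
    rw [sob_zero] at b2
    have b3 := per_sq_nonneg (dx m (emb M (c t)))
    push_cast at b1
    refine b1.trans ?_
    have := le_abs_self R
    have b4 : per (fun x => emb M (c t) x ^ 2) + per (fun x => dx (m + 1) (emb M (c t)) x ^ 2) ≤
      2 * (|R| + energy P K0 m (emb M (c t))) := by linarith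
    calc _ ≤ ((m:ℝ) + 1 + 1) * (2 * (|R| + energy P K0 m (emb M (c t)))) :=
          mul_le_mul_of_nonneg_left b4 (by positivity)
      _ = _ := by ring
  have hg := gronwall_of_hasDerivAt (K := K * (2 * (m + 2))) (A := 1 + |R|) e1
    (fun t ht => (e2 t ht).trans ?_) ht
  swap
  · rw [one_mul, mul_assoc]
    refine mul_le_mul_of_nonneg_left ?_ hK
    have hm0 : (0:ℝ) ≤ m := by positivity
    linarith [key t ht]
  have h0 : (0:ℝ) ∈ Icc 0 T := ⟨le_rfl, ht.1.trans ht.2⟩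
  have b0 := (energy_bounds P hw (smoothPer_emb M (c 0)) (hR4 0 h0)).2
  have S0 := sob_nonneg (m + 1) (emb M (c 0))
  refine (key t ht).trans ?_
  rw [mul_assoc (2 * ((m:ℝ) + 2))]
  refine mul_le_mul_of_nonneg_left ?_ (by positivity)
  have hexp : exp (K * (2 * (m + 2)) * t) ≤ exp (K * (2 * (m + 2))) :=
    exp_le_exp.2 (mul_le_of_le_one_right (by positivity) (ht.2.trans hT))
  have h1 : 1 + |R| + energy P K0 m (emb M (c 0)) ≤
      (1 + |R| + 1 / 2 + C0) * (1 + sob (m + 1) (emb M (c 0))) := by nlinarith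
  calc _ ≤ 1 + |R| + energy P K0 m (emb M (c t)) := by linarith
    _ ≤ _ := hg
    _ ≤ (1 + |R| + 1 / 2 + C0) * (1 + sob (m + 1) (emb M (c 0))) * exp (K * (2 * (m + 2)) * t) :=
        mul_le_mul_of_nonneg_right h1 (exp_pos _).le
    _ ≤ (1 + |R| + 1 / 2 + C0) * (1 + sob (m + 1) (emb M (c 0))) * exp (K * (2 * (m + 2))) :=
        mul_le_mul_of_nonneg_left hexp (by positivity)
    _ = _ := by ring

theorem IsGal.sob_le (P : Eqn) {m : ℕ} (hm : 12 ≤ m) (R ρ : ℝ) : ∃ K, 0 ≤ K ∧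
    ∀ M T c, T ≤ 1 → IsGal P M T c → (∀ t ∈ Icc 0 T, sob 12 (emb M (c t)) ≤ R) →
      sob m (emb M (c 0)) ≤ ρ → ∀ t ∈ Icc 0 T, sob m (emb M (c t)) ≤ K := by
  induction m, hm using Nat.le_induction with
  | base => exact ⟨|R|, abs_nonneg _, fun M T c _ _ h _ t ht => (h t ht).trans (le_abs_self _)⟩
  | succ m hm ih =>
    obtain ⟨K1, hK1, h1⟩ := ih
    obtain ⟨K2, hK2, h2⟩ := IsGal.propagate P hm K1
    refine ⟨K2 * (1 + |ρ|), by positivity, fun M T c hT hG hR h0 t ht => ?_⟩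
    refine (h2 M T c hT hG (h1 M T c hT hG hR ((sob_mono (by omega) _).trans h0)) t ht).trans ?_
    exact mul_le_mul_of_nonneg_left (by linarith [le_abs_self ρ]) hK2

end Apriori

section Difference

open Real MeasureTheory Set
open MvPolynomial (X C pderiv)

lemma hasDerivAt_linev {f v : ℝ → ℝ} (hf : SmoothPer f) (hv : SmoothPer v)
    {p : MvPolynomial ℕ ℝ} (hp : p ∈ ordLE 3) (x : ℝ) :
    HasDerivAt (linev 4 p f v) (linev 4 (DX p) f v x) x := by
  refine mem_ordLE_induction (P := fun p => HasDerivAt (linev 4 p f v) (linev 4 (DX p) f v x) x)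
    ?_ ?_ ?_ ?_ hp
  · intro r
    have e : linev 4 (C r) f v = fun _ => 0 := funext fun x => lin_C _ _ _ r
    rw [e]
    simpa [linev, lin] using hasDerivAt_const x (0:ℝ)
  · intro i hi
    have e : linev 4 (X i) f v = dx i v := funext fun x => lin_X _ _ (by omega)
    rw [e, DX_X, linev, lin_X _ _ (by omega)]
    exact hv.hasDerivAt_dx i x
  · intro p q h1 h2
    have e : linev 4 (p + q) f v = fun x => linev 4 p f v x + linev 4 q f v x :=
      funext fun x => lin_add _ _ _ _ _
    rw [e, map_add]
    refine (h1.add h2).congr_deriv ?_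
    simp only [linev, lin_add]
  · intro p q h1 h2
    have e : linev 4 (p * q) f v = fun x => ev p f x * linev 4 q f v x +
        ev q f x * linev 4 p f v x := funext fun x => lin_mul _ _ _ _ _
    rw [e]
    refine (((hasDerivAt_ev p hf x).mul h2).add ((hasDerivAt_ev q hf x).mul h1)).congr_deriv ?_
    rw [Derivation.leibniz]
    simp only [linev, lin_add, lin_mul, smul_eq_mul, ev]
    ring

/-- The error of the linearization of `p` at `f`. -/
noncomputable def taylorErr (p : MvPolynomial ℕ ℝ) (f h : ℝ → ℝ) (x : ℝ) : ℝ :=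
  ev p h x - ev p f x - linev 4 p f (fun y => h y - f y) x

lemma sd_taylorErr {f h : ℝ → ℝ} (hf : SmoothPer f) (hh : SmoothPer h)
    {p : MvPolynomial ℕ ℝ} (hp : p ∈ ordLE 3) : SD (taylorErr p f h) (taylorErr (DX p) f h) :=
  ⟨((smoothPer_ev p hh).sub (smoothPer_ev p hf)).sub (smoothPer_linev 4 p hf (hh.sub hf)),
    fun x => ((hasDerivAt_ev p hh x).sub (hasDerivAt_ev p hf x)).sub
      (hasDerivAt_linev hf (hh.sub hf) hp x)⟩

lemma taylorErr_bound {p : MvPolynomial ℕ ℝ} (hp : p ∈ ordLE 4) (R : ℝ) :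
    ∃ K, 0 ≤ K ∧ ∀ f h, SmoothPer f → SmoothPer h → sob 9 f ≤ R → sob 9 h ≤ R →
      ∀ x, |taylorErr p f h x| ≤ K * sob 5 (fun y => f y - h y) := by
  obtain ⟨K, hK, hT⟩ := eval_taylor hp (√(2 * R))
  refine ⟨K * 50, by positivity, fun f h hf hh hfR hhR x => ?_⟩
  have h1 := hT (fun i => dx i f x) (fun i => dx i h x)
    (fun i hi => abs_dx_le_of_sob hf (m := 9) (by omega) hfR x)
    (fun i hi => abs_dx_le_of_sob hh (m := 9) (by omega) hhR x)
  have e : taylorErr p f h x = MvPolynomial.eval (fun i => dx i h x) p -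
      MvPolynomial.eval (fun i => dx i f x) p -
      lin 4 p (fun i => dx i f x) (fun i => dx i h x - dx i f x) := by
    rw [taylorErr, linev]
    simp only [dx_sub hh hf]
    rfl
  rw [e, mul_assoc]
  refine h1.trans (mul_le_mul_of_nonneg_left ?_ hK)
  set S := sob 5 (fun y => f y - h y) with hS
  have hS0 : 0 ≤ S := sob_nonneg _ _
  have h2 : ∑ i ∈ Finset.range (4 + 1), |dx i h x - dx i f x| ≤
      ∑ _i ∈ Finset.range (4 + 1), √(2 * S) := Finset.sum_le_sum fun i hi => by
    rw [abs_sub_comm, ← dx_sub hf hh]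
    exact abs_dx_le_of_sob (hf.sub hh) (by have := Finset.mem_range.1 hi; omega) le_rfl x
  rw [Finset.sum_const, Finset.card_range, nsmul_eq_mul] at h2
  calc _ ≤ (((4 + 1 : ℕ) : ℝ) * √(2 * S)) ^ 2 :=
        pow_le_pow_left₀ (Finset.sum_nonneg fun _ _ => abs_nonneg _) h2 2
    _ = 50 * S := by rw [mul_pow, sq_sqrt (by positivity)]; push_cast; ring

lemma sob_interp (M : ℕ) (c : ℤ → ℝ) :
    sob 5 (tp M c) ^ 2 ≤ 6 * (sob 1 (tp M c) * sob 9 (tp M c)) := by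
  rw [sob_tp, sob_tp, sob_tp]
  have h := Finset.sum_sq_le_sum_mul_sum_of_sq_le_mul (freq M)
    (r := fun k : ℤ => (∑ j ∈ Finset.range (5 + 1), (k:ℝ) ^ (2 * j)) * c k ^ 2)
    (f := fun k : ℤ => 6 * ((∑ j ∈ Finset.range (1 + 1), (k:ℝ) ^ (2 * j)) * c k ^ 2))
    (g := fun k : ℤ => (∑ j ∈ Finset.range (9 + 1), (k:ℝ) ^ (2 * j)) * c k ^ 2)
    (fun k _ => by simp only [pow_mul]; positivity) (fun k _ => by simp only [pow_mul]; positivity)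
    (fun k _ => by
      have : (∑ j ∈ Finset.range (5 + 1), (k:ℝ) ^ (2 * j)) ^ 2 ≤
          6 * ((∑ j ∈ Finset.range (1 + 1), (k:ℝ) ^ (2 * j)) *
            ∑ j ∈ Finset.range (9 + 1), (k:ℝ) ^ (2 * j)) := by
        simp only [pow_mul]
        have hq : (0:ℝ) ≤ (k:ℝ) ^ 2 := sq_nonneg _
        generalize (k:ℝ) ^ 2 = q at hq
        simp only [Finset.sum_range_succ, Finset.sum_range_zero]
        rw [← sub_nonneg]
        ring_nf
        positivity
      calc _ = (∑ j ∈ Finset.range (5 + 1), (k:ℝ) ^ (2 * j)) ^ 2 * (c k ^ 2 * c k ^ 2) := by ring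
        _ ≤ _ := mul_le_mul_of_nonneg_right this (by positivity)
        _ = _ := by ring)
  rw [← Finset.mul_sum] at h
  calc _ = (2 * π) ^ 2 * _ := mul_pow _ _ _
    _ ≤ (2 * π) ^ 2 * _ := mul_le_mul_of_nonneg_left h (by positivity)
    _ = _ := by ring

/-- The part of the vector field that is not in the equation. -/
noncomputable def vfErr (P : Eqn) (M : ℕ) (f : ℝ → ℝ) (x : ℝ) : ℝ :=
  -((M:ℝ) + 1)⁻¹ * dx 4 f x - (ev P.N f x - proj M (ev P.N f) x)

lemma sd_vfErr (P : Eqn) (M : ℕ) {f : ℝ → ℝ} (hf : SmoothPer f) :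
    SD (vfErr P M f) fun x => -((M:ℝ) + 1)⁻¹ * dx 5 f x -
      (ev (DX P.N) f x - proj M (ev (DX P.N) f) x) := by
  refine ⟨((hf.dx 4).const_mul _).sub ((smoothPer_ev _ hf).sub (smoothPer_proj M _)), fun x => ?_⟩
  refine ((hf.hasDerivAt_dx 4 x).const_mul _).sub ((hasDerivAt_ev _ hf x).sub ?_)
  have := (smoothPer_proj M (ev P.N f)).hasDerivAt x
  rwa [dx_proj (smoothPer_ev _ hf), dx_ev _ hf, Function.iterate_one] at this

lemma vfErr_bound (P : Eqn) (R : ℝ) : ∃ K, 0 ≤ K ∧ ∀ M f, SmoothPer f → sob 9 f ≤ R →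
    per (fun x => vfErr P M f x ^ 2) + per (fun x => dx 1 (vfErr P M f) x ^ 2) ≤
      K * (((M:ℝ) + 1)⁻¹) ^ 2 := by
  obtain ⟨K1, h1, b1⟩ := ev_bound (DX_mem P.nonpar.1) R
  obtain ⟨K2, h2, b2⟩ := ev_bound (DX_mem (DX_mem P.nonpar.1)) R
  refine ⟨4 * |R| + 4 * π * K1 ^ 2 + 4 * π * K2 ^ 2, by positivity, fun M f hf hR => ?_⟩
  have hM : (0:ℝ) < (M:ℝ) + 1 := by positivity
  have key : ∀ p j, j ≤ 9 → ∀ K, (∀ x, |ev (DX p) f x| ≤ K) →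
      per (fun x => (-((M:ℝ) + 1)⁻¹ * dx j f x - (ev p f x - proj M (ev p f) x)) ^ 2) ≤
        (2 * |R| + 4 * π * K ^ 2) * (((M:ℝ) + 1)⁻¹) ^ 2 := fun p j hj K hK => by
    have c1 := (hf.dx j).continuous
    have c2 := (smoothPer_ev p hf).continuous
    have c3 := (smoothPer_proj M (ev p f)).continuous
    have a1 := per_add_sq_le (f := fun x => -((M:ℝ) + 1)⁻¹ * dx j f x)
      (g := fun x => -1 * (ev p f x - proj M (ev p f) x)) (by fun_prop) (by fun_prop)
    rw [per_const_mul_sq, per_const_mul_sq] at a1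
    have a2 := per_sub_proj_sq_le_dx (smoothPer_ev p hf) M
    have a3 : per (fun x => dx 1 (ev p f) x ^ 2) ≤ 2 * π * K ^ 2 := by
      rw [dx_ev _ hf, Function.iterate_one]
      exact per_sq_le_of_abs_le (smoothPer_ev _ hf).continuous hK
    have a4 : per (fun x => (ev p f x - proj M (ev p f) x) ^ 2) ≤
        2 * π * K ^ 2 * (((M:ℝ) + 1)⁻¹) ^ 2 := by
      rw [inv_pow, ← div_eq_mul_inv, le_div_iff₀ (by positivity), mul_comm]
      exact a2.trans a3
    have a5 := ((per_dx_sq_le_sob hj f).trans hR).trans (le_abs_self R)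
    have a6 := mul_le_mul_of_nonneg_left a5 (sq_nonneg (((M:ℝ) + 1)⁻¹))
    have e : (fun x => (-((M:ℝ) + 1)⁻¹ * dx j f x - (ev p f x - proj M (ev p f) x)) ^ 2) =
        fun x => (-((M:ℝ) + 1)⁻¹ * dx j f x + -1 * (ev p f x - proj M (ev p f) x)) ^ 2 := by
      funext x; ring
    rw [e]
    refine a1.trans ?_
    rw [neg_sq]
    linarith
  rw [← (sd_vfErr P M hf).eq_dx]
  have k1 := key P.N 4 (by omega) K1 (b1 f hf ((sob_mono (by omega) f).trans hR))
  have k2 := key (DX P.N) 5 (by omega) K2 (b2 f hf ((sob_mono (by omega) f).trans hR))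
  unfold vfErr
  linarith

lemma difference_static (P : Eqn) (K0 R : ℝ) :
    ∃ K, 0 ≤ K ∧ ∀ M M' f h, SmoothPer f → SmoothPer h → sob 9 f ≤ R → sob 9 h ≤ R →
      (∀ g, g = (fun y => f y - h y) → sob 5 g ^ 2 ≤ 6 * (sob 1 g * sob 9 g)) →
      ∀ g G, g = (fun y => f y - h y) → G = (fun y => vf P M f y - vf P M' h y) →
      per (fun x => dx 1 g x * dx 1 G x) +
        2 * per (fun x => wt P.γ0 P.N K0 (-1 / 2) f x * g x * G x) +
        per (fun x => wtDeriv P (-1 / 2) f (vf P M f) x * g x ^ 2) ≤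
      K * (sob 1 g + ((((M:ℝ) + 1)⁻¹) ^ 2 + (((M':ℝ) + 1)⁻¹) ^ 2)) := by
  have mp : ∀ i, pderiv i P.N ∈ ordLE 3 := fun i => pderiv_mem i P.nonpar.1
  obtain ⟨CA, pA, bA⟩ := dx_ev_bound (mp 3) R 2
  obtain ⟨CB, pB, bB⟩ := dx_ev_bound (mp 2) R 1
  obtain ⟨CC, pC, bC⟩ := dx_ev_bound (mp 1) R 1
  obtain ⟨CO, pO, bO⟩ := dx_ev_bound (mp 0) R 1
  obtain ⟨CW, pW, bW⟩ := wt_dx_bound (γ0 := P.γ0) P.nonpar K0 (-1 / 2) R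
  obtain ⟨CD, pD, bD⟩ := per_wtDeriv_le P (-1 / 2) R
  obtain ⟨CT, pT, bT⟩ := taylorErr_bound (ordLE_mono (show 3 ≤ 4 by omega) P.nonpar.1) R
  obtain ⟨CS, pS, bS⟩ := taylorErr_bound (DX_mem P.nonpar.1) R
  obtain ⟨CE, pE, bE⟩ := vfErr_bound P R
  set K1 := CA + CB + CC + CO + CW with hK1
  obtain ⟨K, pK, bK⟩ := energy_static P.γ0 P.γ1 P.γ2 (K1 := K1) (by positivity)
  set CI := 6 * (4 * |R|) with hCI
  refine ⟨K * (1 + 8 * K1 ^ 2 + 8 * π * (CT ^ 2 + CS ^ 2) * CI + 8 * CE) + CD, by positivity, ?_⟩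
  intro M M' f h hf hh hfR hhR hI g G hgd hGd
  have hR9 : ∀ i ≤ 9, sob i f ≤ R := fun i hi => (sob_mono (by omega) f).trans hfR
  have sg : SmoothPer g := hgd ▸ hf.sub hh
  have sG : SmoothPer G := hGd ▸ (smoothPer_vf P M hf).sub (smoothPer_vf P M' hh)
  have se := fun p => smoothPer_ev p hf
  have sw := (sd_wt (γ0 := P.γ0) P.nonpar K0 (-1 / 2) hf).1
  have ST := sd_taylorErr hf hh P.nonpar.1
  have SE := sd_vfErr P M hf
  have SE' := sd_vfErr P M' hh
  set w := wt P.γ0 P.N K0 (-1 / 2) f with hw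
  have eg : ∀ j x, dx j g x = dx j f x - dx j h x := fun j x => by rw [hgd, dx_sub hf hh]
  have k1 : ∀ i ≤ 2, ∀ x, |dx i (ev (pderiv 3 P.N) f) x| ≤ K1 := fun i hi x =>
    (bA f hf (hR9 _ (by omega)) i hi x).trans (by rw [hK1]; linarith)
  have k2 : ∀ i ≤ 1, ∀ x, |dx i (ev (pderiv 2 P.N) f) x| ≤ K1 := fun i hi x =>
    (bB f hf (hR9 _ (by omega)) i hi x).trans (by rw [hK1]; linarith)
  have k3 : ∀ i ≤ 1, ∀ x, |dx i (ev (pderiv 1 P.N) f) x| ≤ K1 := fun i hi x =>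
    (bC f hf (hR9 _ (by omega)) i hi x).trans (by rw [hK1]; linarith)
  have k0 : ∀ i ≤ 1, ∀ x, |dx i (ev (pderiv 0 P.N) f) x| ≤ K1 := fun i hi x =>
    (bO f hf (hR9 _ (by omega)) i hi x).trans (by rw [hK1]; linarith)
  have k4 : ∀ i ≤ 4, ∀ x, |dx i w x| ≤ K1 := fun i hi x =>
    (bW f hf (hR9 _ (by omega)) i hi x).trans (by rw [hK1]; linarith)
  set F : ℝ → ℝ := fun x => ev (pderiv 0 P.N) f x * g x + (-1 * taylorErr P.N f h x +
    (vfErr P M f x + -1 * vfErr P M' h x)) with hF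
  have sF : SmoothPer F := ((se _).mul sg).add ((ST.1.const_mul _).add (SE.1.add (SE'.1.const_mul _)))
  have hb := bK g (ev (pderiv 3 P.N) f) (ev (pderiv 2 P.N) f) (ev (pderiv 1 P.N) f) w F (fun _ => 0) G
    sg (se _) (se _) (se _) sw sF (SmoothPer.const 0) sG k1 k2 k3 k4 ?_ ?_
  rotate_left
  · intro x
    have e : linev 4 P.N f (fun y => h y - f y) x = -(ev (pderiv 3 P.N) f x * dx 3 g x +
        ev (pderiv 2 P.N) f x * dx 2 g x + ev (pderiv 1 P.N) f x * dx 1 g x +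
        ev (pderiv 0 P.N) f x * g x) := by
      have e0 : g x = f x - h x := by rw [hgd]
      rw [linev, lin]
      simp only [Finset.sum_range_succ, Finset.sum_range_zero, dx_sub hh hf, eg,
        pderiv_eq_zero (show 3 < 4 by omega) P.nonpar.1, map_zero, dx_zero, e0, ev]
      ring
    simp only [hF, hGd, vf, vfErr, taylorErr, e, eg]
    ring
  · intro x
    rw [wt_dx_one P.ne_zero P.nonpar K0 _ hf, dx_ev _ hf, Function.iterate_one]
    ring
  have hz : per (fun x => -(dx 2 g x) * 0 + 2 * (w x * g x * 0)) = 0 := by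
    simp only [mul_zero, add_zero]; simp [per]
  rw [hz, add_zero] at hb
  set Y := sob 1 g with hY
  set δ := (((M:ℝ) + 1)⁻¹) ^ 2 + (((M':ℝ) + 1)⁻¹) ^ 2 with hδ
  have y0 : 0 ≤ Y := sob_nonneg _ _
  have d0 : 0 ≤ δ := by positivity
  have yg : per (fun x => g x ^ 2) + per (fun x => dx 1 g x ^ 2) = Y := by
    simp [hY, sob, Finset.sum_range_succ, dx_zero]
  have yg0 := per_sq_nonneg g
  have yg1 := per_sq_nonneg (dx 1 g)
  have hS : sob 5 g ^ 2 ≤ CI * Y := by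
    have h9 : sob 9 g ≤ 4 * |R| := by
      have : sob 9 g ≤ 2 * (sob 9 f + sob 9 h) := by
        simp only [sob, ← Finset.sum_add_distrib, Finset.mul_sum]
        refine Finset.sum_le_sum fun j _ => ?_
        have c1 := (hf.dx j).continuous
        have c2 := (hh.dx j).continuous
        have := per_add_sq_le (f := dx j f) (g := fun x => -1 * dx j h x) c1 (by fun_prop)
        rw [per_const_mul_sq] at this
        rw [show (fun x => dx j g x ^ 2) = fun x => (dx j f x + -1 * dx j h x) ^ 2 from
          funext fun x => by rw [eg]; ring]
        simpa using this
      linarith [le_abs_self R]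
    refine (hI g hgd).trans ?_
    rw [hCI]
    nlinarith [mul_le_mul_of_nonneg_left h9 y0]
  have cg := sg.continuous
  have cg1 := (sg.dx 1).continuous
  have cT := ST.1.continuous
  have cT1 := ST.continuous
  have cE := SE.1.continuous
  have cE1 := (SE.1.dx 1).continuous
  have cE' := SE'.1.continuous
  have cE1' := (SE'.1.dx 1).continuous
  have cO := (se (pderiv 0 P.N)).continuous
  have cO1 := ((se (pderiv 0 P.N)).dx 1).continuous
  have tT : per (fun x => taylorErr P.N f h x ^ 2) ≤ 2 * π * CT ^ 2 * (CI * Y) := by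
    refine (per_sq_le_of_abs_le cT (bT f h hf hh hfR hhR)).trans ?_
    rw [← hgd, mul_pow, ← mul_assoc]
    exact mul_le_mul_of_nonneg_left hS (by positivity)
  have tS : per (fun x => taylorErr (DX P.N) f h x ^ 2) ≤ 2 * π * CS ^ 2 * (CI * Y) := by
    refine (per_sq_le_of_abs_le cT1 (bS f h hf hh hfR hhR)).trans ?_
    rw [← hgd, mul_pow, ← mul_assoc]
    exact mul_le_mul_of_nonneg_left hS (by positivity)
  have tE := bE M f hf hfR
  have tE' := bE M' h hh hhR
  have split : ∀ p q r s : ℝ → ℝ, Continuous p → Continuous q → Continuous r → Continuous s →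
      per (fun x => (p x + (-1 * q x + (r x + -1 * s x))) ^ 2) ≤
        2 * per (fun x => p x ^ 2) + 4 * per (fun x => q x ^ 2) + 8 * per (fun x => r x ^ 2) +
          8 * per (fun x => s x ^ 2) := fun p q r s hp hq hr hs => by
    have a1 := per_add_sq_le (f := p) (g := fun x => -1 * q x + (r x + -1 * s x)) hp (by fun_prop)
    have a2 := per_add_sq_le (f := fun x => -1 * q x) (g := fun x => r x + -1 * s x)
      (by fun_prop) (by fun_prop)
    have a3 := per_add_sq_le (f := r) (g := fun x => -1 * s x) hr (by fun_prop)
    rw [per_const_mul_sq] at a2 a3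
    linarith
  have k00 : ∀ x, |ev (pderiv 0 P.N) f x| ≤ K1 := fun x => by
    simpa [dx_zero] using k0 0 (by omega) x
  have r0 := split (fun x => ev (pderiv 0 P.N) f x * g x) (taylorErr P.N f h) (vfErr P M f)
    (vfErr P M' h) (by fun_prop) cT cE cE'
  have r0' := per_mul_sq_le cO cg k00
  have F1 : dx 1 F = fun x => (dx 1 (ev (pderiv 0 P.N) f) x * g x +
      ev (pderiv 0 P.N) f x * dx 1 g x) + (-1 * taylorErr (DX P.N) f h x +
      (dx 1 (vfErr P M f) x + -1 * dx 1 (vfErr P M' h) x)) := by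
    have s1 := (SD.dx (se (pderiv 0 P.N)) 0).mul (SD.dx sg 0)
    have s2 := (SD.dx SE.1 0).add ((SD.dx SE'.1 0).const_mul (-1))
    simp only [dx_zero] at s1 s2
    exact (s1.add ((ST.const_mul (-1)).add s2)).eq_dx.symm
  have r1 := split (fun x => dx 1 (ev (pderiv 0 P.N) f) x * g x +
      ev (pderiv 0 P.N) f x * dx 1 g x) (taylorErr (DX P.N) f h) (dx 1 (vfErr P M f))
    (dx 1 (vfErr P M' h)) (by fun_prop) cT1 cE1 cE1'
  have r1' := per_add_sq_le (f := fun x => dx 1 (ev (pderiv 0 P.N) f) x * g x)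
    (g := fun x => ev (pderiv 0 P.N) f x * dx 1 g x) (by fun_prop) (by fun_prop)
  have r2' := per_mul_sq_le cO1 cg (k0 1 le_rfl)
  have r3' := per_mul_sq_le cO cg1 k00
  have hD := bD M f hf (hR9 9 le_rfl) g cg
  have q1 : per (fun x => F x ^ 2) + per (fun x => dx 1 F x ^ 2) ≤
      (8 * K1 ^ 2 + 8 * π * (CT ^ 2 + CS ^ 2) * CI) * Y + 8 * CE * δ := by
    have u1 : 0 ≤ K1 ^ 2 * per (fun x => g x ^ 2) := by positivity
    have u2 : 0 ≤ K1 ^ 2 * per (fun x => dx 1 g x ^ 2) := by positivity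
    have u3 : K1 ^ 2 * (per (fun x => g x ^ 2) + per (fun x => dx 1 g x ^ 2)) = K1 ^ 2 * Y := by
      rw [yg]
    rw [F1, hδ]
    linarith
  have q2 := mul_le_mul_of_nonneg_left q1 pK
  have q3 : CD * per (fun x => g x ^ 2) ≤ CD * Y := mul_le_mul_of_nonneg_left (by linarith) pD
  have q4 : 0 ≤ K * (1 + 8 * K1 ^ 2 + 8 * π * (CT ^ 2 + CS ^ 2) * CI) * δ := by positivity
  have q5 : 0 ≤ K * (8 * CE) * Y := by positivity
  have q6 : 0 ≤ CD * δ := by positivity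
  have q7 : K * (per (fun x => g x ^ 2) + per (fun x => dx 1 g x ^ 2)) = K * Y := by rw [yg]
  have q8 : 0 ≤ K * δ := by positivity
  linarith

end Difference

section DifferenceGronwall

open Real MeasureTheory Set
open MvPolynomial (X C pderiv)

lemma emb_sub_emb (M M' : ℕ) (c : freq M → ℝ) (c' : freq M' → ℝ) :
    ∃ L a, (fun y => emb M c y - emb M' c' y) = tp L a := by
  refine ⟨max M M', fun k => (if h : k ∈ freq M then c ⟨k, h⟩ else 0) -
    (if h : k ∈ freq M' then c' ⟨k, h⟩ else 0), ?_⟩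
  funext y
  rw [tp_sub, tp_extend (le_max_left M M') fun k hk => by simp [hk],
    tp_extend (le_max_right M M') fun k hk => by simp [hk]]
  rfl

theorem IsGal.difference_le (P : Eqn) (R : ℝ) : ∃ K, 0 ≤ K ∧ ∀ M M' T c c', T ≤ 1 →
    IsGal P M T c → IsGal P M' T c' → (∀ t ∈ Icc 0 T, sob 9 (emb M (c t)) ≤ R) →
    (∀ t ∈ Icc 0 T, sob 9 (emb M' (c' t)) ≤ R) → ∀ t ∈ Icc 0 T,
      sob 1 (fun y => emb M (c t) y - emb M' (c' t) y) ≤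
        K * (sob 1 (fun y => emb M (c 0) y - emb M' (c' 0) y) +
          ((((M:ℝ) + 1)⁻¹) ^ 2 + (((M':ℝ) + 1)⁻¹) ^ 2)) := by
  obtain ⟨K0, C0, hC0, hw⟩ := wt_pos P.γ0 P.nonpar (-1 / 2) R
  obtain ⟨K, hK, hst⟩ := difference_static P K0 R
  refine ⟨2 * (1 + C0) * exp (2 * K), by positivity, fun M M' T c c' hT kc kc' hR hR' t ht => ?_⟩
  set δ := (((M:ℝ) + 1)⁻¹) ^ 2 + (((M':ℝ) + 1)⁻¹) ^ 2 with hδ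
  have hδ0 : 0 ≤ δ := by positivity
  set E : ℝ → ℝ := fun τ =>
    1 / 2 * per (fun x => (dx 1 (emb M (c τ)) x - dx 1 (emb M' (c' τ)) x) ^ 2) +
      per (fun x => wt P.γ0 P.N K0 (-1 / 2) (emb M (c τ)) x *
        (emb M (c τ) x - emb M' (c' τ) x) ^ 2) with hE
  have h0 : (0:ℝ) ∈ Icc 0 T := left_mem_Icc.2 (ht.1.trans ht.2)
  have bd : ∀ τ ∈ Icc 0 T, sob 1 (fun y => emb M (c τ) y - emb M' (c' τ) y) ≤ 2 * E τ ∧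
      E τ ≤ (1 + C0) * sob 1 (fun y => emb M (c τ) y - emb M' (c' τ) y) := fun τ hτ => by
    have sf := smoothPer_emb M (c τ)
    have sh := smoothPer_emb M' (c' τ)
    have hw' := hw _ sf ((sob_mono (by omega) _).trans (hR τ hτ))
    have c1 : Continuous (wt P.γ0 P.N K0 (-1 / 2) (emb M (c τ))) :=
      (sd_wt P.nonpar K0 _ sf).1.continuous
    have c2 := (sf.sub sh).continuous
    have h1 : per (fun x => (emb M (c τ) x - emb M' (c' τ) x) ^ 2) ≤
        per (fun x => wt P.γ0 P.N K0 (-1 / 2) (emb M (c τ)) x *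
          (emb M (c τ) x - emb M' (c' τ) x) ^ 2) :=
      per_mono (by fun_prop) (by fun_prop) fun x => by
        nlinarith [(hw' x).1, sq_nonneg (emb M (c τ) x - emb M' (c' τ) x)]
    have h2 : per (fun x => wt P.γ0 P.N K0 (-1 / 2) (emb M (c τ)) x *
          (emb M (c τ) x - emb M' (c' τ) x) ^ 2) ≤
        C0 * per (fun x => (emb M (c τ) x - emb M' (c' τ) x) ^ 2) := by
      rw [← per_const_mul]
      exact per_mono (by fun_prop) (by fun_prop) fun x =>
        mul_le_mul_of_nonneg_right (hw' x).2 (sq_nonneg _)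
    have h3 : sob 1 (fun y => emb M (c τ) y - emb M' (c' τ) y) =
        per (fun x => (emb M (c τ) x - emb M' (c' τ) x) ^ 2) +
        per (fun x => (dx 1 (emb M (c τ)) x - dx 1 (emb M' (c' τ)) x) ^ 2) := by
      simp only [sob, Finset.sum_range_succ, Finset.sum_range_zero, dx_zero, zero_add,
        dx_sub sf sh]
    have n0 := per_sq_nonneg (fun x => emb M (c τ) x - emb M' (c' τ) x)
    have n1 := per_sq_nonneg (fun x => dx 1 (emb M (c τ)) x - dx 1 (emb M' (c' τ)) x)
    simp only [hE]
    rw [h3]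
    exact ⟨by linarith, by nlinarith [mul_nonneg hC0 n1]⟩
  have hd : ∀ τ ∈ Icc 0 T, ∃ e, HasDerivAt E e τ ∧ e ≤ 2 * K * (δ + E τ) := fun τ hτ => by
    have e1 : HasDerivAt c (fun k => 1 * hc (vf P M (emb M (c τ))) k) τ := by
      simpa using kc τ hτ
    have e2 : HasDerivAt c' (fun k => 1 * hc (vf P M' (emb M' (c' τ))) k) τ := by
      simpa using kc' τ hτ
    have v1 := proj_vf P M (proj_emb M (c τ))
    have v2 := proj_vf P M' (proj_emb M' (c' τ))
    have sf := smoothPer_emb M (c τ)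
    have sh := smoothPer_emb M' (c' τ)
    have k1 := (smoothPer_vf P M sf).continuous
    have k2 := (smoothPer_vf P M' sh).continuous
    have kw := continuous_wtDeriv P (-1 / 2) sf (smoothPer_vf P M sf)
    have q1 : ContDiff ℝ 1 (Prod.fst : (freq M → ℝ) × (freq M' → ℝ) → _) := contDiff_fst
    have q2 : ContDiff ℝ 1 (Prod.snd : (freq M → ℝ) × (freq M' → ℝ) → _) := contDiff_snd
    refine ⟨_, hasDerivAt_energy (V := (freq M → ℝ) × (freq M' → ℝ))
      (h1 := fun p x => dx 1 (emb M p.1) x - dx 1 (emb M' p.2) x)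
      (h0 := fun p x => emb M p.1 x - emb M' p.2 x)
      (w := fun p => wt P.γ0 P.N K0 (-1 / 2) (emb M p.1))
      (((sep_emb M 1).comp q1).sub ((sep_emb M' 1).comp q2))
      ((((sep_emb M 0).comp q1).sub ((sep_emb M' 0).comp q2)).congr fun p x => by simp [dx_zero])
      ((Sep.wt (sep_emb M) _ _ _ _).comp q1) (e1.prodMk e2)
      (D1 := fun x => 1 * dx 1 (vf P M (emb M (c τ))) x - 1 * dx 1 (vf P M' (emb M' (c' τ))) x)
      (D0 := fun x => 1 * dx 0 (vf P M (emb M (c τ))) x - 1 * dx 0 (vf P M' (emb M' (c' τ))) x)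
      (Dw := fun x => 1 * wtDeriv P (-1 / 2) (emb M (c τ)) (vf P M (emb M (c τ))) x)
      (by simp only [dx_zero]; fun_prop) (by fun_prop)
      (fun x => (hasDerivAt_dx_emb v1 e1 1 x).fun_sub (hasDerivAt_dx_emb v2 e2 1 x))
      (fun x => by
        simpa only [dx_zero] using
          (hasDerivAt_dx_emb v1 e1 0 x).fun_sub (hasDerivAt_dx_emb v2 e2 0 x))
      (fun x => hasDerivAt_wt P v1 e1 K0 _ x), ?_⟩
    have := hst M M' _ _ sf sh (hR τ hτ) (hR' τ hτ) (fun g hg => by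
      obtain ⟨L, a, ha⟩ := emb_sub_emb M M' (c τ) (c' τ)
      rw [hg, ha]
      exact sob_interp L a) _ _ rfl rfl
    simp only [dx_sub sf sh, dx_sub (smoothPer_vf P M sf) (smoothPer_vf P M' sh)] at this
    simp only [dx_zero, one_mul]
    refine this.trans ?_
    have b := (bd τ hτ).1
    rw [← hδ]
    nlinarith [mul_le_mul_of_nonneg_left b hK, mul_nonneg hK hδ0]
  have hg := gronwall_of_hasDerivAt (E' := deriv E) (K := 2 * K) (A := δ)
    (fun τ hτ => by
      obtain ⟨e, he, -⟩ := hd τ hτ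
      rwa [he.deriv])
    (fun τ hτ => by
      obtain ⟨e, he, hle⟩ := hd τ hτ
      rwa [he.deriv]) ht
  have b0 := (bd 0 h0).2
  have bt := (bd t ht).1
  have s0 := sob_nonneg 1 (fun y => emb M (c 0) y - emb M' (c' 0) y)
  have he : exp (2 * K * t) ≤ exp (2 * K) :=
    exp_le_exp.2 (by nlinarith [ht.2, ht.1])
  have hA : 0 ≤ δ + E 0 := by linarith [(bd 0 h0).1]
  have h4 := mul_le_mul_of_nonneg_left he hA
  have h5 : (δ + E 0) * exp (2 * K) ≤
      (1 + C0) * (sob 1 (fun y => emb M (c 0) y - emb M' (c' 0) y) + δ) * exp (2 * K) :=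
    mul_le_mul_of_nonneg_right (by nlinarith [mul_nonneg hC0 hδ0]) (exp_pos _).le
  linarith

end DifferenceGronwall

section Series

open Real MeasureTheory Set Filter Topology

lemma sum_ratio_le {x : ℝ} (hx : 1 ≤ x) (n : ℕ) :
    ∑ i ∈ Finset.range n, min ((4:ℝ) ^ i / x) (x / 4 ^ i) ≤ 3 := by
  have h0 : (0:ℝ) < x := by linarith
  have key : ∑ i ∈ Finset.range n, min ((4:ℝ) ^ i / x) (x / 4 ^ i) ≤ 4 ^ n / (3 * x) ∧
      (x ≤ 4 ^ n → ∑ i ∈ Finset.range n, min ((4:ℝ) ^ i / x) (x / 4 ^ i) ≤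
        3 - 4 / 3 * (x / 4 ^ n)) := by
    induction n with
    | zero =>
      refine ⟨by simpa using h0.le, fun h => ?_⟩
      simp only [Finset.range_zero, Finset.sum_empty, pow_zero, div_one] at h ⊢
      linarith
    | succ n ih =>
      have h4 : (0:ℝ) < 4 ^ n := by positivity
      have e1 : (4:ℝ) ^ (n + 1) / (3 * x) = 4 / 3 * (4 ^ n / x) := by
        rw [pow_succ]; field_simp
      have e2 : (4:ℝ) ^ n / (3 * x) = 1 / 3 * (4 ^ n / x) := by field_simp
      have e3 : x / 4 ^ (n + 1) = 1 / 4 * (x / 4 ^ n) := by rw [pow_succ]; field_simp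
      rw [Finset.sum_range_succ, e1, e3]
      rw [e2] at ih
      have m1 := min_le_left ((4:ℝ) ^ n / x) (x / 4 ^ n)
      have m2 := min_le_right ((4:ℝ) ^ n / x) (x / 4 ^ n)
      refine ⟨by linarith [ih.1], fun h => ?_⟩
      rcases le_total x (4 ^ n) with hn | hn
      · linarith [ih.2 hn]
      · have a1 : (4:ℝ) ^ n / x ≤ 1 := (div_le_one h0).2 hn
        have a2 : x / 4 ^ n ≤ 4 := by
          rw [div_le_iff₀ h4]
          rw [pow_succ] at h
          linarith
        linarith [ih.1]
  rcases le_total x (4 ^ n) with h | h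
  · have : 0 ≤ x / 4 ^ n := by positivity
    linarith [key.2 h]
  · have : (4:ℝ) ^ n / (3 * x) ≤ 1 := by
      rw [div_le_one (by positivity)]; linarith
    linarith [key.1]

lemma exists_limit {ι : Type*} {A : Set ι} {W : ℤ → ℝ} (hW : ∀ k, 1 ≤ W k) {ρ : ℕ → ℤ → ℝ}
    (hρ0 : ∀ i k, 0 < ρ i k) (hρ : ∀ k n, ∑ i ∈ Finset.range n, ρ i k ≤ 3)
    {a : ℕ → ι → ℤ → ℝ} {β : ℕ → ℝ} (hβ0 : ∀ i, 0 ≤ β i) (hβ : Summable β)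
    (h : ∀ i, ∀ t ∈ A, ∀ F : Finset ℤ,
      ∑ k ∈ F, W k * ((a (i + 1) t k - a i t k) ^ 2 / ρ i k) ≤ β i) :
    ∃ (c : ι → ℤ → ℝ) (ε : ℕ → ℝ), Tendsto ε atTop (𝓝 0) ∧ ∀ i, ∀ t ∈ A, ∀ F : Finset ℤ,
      ∑ k ∈ F, W k * (a i t k - c t k) ^ 2 ≤ ε i := by
  set ε : ℕ → ℝ := fun i => 3 * ∑' l, β (l + i) with hε
  have tε : Tendsto ε atTop (𝓝 0) := by
    simpa using (tendsto_sum_nat_add β).const_mul 3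
  have step : ∀ i n, ∀ t ∈ A, ∀ F : Finset ℤ,
      ∑ k ∈ F, W k * (a i t k - a (i + n) t k) ^ 2 ≤ ε i := fun i n t ht F => by
    have p1 : ∀ k, (a i t k - a (i + n) t k) ^ 2 ≤
        3 * ∑ l ∈ Finset.range n, (a (i + l + 1) t k - a (i + l) t k) ^ 2 / ρ (i + l) k := fun k => by
      have e : a (i + n) t k - a i t k =
          ∑ l ∈ Finset.range n, (a (i + l + 1) t k - a (i + l) t k) := by
        have := Finset.sum_range_sub (fun l => a (i + l) t k) n
        simpa [add_assoc] using this.symm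
      rcases Nat.eq_zero_or_pos n with rfl | hn
      · simp
      have cs := Finset.sq_sum_div_le_sum_sq_div (Finset.range n)
        (fun l => a (i + l + 1) t k - a (i + l) t k) (g := fun l => ρ (i + l) k)
        (fun l _ => hρ0 _ _)
      have hpos : 0 < ∑ l ∈ Finset.range n, ρ (i + l) k :=
        Finset.sum_pos (fun l _ => hρ0 _ _) ⟨0, by simpa using hn⟩
      have hle : ∑ l ∈ Finset.range n, ρ (i + l) k ≤ 3 := by
        have h1 := hρ k (i + n)
        rw [Finset.sum_range_add] at h1
        have h2 : 0 ≤ ∑ x ∈ Finset.range i, ρ x k := Finset.sum_nonneg fun _ _ => (hρ0 _ _).le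
        linarith
      rw [div_le_iff₀ hpos, ← e] at cs
      rw [← neg_sub, neg_sq, mul_comm]
      exact cs.trans (mul_le_mul_of_nonneg_left hle (Finset.sum_nonneg fun l _ =>
        div_nonneg (sq_nonneg _) (hρ0 _ _).le))
    calc ∑ k ∈ F, W k * (a i t k - a (i + n) t k) ^ 2
        ≤ ∑ k ∈ F, W k * (3 * ∑ l ∈ Finset.range n,
            (a (i + l + 1) t k - a (i + l) t k) ^ 2 / ρ (i + l) k) :=
          Finset.sum_le_sum fun k _ => mul_le_mul_of_nonneg_left (p1 k) (by linarith [hW k])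
      _ = 3 * ∑ l ∈ Finset.range n, ∑ k ∈ F,
            W k * ((a (i + l + 1) t k - a (i + l) t k) ^ 2 / ρ (i + l) k) := by
          rw [Finset.sum_comm, Finset.mul_sum]
          refine Finset.sum_congr rfl fun k _ => ?_
          rw [Finset.mul_sum, Finset.mul_sum, Finset.mul_sum]
          exact Finset.sum_congr rfl fun l _ => by ring
      _ ≤ 3 * ∑ l ∈ Finset.range n, β (l + i) := by
          gcongr with l _
          rw [add_comm l i]
          exact h _ t ht F
      _ ≤ ε i := by
          have := ((summable_nat_add_iff i).2 hβ).sum_le_tsum (Finset.range n)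
            fun l _ => hβ0 _
          simp only [hε]
          linarith
  refine ⟨fun t k => limUnder atTop fun i => a i t k, ε, tε, fun i t ht F => ?_⟩
  have lim : ∀ k, Tendsto (fun i => a i t k) atTop (𝓝 (limUnder atTop fun i => a i t k)) :=
    fun k => by
      refine CauchySeq.tendsto_limUnder (cauchySeq_of_le_tendsto_0' (fun n => √(ε n)) (fun n m hnm => ?_)
        (by simpa using tε.sqrt))
      obtain ⟨j, rfl⟩ := Nat.exists_eq_add_of_le hnm
      have := step n j t ht {k}
      rw [Finset.sum_singleton] at this
      rw [dist_eq]
      refine abs_le_sqrt (le_trans ?_ this)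
      nlinarith [sq_nonneg (a n t k - a (n + j) t k), hW k]
  have lim' : Tendsto (fun n => ∑ k ∈ F, W k * (a i t k - a (n + i) t k) ^ 2) atTop
      (𝓝 (∑ k ∈ F, W k * (a i t k - limUnder atTop fun i => a i t k) ^ 2)) := by
    refine tendsto_finsetSum _ fun k _ => ((tendsto_const_nhds.sub
      ((lim k).comp (tendsto_add_atTop_nat i))).pow 2).const_mul _
  refine le_of_tendsto' lim' fun n => ?_
  rw [add_comm n i]
  exact step i n t ht F

lemma summable_inv_weight : Summable fun k : ℤ => (1 + (k:ℝ) ^ 2)⁻¹ := by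
  refine Summable.of_nonneg_of_le (fun k => by positivity) (fun k => ?_)
    ((summable_one_div_int_pow (p := 2)).2 (by norm_num) |>.mul_left 1 |>.add
      (summable_of_ne_finset_zero (s := {0}) (f := fun k : ℤ => if k = 0 then (1:ℝ) else 0)
        fun k hk => by simpa using hk))
  by_cases hk : k = 0
  · simp [hk]
  · have : (0:ℝ) < (k:ℝ) ^ 2 := by positivity
    simp only [hk, if_false, add_zero, one_mul, one_div]
    exact inv_anti₀ this (by linarith)

/-- The constant of the Sobolev embedding. -/
noncomputable def sobC : ℝ := 4 * ∑' k : ℤ, (1 + (k:ℝ) ^ 2)⁻¹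

lemma sobC_nonneg : 0 ≤ sobC := mul_nonneg (by norm_num) (tsum_nonneg fun _ => by positivity)

lemma dx_cas_sq_le (j : ℕ) (k : ℤ) (x : ℝ) : dx j (cas k) x ^ 2 ≤ 4 * (1 + (k:ℝ) ^ 2) ^ j := by
  have h := abs_dx_cas_le j k x
  calc dx j (cas k) x ^ 2 = |dx j (cas k) x| ^ 2 := (sq_abs _).symm
    _ ≤ (2 * |(k:ℝ)| ^ j) ^ 2 := by gcongr
    _ = 4 * ((k:ℝ) ^ 2) ^ j := by rw [mul_pow, ← pow_mul, mul_comm j 2, pow_mul, sq_abs]; ring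
    _ ≤ 4 * (1 + (k:ℝ) ^ 2) ^ j := by gcongr; linarith

lemma sum_cas_sq_le (j : ℕ) (F : Finset ℤ) (d : ℤ → ℝ) (x : ℝ) :
    (∑ k ∈ F, d k * dx j (cas k) x) ^ 2 ≤
      sobC * ∑ k ∈ F, (1 + (k:ℝ) ^ 2) ^ (j + 1) * d k ^ 2 := by
  have h := Finset.sum_sq_le_sum_mul_sum_of_sq_le_mul F
    (r := fun k : ℤ => d k * dx j (cas k) x) (f := fun k : ℤ => 4 * (1 + (k:ℝ) ^ 2)⁻¹)
    (g := fun k : ℤ => (1 + (k:ℝ) ^ 2) ^ (j + 1) * d k ^ 2) (fun k _ => by positivity)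
    (fun k _ => by positivity) (fun k _ => by
      have := dx_cas_sq_le j k x
      have h1 : (0:ℝ) < 1 + (k:ℝ) ^ 2 := by positivity
      rw [mul_pow, pow_succ _ j]
      calc d k ^ 2 * dx j (cas k) x ^ 2 ≤ d k ^ 2 * (4 * (1 + (k:ℝ) ^ 2) ^ j) := by gcongr
        _ = _ := by field_simp)
  refine h.trans (mul_le_mul_of_nonneg_right ?_ (Finset.sum_nonneg fun k _ => by positivity))
  rw [← Finset.mul_sum, sobC]
  exact mul_le_mul_of_nonneg_left (summable_inv_weight.sum_le_tsum F fun k _ => by positivity)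
    (by norm_num)

lemma summable_cas {j : ℕ} {d : ℤ → ℝ}
    (h : Summable fun k : ℤ => (1 + (k:ℝ) ^ 2) ^ (j + 1) * d k ^ 2) :
    Summable fun k : ℤ => |d k| * (2 * |(k:ℝ)| ^ j) := by
  refine Summable.of_nonneg_of_le (fun k => by positivity) (fun k => ?_)
    (summable_inv_weight.add h)
  set w := 1 + (k:ℝ) ^ 2 with hw
  have h1 : (0:ℝ) < w := by positivity
  have h2 : (|(k:ℝ)| ^ j) ^ 2 ≤ w ^ j := by
    rw [← pow_mul, mul_comm j 2, pow_mul, sq_abs]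
    gcongr; linarith
  have h3 : w⁻¹ * w = 1 := inv_mul_cancel₀ h1.ne'
  have h4 : 0 ≤ w⁻¹ * (1 - w * (|(k:ℝ)| ^ j * |d k|)) ^ 2 := by positivity
  have h5 : w⁻¹ * (1 - w * (|(k:ℝ)| ^ j * |d k|)) ^ 2 =
      w⁻¹ - 2 * (|(k:ℝ)| ^ j * |d k|) + w * ((|(k:ℝ)| ^ j) ^ 2 * d k ^ 2) := by
    rw [← sq_abs (d k)]; field_simp; ring
  have h6 : w * ((|(k:ℝ)| ^ j) ^ 2 * d k ^ 2) ≤ w * (w ^ j * d k ^ 2) := by gcongr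
  rw [pow_succ]
  linarith

/-- The function with Hartley coefficients `c`. -/
noncomputable def ser (c : ℤ → ℝ) (x : ℝ) : ℝ := ∑' k, c k * cas k x

lemma summable_weight_mono {m n : ℕ} (h : m ≤ n) {d : ℤ → ℝ}
    (hd : Summable fun k : ℤ => (1 + (k:ℝ) ^ 2) ^ n * d k ^ 2) :
    Summable fun k : ℤ => (1 + (k:ℝ) ^ 2) ^ m * d k ^ 2 :=
  hd.of_nonneg_of_le (fun k => by positivity) fun k =>
    mul_le_mul_of_nonneg_right (pow_le_pow_right₀ (by nlinarith) h) (sq_nonneg _)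


lemma norm_term_le (c : ℤ → ℝ) (j : ℕ) (k : ℤ) (x : ℝ) :
    ‖c k * dx j (cas k) x‖ ≤ |c k| * (2 * |(k:ℝ)| ^ j) := by
  rw [norm_eq_abs, abs_mul]
  exact mul_le_mul_of_nonneg_left (abs_dx_cas_le j k x) (abs_nonneg _)

lemma dx_ser {c : ℤ → ℝ} {m : ℕ} (hs : Summable fun k : ℤ => (1 + (k:ℝ) ^ 2) ^ (m + 1) * c k ^ 2)
    {j : ℕ} (hj : j ≤ m) : dx j (ser c) = fun x => ∑' k, c k * dx j (cas k) x := by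
  induction j with
  | zero => simp only [dx_zero]; rfl
  | succ j ih =>
    rw [dx_succ, ih (by omega)]
    have s1 := summable_cas (summable_weight_mono (show j + 1 + 1 ≤ m + 1 by omega) hs)
    have s0 := summable_cas (summable_weight_mono (show j + 1 ≤ m + 1 by omega) hs)
    funext x
    refine (hasDerivAt_tsum (y₀ := 0) s1 (fun k y => ?_) (fun k y => norm_term_le c (j + 1) k y)
      (Summable.of_norm_bounded s0 fun k => norm_term_le c j k _) x).deriv
    exact ((smoothPer_cas k).hasDerivAt_dx j y).const_mul (c k)

lemma contDiff_ser {c : ℤ → ℝ} {m : ℕ}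
    (hs : Summable fun k : ℤ => (1 + (k:ℝ) ^ 2) ^ (m + 1) * c k ^ 2) : ContDiff ℝ m (ser c) := by
  refine contDiff_tsum (𝕜 := ℝ) (N := (m : ℕ∞)) (v := fun j k => |c k| * (2 * |(k:ℝ)| ^ j))
    (fun k => ?_) (fun j hj => ?_) (fun j k x hj => ?_)
  · exact contDiff_const.mul ((smoothPer_cas k).1.of_le (by exact_mod_cast le_top))
  · exact summable_cas (summable_weight_mono (by simpa using hj) hs)
  · rw [norm_iteratedFDeriv_eq_norm_iteratedDeriv, iteratedDeriv_const_mul_field]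
    exact norm_term_le c j k x

lemma periodic_ser (c : ℤ → ℝ) : Function.Periodic (ser c) (2 * π) := fun x =>
  tsum_congr fun k => by rw [(smoothPer_cas k).2 x]

/-- The squared weighted `ℓ²` distance of `a` and `c` is at most `e`. -/
def Near (s : ℕ) (a c : ℤ → ℝ) (e : ℝ) : Prop :=
  ∀ F : Finset ℤ, ∑ k ∈ F, (1 + (k:ℝ) ^ 2) ^ s * (a k - c k) ^ 2 ≤ e

lemma Near.summable {s : ℕ} {a c : ℤ → ℝ} {e : ℝ} (h : Near s a c e) :
    Summable fun k : ℤ => (1 + (k:ℝ) ^ 2) ^ s * (a k - c k) ^ 2 :=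
  summable_of_sum_le (fun k => by positivity) h

lemma Near.summable_right {s M : ℕ} {a c : ℤ → ℝ} {e : ℝ} (h : Near s a c e)
    (ha : ∀ k ∉ freq M, a k = 0) : Summable fun k : ℤ => (1 + (k:ℝ) ^ 2) ^ s * c k ^ 2 := by
  have h2 : Summable fun k : ℤ => (1 + (k:ℝ) ^ 2) ^ s * a k ^ 2 :=
    summable_of_ne_finset_zero (s := freq M) fun k hk => by simp [ha k hk]
  refine ((h.summable.add h2).mul_left 2).of_nonneg_of_le (fun k => by positivity) fun k => ?_
  rw [← mul_add, mul_left_comm]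
  exact mul_le_mul_of_nonneg_left (by nlinarith [sq_nonneg (a k - c k + a k)]) (by positivity)

lemma Near.mono {s m : ℕ} (hm : m ≤ s) {a c : ℤ → ℝ} {e : ℝ} (h : Near s a c e) : Near m a c e :=
  fun F => (Finset.sum_le_sum fun k _ =>
    mul_le_mul_of_nonneg_right (pow_le_pow_right₀ (by nlinarith) hm) (sq_nonneg _)).trans (h F)

lemma Near.dx_sub_le {m M : ℕ} {a c : ℤ → ℝ} {e : ℝ} (h : Near (m + 1) a c e)
    (ha : ∀ k ∉ freq M, a k = 0) {j : ℕ} (hj : j ≤ m) (x : ℝ) :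
    |dx j (tp M a) x - dx j (ser c) x| ≤ √(sobC * e) := by
  have hs := h.summable_right ha
  rw [dx_ser hs hj, dx_tp_eq_sum]
  have s1 : HasSum (fun k => c k * dx j (cas k) x) (∑' k, c k * dx j (cas k) x) :=
    (Summable.of_norm_bounded (summable_cas (summable_weight_mono (by omega) hs))
      fun k => norm_term_le c j k x).hasSum
  have s2 : HasSum (fun k => a k * dx j (cas k) x) (∑ k ∈ freq M, a k * dx j (cas k) x) :=
    hasSum_sum_of_ne_finset_zero fun k hk => by simp [ha k hk]
  refine le_of_tendsto' ((s2.sub s1).abs) fun F => abs_le_sqrt ?_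
  simp only [← sub_mul]
  exact (sum_cas_sq_le j F _ x).trans (mul_le_mul_of_nonneg_left (h.mono (by omega) F) sobC_nonneg)

lemma hc_ser {a : ℕ → ℤ → ℝ} {M : ℕ → ℕ} {c : ℤ → ℝ} {ε : ℕ → ℝ} (hM : ∀ i, i ≤ M i)
    (ha : ∀ i, ∀ k ∉ freq (M i), a i k = 0) (hε : Tendsto ε atTop (𝓝 0))
    (h : ∀ i, Near 1 (a i) c (ε i)) (k : ℤ) : hc (ser c) k = c k := by
  have cc : Continuous (ser c) := (contDiff_ser (m := 0) ((h 0).summable_right (ha 0))).continuous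
  have key : ∀ i, k.natAbs ≤ i → |hc (ser c) k - c k| ≤ 3 * √(max sobC 1 * ε i) := fun i hi => by
    have e0 : 0 ≤ ε i := by simpa using h i ∅
    have hk : k ∈ freq (M i) := mem_freq.2 (by
      have := hM i
      rw [Int.abs_eq_natAbs]
      omega)
    have h1 : |hc (tp (M i) (a i)) k - hc (ser c) k| ≤ 2 * √(max sobC 1 * ε i) := by
      rw [← hc_sub (smoothPer_tp _ _).continuous cc, hc, abs_mul, abs_of_pos (by positivity)]
      rw [inv_mul_le_iff₀ (by positivity)]
      have := intervalIntegral.norm_integral_le_of_norm_le_const (a := 0) (b := 2 * π)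
        (C := 2 * √(max sobC 1 * ε i))
        (f := fun x => (tp (M i) (a i) x - ser c x) * cas k x) fun x _ => by
          have h2 := (h i).dx_sub_le (m := 0) (ha i) le_rfl x
          simp only [dx_zero] at h2
          rw [norm_eq_abs, abs_mul, mul_comm]
          exact mul_le_mul (abs_cas_le k x) (h2.trans (sqrt_le_sqrt (by gcongr; exact le_max_left _ _)))
            (abs_nonneg _) (by norm_num)
      rw [sub_zero, abs_of_pos (by positivity), norm_eq_abs] at this
      rw [per]
      linarith
    rw [hc_of_mem hk] at h1
    have h3 : |a i k - c k| ≤ √(max sobC 1 * ε i) := by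
      refine abs_le_sqrt (le_trans ?_ (mul_le_mul_of_nonneg_right (le_max_right _ _) e0))
      have := h i {k}
      rw [Finset.sum_singleton, pow_one] at this
      nlinarith [sq_nonneg (a i k - c k), sq_nonneg (k:ℝ),
        mul_nonneg (sq_nonneg (k:ℝ)) (sq_nonneg (a i k - c k))]
    have h4 := abs_sub_le (hc (ser c) k) (a i k) (c k)
    rw [abs_sub_comm (hc (ser c) k) (a i k)] at h4
    linarith
  have lim : Tendsto (fun i => 3 * √(max sobC 1 * ε i)) atTop (𝓝 0) := by
    simpa using (hε.const_mul (max sobC 1)).sqrt.const_mul 3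
  have := ge_of_tendsto lim (eventually_atTop.2 ⟨k.natAbs, key⟩)
  exact sub_eq_zero.1 (abs_nonpos_iff.1 this)

end Series

section GalerkinLimit

open Real MeasureTheory Set Filter Topology

/-- Extension by zero of a finite family of coefficients. -/
noncomputable def ext0 {M : ℕ} (c : freq M → ℝ) (k : ℤ) : ℝ :=
  if h : k ∈ freq M then c ⟨k, h⟩ else 0

lemma emb_eq {M : ℕ} (c : freq M → ℝ) : emb M c = tp M (ext0 c) := rfl

lemma ext0_of_notMem {M : ℕ} (c : freq M → ℝ) : ∀ k ∉ freq M, ext0 c k = 0 := fun k hk => by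
  simp [ext0, hk]

lemma sum_weight_le_sob (m : ℕ) {M : ℕ} {a : ℤ → ℝ} (ha : ∀ k ∉ freq M, a k = 0) (F : Finset ℤ) :
    ∑ k ∈ F, (1 + (k:ℝ) ^ 2) ^ m * a k ^ 2 ≤ 2 ^ m * sob m (tp M a) := by
  have h1 : ∑ k ∈ F, (1 + (k:ℝ) ^ 2) ^ m * a k ^ 2 ≤
      ∑ k ∈ freq M, (1 + (k:ℝ) ^ 2) ^ m * a k ^ 2 := by
    have hS : HasSum (fun k : ℤ => (1 + (k:ℝ) ^ 2) ^ m * a k ^ 2)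
        (∑ k ∈ freq M, (1 + (k:ℝ) ^ 2) ^ m * a k ^ 2) :=
      hasSum_sum_of_ne_finset_zero fun k hk => by simp [ha k hk]
    exact sum_le_hasSum F (fun k _ => by positivity) hS
  have h2 : ∑ k ∈ freq M, (1 + (k:ℝ) ^ 2) ^ m * a k ^ 2 ≤ 2 ^ m *
      ∑ k ∈ freq M, (∑ j ∈ Finset.range (m + 1), (k:ℝ) ^ (2 * j)) * a k ^ 2 := by
    rw [Finset.mul_sum]
    refine Finset.sum_le_sum fun k _ => ?_
    rw [← mul_assoc]
    exact mul_le_mul_of_nonneg_right (weight_le_geom m k) (sq_nonneg _)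
  have h3 : 0 ≤ ∑ k ∈ freq M, (∑ j ∈ Finset.range (m + 1), (k:ℝ) ^ (2 * j)) * a k ^ 2 :=
    Finset.sum_nonneg fun k _ => mul_nonneg
      (Finset.sum_nonneg fun j _ => by rw [pow_mul]; positivity) (sq_nonneg _)
  rw [sob_tp]
  refine h1.trans (h2.trans (mul_le_mul_of_nonneg_left ?_ (by positivity)))
  nlinarith [pi_gt_three]

lemma sob_le_sum_weight (m M : ℕ) (a : ℤ → ℝ) :
    sob m (tp M a) ≤ 2 * π * ∑ k ∈ freq M, (1 + (k:ℝ) ^ 2) ^ m * a k ^ 2 := by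
  rw [sob_tp]
  exact mul_le_mul_of_nonneg_left (Finset.sum_le_sum fun k _ =>
    mul_le_mul_of_nonneg_right (geom_le_weight m k) (sq_nonneg _)) (by positivity)

/-- The ratio between a frequency and a dyadic scale, capped symmetrically. -/
noncomputable def ratio (i : ℕ) (k : ℤ) : ℝ :=
  min ((4:ℝ) ^ i / (1 + (k:ℝ) ^ 2)) ((1 + (k:ℝ) ^ 2) / 4 ^ i)

lemma ratio_pos (i : ℕ) (k : ℤ) : 0 < ratio i k := lt_min (by positivity) (by positivity)

lemma sum_ratio (k : ℤ) (n : ℕ) : ∑ i ∈ Finset.range n, ratio i k ≤ 3 :=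
  sum_ratio_le (by nlinarith) n

lemma ratio_le (i : ℕ) (k : ℤ) : ratio i k ≤ 3 :=
  (Finset.single_le_sum (f := fun i => ratio i k) (fun i _ => (ratio_pos i k).le)
    (Finset.self_mem_range_succ i)).trans (sum_ratio k (i + 1))

lemma inv_ratio_le (i : ℕ) (k : ℤ) {s : ℕ} (hs : 2 ≤ s) :
    (ratio i k)⁻¹ ≤ (1 + (k:ℝ) ^ 2) / 4 ^ i + (4 ^ i) ^ (s - 1) / (1 + (k:ℝ) ^ 2) ^ (s - 1) := by
  have h1 : (0:ℝ) < 1 + (k:ℝ) ^ 2 := by positivity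
  have h4 : (0:ℝ) < 4 ^ i := by positivity
  rw [ratio]
  rcases le_total ((4:ℝ) ^ i) (1 + (k:ℝ) ^ 2) with h | h
  · rw [min_eq_left, inv_div]
    · exact le_add_of_nonneg_right (by positivity)
    · rw [div_le_div_iff₀ h1 h4]; nlinarith
  · rw [min_eq_right, inv_div, ← div_pow]
    · have h5 : 1 ≤ (4:ℝ) ^ i / (1 + (k:ℝ) ^ 2) := (one_le_div h1).2 h
      have := le_self_pow₀ h5 (show s - 1 ≠ 0 by omega)
      have : 0 ≤ (1 + (k:ℝ) ^ 2) / 4 ^ i := by positivity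
      linarith
    · rw [div_le_div_iff₀ h4 h1]; nlinarith

lemma le_ratio_of_mem {i : ℕ} {k : ℤ} (hk : k ∈ freq (2 ^ (i + 1))) :
    (1 + (k:ℝ) ^ 2) / 4 ^ i ≤ 25 * ratio i k := by
  have h4 : (1:ℝ) ≤ 4 ^ i := one_le_pow₀ (by norm_num)
  have h1 : (0:ℝ) < 1 + (k:ℝ) ^ 2 := by positivity
  have hk' : |(k:ℝ)| ≤ 2 ^ (i + 1) := by exact_mod_cast mem_freq.1 hk
  have h2 : (k:ℝ) ^ 2 ≤ 4 * 4 ^ i := by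
    calc (k:ℝ) ^ 2 = |(k:ℝ)| ^ 2 := (sq_abs _).symm
      _ ≤ (2 ^ (i + 1)) ^ 2 := by gcongr
      _ = 4 * 4 ^ i := by rw [← pow_mul, mul_comm, pow_mul]; norm_num; ring
  rw [ratio, mul_min_of_nonneg _ _ (by norm_num)]
  refine le_min ?_ ?_
  · rw [← mul_div_assoc, div_le_div_iff₀ (by positivity) h1]
    nlinarith
  · have : 0 ≤ (1 + (k:ℝ) ^ 2) / 4 ^ i := by positivity
    linarith

lemma one_le_ratio_of_mem {i : ℕ} {k : ℤ} (hk : k ∈ freq (2 ^ (i + 1))) (hk' : k ∉ freq (2 ^ i)) :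
    (4:ℝ) ^ i ≤ 1 + (k:ℝ) ^ 2 ∧ 1 ≤ 25 * ratio i k := by
  have h4 : (0:ℝ) < 4 ^ i := by positivity
  have h3 : (2:ℝ) ^ i ≤ |(k:ℝ)| := by
    have := mt mem_freq.2 hk'
    push Not at this
    exact_mod_cast this.le
  have h1 : (4:ℝ) ^ i ≤ 1 + (k:ℝ) ^ 2 := by
    calc (4:ℝ) ^ i = (2 ^ i) ^ 2 := by rw [← pow_mul, mul_comm, pow_mul]; norm_num
      _ ≤ |(k:ℝ)| ^ 2 := by gcongr
      _ ≤ _ := by rw [sq_abs]; linarith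
  exact ⟨h1, ((one_le_div h4).2 h1).trans (le_ratio_of_mem hk)⟩

section dyadic

variable {s : ℕ} {b : ℤ → ℝ} (hb : Summable fun k : ℤ => (1 + (k:ℝ) ^ 2) ^ s * b k ^ 2)

include hb

lemma summable_ratio_mul (i : ℕ) :
    Summable fun k : ℤ => ratio i k * ((1 + (k:ℝ) ^ 2) ^ s * b k ^ 2) :=
  (hb.mul_left 3).of_nonneg_of_le (fun k => mul_nonneg (ratio_pos i k).le (by positivity))
    fun k => mul_le_mul_of_nonneg_right (ratio_le i k) (by positivity)

lemma summable_tsum_ratio :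
    Summable fun i => ∑' k : ℤ, ratio i k * ((1 + (k:ℝ) ^ 2) ^ s * b k ^ 2) := by
  refine summable_of_sum_range_le (c := 3 * ∑' k : ℤ, (1 + (k:ℝ) ^ 2) ^ s * b k ^ 2)
    (fun i => tsum_nonneg fun k => mul_nonneg (ratio_pos i k).le (by positivity)) fun n => ?_
  rw [← Summable.tsum_finsetSum fun i _ => summable_ratio_mul hb i, ← tsum_mul_left]
  refine Summable.tsum_le_tsum (fun k => ?_)
    (summable_sum fun i _ => summable_ratio_mul hb i) (hb.mul_left 3)
  rw [← Finset.sum_mul]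
  exact mul_le_mul_of_nonneg_right (sum_ratio k n) (by positivity)

lemma sum_freq_weight_le (i : ℕ) {n : ℕ} (hn : n ≤ i + 1) :
    (∑ k ∈ freq (2 ^ n), (1 + (k:ℝ) ^ 2) ^ (s + 1) * b k ^ 2) / 4 ^ i ≤
      25 * ∑' k : ℤ, ratio i k * ((1 + (k:ℝ) ^ 2) ^ s * b k ^ 2) := by
  rw [Finset.sum_div]
  calc ∑ k ∈ freq (2 ^ n), (1 + (k:ℝ) ^ 2) ^ (s + 1) * b k ^ 2 / 4 ^ i
      ≤ ∑ k ∈ freq (2 ^ n), 25 * (ratio i k * ((1 + (k:ℝ) ^ 2) ^ s * b k ^ 2)) := by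
        refine Finset.sum_le_sum fun k hk => ?_
        have hk' : k ∈ freq (2 ^ (i + 1)) := by
          have h1 := mem_freq.1 hk
          have h2 : 2 ^ n ≤ 2 ^ (i + 1) := Nat.pow_le_pow_right (by norm_num) hn
          exact mem_freq.2 (h1.trans (by exact_mod_cast h2))
        have := mul_le_mul_of_nonneg_right (le_ratio_of_mem hk')
          (show 0 ≤ (1 + (k:ℝ) ^ 2) ^ s * b k ^ 2 by positivity)
        calc _ = (1 + (k:ℝ) ^ 2) / 4 ^ i * ((1 + (k:ℝ) ^ 2) ^ s * b k ^ 2) := by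
              rw [pow_succ]; ring
          _ ≤ _ := by rwa [← mul_assoc 25]
    _ ≤ _ := by
        rw [← Finset.mul_sum]
        exact mul_le_mul_of_nonneg_left ((summable_ratio_mul hb i).sum_le_tsum _ fun k _ =>
          mul_nonneg (ratio_pos i k).le (by positivity)) (by norm_num)

lemma sum_annulus_le (hs : 1 ≤ s) (i : ℕ) (F : Finset ℤ) :
    (4 ^ i) ^ (s - 1) * ∑ k ∈ F, (1 + (k:ℝ) ^ 2) ^ 1 *
      ((if k ∈ freq (2 ^ (i + 1)) then b k else 0) - if k ∈ freq (2 ^ i) then b k else 0) ^ 2 ≤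
      25 * ∑' k : ℤ, ratio i k * ((1 + (k:ℝ) ^ 2) ^ s * b k ^ 2) := by
  rw [Finset.mul_sum]
  calc _ ≤ ∑ k ∈ F, 25 * (ratio i k * ((1 + (k:ℝ) ^ 2) ^ s * b k ^ 2)) := by
        refine Finset.sum_le_sum fun k _ => ?_
        have hp : 0 ≤ 25 * (ratio i k * ((1 + (k:ℝ) ^ 2) ^ s * b k ^ 2)) :=
          mul_nonneg (by norm_num) (mul_nonneg (ratio_pos i k).le (by positivity))
        by_cases h1 : k ∈ freq (2 ^ i)
        · have h2 : k ∈ freq (2 ^ (i + 1)) := by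
            have h2 : 2 ^ i ≤ 2 ^ (i + 1) := Nat.pow_le_pow_right (by norm_num) (by omega)
            exact mem_freq.2 ((mem_freq.1 h1).trans (by exact_mod_cast h2))
          simpa [h1, h2] using hp
        by_cases h2 : k ∈ freq (2 ^ (i + 1))
        · obtain ⟨h3, h4⟩ := one_le_ratio_of_mem h2 h1
          simp only [h1, h2, if_true, if_false, sub_zero, pow_one]
          have h5 : ((4:ℝ) ^ i) ^ (s - 1) * (1 + (k:ℝ) ^ 2) ≤ (1 + (k:ℝ) ^ 2) ^ s := by
            obtain ⟨n, rfl⟩ := Nat.exists_eq_add_of_le' hs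
            rw [Nat.add_sub_cancel, pow_succ _ n]
            exact mul_le_mul_of_nonneg_right (pow_le_pow_left₀ (by positivity) h3 _) (by positivity)
          have h6 := mul_le_mul_of_nonneg_right h5 (sq_nonneg (b k))
          have h7 : 0 ≤ (1 + (k:ℝ) ^ 2) ^ s * b k ^ 2 := by positivity
          nlinarith
        · simpa [h1, h2] using hp
    _ ≤ _ := by
        rw [← Finset.mul_sum]
        exact mul_le_mul_of_nonneg_left ((summable_ratio_mul hb i).sum_le_tsum _ fun k _ =>
          mul_nonneg (ratio_pos i k).le (by positivity)) (by norm_num)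

end dyadic

end GalerkinLimit

section GalerkinConvergence

open Real MeasureTheory Set Filter Topology

lemma tp_sub_eq {M M' : ℕ} (h : M ≤ M') {a a' : ℤ → ℝ} (ha : ∀ k ∉ freq M, a k = 0) :
    tp M' (fun k => a' k - a k) = fun y => tp M' a' y - tp M a y := by
  funext y
  rw [tp_sub, tp_extend h ha]

lemma sum_weight_sub_le (m : ℕ) {M M' : ℕ} {a a' : ℤ → ℝ} (ha : ∀ k ∉ freq M, a k = 0)
    (ha' : ∀ k ∉ freq M', a' k = 0) (F : Finset ℤ) :
    ∑ k ∈ F, (1 + (k:ℝ) ^ 2) ^ m * (a' k - a k) ^ 2 ≤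
      2 * 2 ^ m * (sob m (tp M' a') + sob m (tp M a)) := by
  have h1 := sum_weight_le_sob m ha F
  have h2 := sum_weight_le_sob m ha' F
  have h3 : ∑ k ∈ F, (1 + (k:ℝ) ^ 2) ^ m * (a' k - a k) ^ 2 ≤
      2 * (∑ k ∈ F, (1 + (k:ℝ) ^ 2) ^ m * a' k ^ 2 + ∑ k ∈ F, (1 + (k:ℝ) ^ 2) ^ m * a k ^ 2) := by
    rw [← Finset.sum_add_distrib, Finset.mul_sum]
    refine Finset.sum_le_sum fun k _ => ?_
    rw [← mul_add, mul_left_comm]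
    exact mul_le_mul_of_nonneg_left (by nlinarith [sq_nonneg (a' k + a k)]) (by positivity)
  linarith

lemma weight_div_ratio_le (i : ℕ) {s : ℕ} (hs : 2 ≤ s) (k : ℤ) (X : ℝ) :
    (1 + (k:ℝ) ^ 2) ^ s * (X ^ 2 / ratio i k) ≤
      (1 + (k:ℝ) ^ 2) ^ (s + 1) * X ^ 2 / 4 ^ i +
        (4 ^ i) ^ (s - 1) * ((1 + (k:ℝ) ^ 2) ^ 1 * X ^ 2) := by
  have h := mul_le_mul_of_nonneg_left (inv_ratio_le i k hs)
    (show 0 ≤ (1 + (k:ℝ) ^ 2) ^ s * X ^ 2 by positivity)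
  have hW : (0:ℝ) < 1 + (k:ℝ) ^ 2 := by positivity
  obtain ⟨n, rfl⟩ := Nat.exists_eq_add_of_le' (show 1 ≤ s by omega)
  rw [Nat.add_sub_cancel] at h ⊢
  calc _ = (1 + (k:ℝ) ^ 2) ^ (n + 1) * X ^ 2 * (ratio i k)⁻¹ := by ring
    _ ≤ _ := h
    _ = _ := by field_simp; ring

lemma pow_mul_inv_sq_le (i : ℕ) {s : ℕ} (hs : 1 ≤ s) {M : ℕ} (hM : (2 ^ i) ^ s ≤ M) :
    ((4:ℝ) ^ i) ^ (s - 1) * (((M:ℝ) + 1)⁻¹) ^ 2 ≤ 1 / 4 ^ i := by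
  have h1 : ((2:ℝ) ^ i) ^ s ≤ (M:ℝ) + 1 := by
    have : (((2 ^ i) ^ s : ℕ) : ℝ) ≤ M := by exact_mod_cast hM
    push_cast at this
    linarith
  have h2 : ((4:ℝ) ^ i) ^ s ≤ ((M:ℝ) + 1) ^ 2 := by
    calc ((4:ℝ) ^ i) ^ s = (((2:ℝ) ^ i) ^ s) ^ 2 := by
          rw [show (4:ℝ) = 2 ^ 2 by norm_num]; simp only [← pow_mul]; congr 1; ring
      _ ≤ _ := by gcongr
  obtain ⟨n, rfl⟩ := Nat.exists_eq_add_of_le' hs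
  rw [Nat.add_sub_cancel, inv_pow, ← div_eq_mul_inv, div_le_div_iff₀ (by positivity) (by positivity),
    one_mul, ← pow_succ]
  exact h2

/-- Truncation of a sequence of coefficients to `|k| ≤ 2 ^ i`. -/
noncomputable def trunc (b : ℤ → ℝ) (i : ℕ) (k : ℤ) : ℝ := if k ∈ freq (2 ^ i) then b k else 0

lemma sob_trunc_le (m : ℕ) (b : ℤ → ℝ) {i M : ℕ} (hM : 2 ^ i ≤ M) :
    sob m (tp M (trunc b i)) ≤ 2 * π * ∑ k ∈ freq (2 ^ i), (1 + (k:ℝ) ^ 2) ^ m * b k ^ 2 := by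
  rw [tp_extend hM (c := trunc b i) fun k hk => if_neg hk]
  refine (sob_le_sum_weight m _ _).trans_eq ?_
  congr 1
  exact Finset.sum_congr rfl fun k hk => by rw [trunc, if_pos hk]

lemma ext0_restrict {M : ℕ} {a : ℤ → ℝ} (ha : ∀ k ∉ freq M, a k = 0) :
    ext0 (fun k : freq M => a k) = a := by
  funext k
  by_cases hk : k ∈ freq M <;> simp [ext0, hk, ha]

theorem galerkin_limit (P : Eqn) (r : ℝ) : ∃ T, 0 < T ∧ T ≤ 1 ∧ ∀ s, 13 ≤ s → ∀ b : ℤ → ℝ,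
    (Summable fun k : ℤ => (1 + (k:ℝ) ^ 2) ^ s * b k ^ 2) →
    ∑' k : ℤ, (1 + (k:ℝ) ^ 2) ^ 12 * b k ^ 2 ≤ r →
    ∃ (M : ℕ → ℕ) (c : ∀ i, ℝ → freq (M i) → ℝ) (cl : ℝ → ℤ → ℝ) (ε : ℕ → ℝ) (R : ℝ),
      (∀ i, i ≤ M i) ∧ (∀ i, IsGal P (M i) T (c i)) ∧ Tendsto ε atTop (𝓝 0) ∧
      (∀ i, ∀ t ∈ Icc 0 T, Near s (ext0 (c i t)) (cl t) (ε i)) ∧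
      (∀ i, ∀ t ∈ Icc 0 T, sob 12 (emb (M i) (c i t)) ≤ R) ∧ cl 0 = b := by
  obtain ⟨T, R, hT0, hT1, hG⟩ := exists_isGal P (2 * π * r)
  refine ⟨T, hT0, hT1, fun s hs b hb hr => ?_⟩
  have hMi : ∀ i, 2 ^ i ≤ (2 ^ i) ^ s := fun i => Nat.le_self_pow (by omega) _
  have hb' : ∀ m, m ≤ s → Summable fun k : ℤ => (1 + (k:ℝ) ^ 2) ^ m * b k ^ 2 :=
    fun m hm => summable_weight_mono hm hb
  have hfr : ∀ m, m ≤ s → ∀ i, ∑ k ∈ freq (2 ^ i), (1 + (k:ℝ) ^ 2) ^ m * b k ^ 2 ≤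
      ∑' k : ℤ, (1 + (k:ℝ) ^ 2) ^ m * b k ^ 2 := fun m hm i =>
    (hb' m hm).sum_le_tsum _ fun k _ => by positivity
  have htr : ∀ i, ∀ k ∉ freq ((2 ^ i) ^ s), trunc b i k = 0 := fun i k hk =>
    if_neg fun h => hk (mem_freq.2 ((mem_freq.1 h).trans (by exact_mod_cast hMi i)))
  have hdat : ∀ i, sob 12 (emb ((2 ^ i) ^ s) fun k => trunc b i k) ≤ 2 * π * r := fun i => by
    rw [emb_restrict]
    exact (sob_trunc_le 12 b (hMi i)).trans (mul_le_mul_of_nonneg_left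
      ((hfr 12 (by omega) i).trans hr) (by positivity))
  choose c c0 cG cR using fun i => hG _ _ (hdat i)
  obtain ⟨K1, hK1, h1⟩ := IsGal.sob_le P (show 12 ≤ s by omega) R
    (2 * π * ∑' k : ℤ, (1 + (k:ℝ) ^ 2) ^ s * b k ^ 2)
  obtain ⟨K2, hK2, h2⟩ := IsGal.propagate P (show 12 ≤ s by omega) K1
  obtain ⟨K3, hK3, h3⟩ := IsGal.difference_le P R
  set D : ℕ → ℝ := fun i => ∑' k : ℤ, ratio i k * ((1 + (k:ℝ) ^ 2) ^ s * b k ^ 2) with hD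
  have D0 : ∀ i, 0 ≤ D i := fun i =>
    tsum_nonneg fun k => mul_nonneg (ratio_pos i k).le (by positivity)
  have hhigh : ∀ i n, n ≤ i + 1 → ∀ t ∈ Icc 0 T,
      sob (s + 1) (emb ((2 ^ n) ^ s) (c n t)) / 4 ^ i ≤ K2 * (1 / 4 ^ i + 2 * π * (25 * D i)) :=
    fun i n hn t ht => by
      have e1 : ∀ τ ∈ Icc 0 T, sob s (emb ((2 ^ n) ^ s) (c n τ)) ≤ K1 :=
        h1 _ T (c n) hT1 (cG n) (cR n) (by
          rw [c0, emb_restrict]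
          exact (sob_trunc_le s b (hMi n)).trans (mul_le_mul_of_nonneg_left
            (hfr s le_rfl n) (by positivity)))
      have e2 := h2 _ T (c n) hT1 (cG n) e1 t ht
      rw [c0, emb_restrict] at e2
      have e3 := sob_trunc_le (s + 1) b (hMi n)
      have e4 : ∑ k ∈ freq (2 ^ n), (1 + (k:ℝ) ^ 2) ^ (s + 1) * b k ^ 2 ≤ 25 * D i * 4 ^ i :=
        (div_le_iff₀ (by positivity)).1 (sum_freq_weight_le hb i hn)
      rw [div_le_iff₀ (by positivity)]
      have e5 : (1 / (4:ℝ) ^ i) * 4 ^ i = 1 := by field_simp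
      refine e2.trans ?_
      rw [mul_assoc K2, add_mul, e5]
      refine mul_le_mul_of_nonneg_left (add_le_add le_rfl (e3.trans ?_)) hK2
      rw [mul_assoc (2 * π)]
      exact mul_le_mul_of_nonneg_left e4 (by positivity)
  have hlow : ∀ i, ∀ t ∈ Icc 0 T, ∀ F : Finset ℤ, (4 ^ i) ^ (s - 1) * ∑ k ∈ F, (1 + (k:ℝ) ^ 2) ^ 1 *
      (ext0 (c (i + 1) t) k - ext0 (c i t) k) ^ 2 ≤
        2 * K3 * (2 * π * (25 * D i) + 2 * (1 / 4 ^ i)) := fun i t ht F => by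
    have hM : (2 ^ i) ^ s ≤ (2 ^ (i + 1)) ^ s :=
      Nat.pow_le_pow_left (Nat.pow_le_pow_right (by norm_num) (by omega)) s
    have hd := h3 ((2 ^ (i + 1)) ^ s) ((2 ^ i) ^ s) T (c (i + 1)) (c i) hT1 (cG _) (cG _)
      (fun τ hτ => (sob_mono (by norm_num) _).trans (cR _ τ hτ))
      (fun τ hτ => (sob_mono (by norm_num) _).trans (cR _ τ hτ)) t ht
    rw [c0, c0, emb_restrict, emb_restrict, ← tp_sub_eq hM (htr i), emb_eq, emb_eq,
      ← tp_sub_eq hM (ext0_of_notMem (c i t))] at hd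
    have hz : ∀ k ∉ freq ((2 ^ (i + 1)) ^ s), ext0 (c (i + 1) t) k - ext0 (c i t) k = 0 :=
      fun k hk => by
        rw [ext0_of_notMem _ k hk, ext0_of_notMem _ k fun h => hk (mem_freq.2
          ((mem_freq.1 h).trans (by exact_mod_cast hM))), sub_zero]
    have e1 := sum_weight_le_sob 1 hz F
    have e2 := sob_le_sum_weight 1 ((2 ^ (i + 1)) ^ s) (fun k => trunc b (i + 1) k - trunc b i k)
    have e3 := sum_annulus_le hb (by omega) i (freq ((2 ^ (i + 1)) ^ s))
    have e4 := pow_mul_inv_sq_le i (show 1 ≤ s by omega) hM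
    have e5 := pow_mul_inv_sq_le i (show 1 ≤ s by omega) (le_refl ((2 ^ i) ^ s))
    have p0 : (0:ℝ) ≤ (4 ^ i) ^ (s - 1) := by positivity
    have e6 := mul_le_mul_of_nonneg_left (e1.trans (mul_le_mul_of_nonneg_left
      (hd.trans (mul_le_mul_of_nonneg_left (add_le_add e2 le_rfl) hK3)) (by norm_num))) p0
    refine e6.trans ?_
    have e7 := mul_le_mul_of_nonneg_left e3 (show 0 ≤ 2 * π by positivity)
    have e8 := mul_le_mul_of_nonneg_left (add_le_add e7 (add_le_add e4 e5))
      (show 0 ≤ 2 * K3 by positivity)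
    simp only [trunc] at *
    linarith
  obtain ⟨cl, ε, hε, hcl⟩ := exists_limit (A := Icc 0 T) (W := fun k : ℤ => (1 + (k:ℝ) ^ 2) ^ s)
    (fun k => one_le_pow₀ (by nlinarith)) ratio_pos sum_ratio (a := fun i t => ext0 (c i t))
    (β := fun i => 2 * 2 ^ (s + 1) * (2 * (K2 * (1 / 4 ^ i + 2 * π * (25 * D i)))) +
      2 * K3 * (2 * π * (25 * D i) + 2 * (1 / 4 ^ i)))
    (fun i => by have := D0 i; positivity)
    (by
      have g : Summable fun i : ℕ => (1:ℝ) / 4 ^ i := by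
        simpa [one_div] using summable_geometric_of_lt_one (r := (4:ℝ)⁻¹) (by norm_num) (by norm_num)
      have d := ((summable_tsum_ratio hb).mul_left 25).mul_left (2 * π)
      exact (((g.add d).mul_left _).mul_left _ |>.mul_left _).add
        ((d.add (g.mul_left _)).mul_left _))
    (fun i t ht F => by
      refine (Finset.sum_le_sum fun k _ => weight_div_ratio_le i (by omega) k _).trans ?_
      rw [Finset.sum_add_distrib, ← Finset.sum_div, ← Finset.mul_sum]
      refine add_le_add ?_ (hlow i t ht F)
      have e1 := sum_weight_sub_le (s + 1) (ext0_of_notMem (c i t)) (ext0_of_notMem (c (i + 1) t)) F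
      refine (div_le_div_of_nonneg_right e1 (by positivity)).trans ?_
      rw [mul_div_assoc, add_div]
      refine mul_le_mul_of_nonneg_left ?_ (by positivity)
      have a1 := hhigh i i (by omega) t ht
      have a2 := hhigh i (i + 1) le_rfl t ht
      rw [emb_eq] at a1 a2
      linarith)
  refine ⟨fun i => (2 ^ i) ^ s, c, cl, ε, R, fun i => (Nat.lt_two_pow_self.le.trans (hMi i)), cG, hε,
    hcl, cR, ?_⟩
  funext k
  have lim : Tendsto (fun i => √(ε i)) atTop (𝓝 0) := by simpa using hε.sqrt
  have key : ∀ᶠ i in atTop, |b k - cl 0 k| ≤ √(ε i) := by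
    filter_upwards [eventually_ge_atTop k.natAbs] with i hi
    have hk : k ∈ freq (2 ^ i) := mem_freq.2 (by
      have : i < 2 ^ i := Nat.lt_two_pow_self
      rw [Int.abs_eq_natAbs]
      exact_mod_cast hi.trans this.le)
    have := hcl i 0 ⟨le_rfl, hT0.le⟩ {k}
    rw [Finset.sum_singleton, c0, ext0_restrict (htr i), trunc, if_pos hk] at this
    refine abs_le_sqrt (le_trans ?_ this)
    exact le_mul_of_one_le_left (sq_nonneg _) (one_le_pow₀ (by nlinarith))
  exact (sub_eq_zero.1 (abs_nonpos_iff.1 (ge_of_tendsto lim key))).symm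

end GalerkinConvergence

section LimitSolution

open Real MeasureTheory Set Filter Topology

/-- A sequence of Galerkin approximations whose coefficients converge uniformly in the
`H^s` norm on the time interval `[0, T]`. -/
structure GalLimit (P : Eqn) (T : ℝ) (s : ℕ) where
  M : ℕ → ℕ
  c : ∀ i, ℝ → freq (M i) → ℝ
  cl : ℝ → ℤ → ℝ
  ε : ℕ → ℝ
  R : ℝ
  T_nonneg : 0 ≤ T
  T_le : T ≤ 1
  le_s : 13 ≤ s
  le_M : ∀ i, i ≤ M i
  gal : ∀ i, IsGal P (M i) T (c i)
  tendsto : Tendsto ε atTop (𝓝 0)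
  near : ∀ i, ∀ t ∈ Icc 0 T, Near s (ext0 (c i t)) (cl t) (ε i)
  bound : ∀ i, ∀ t ∈ Icc 0 T, sob 12 (emb (M i) (c i t)) ≤ R

/-- The projection of the time line to `[0, T]`. -/
noncomputable def clamp (T t : ℝ) : ℝ := max 0 (min t T)

lemma clamp_mem {T : ℝ} (hT : 0 ≤ T) (t : ℝ) : clamp T t ∈ Icc 0 T :=
  ⟨le_max_left _ _, max_le hT (min_le_right _ _)⟩

lemma clamp_of_mem {T t : ℝ} (ht : t ∈ Icc 0 T) : clamp T t = t := by
  rw [clamp, min_eq_left ht.2, max_eq_right ht.1]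

lemma continuous_clamp (T : ℝ) : Continuous (clamp T) := by
  unfold clamp; fun_prop

lemma hsNorm_sq_of_hc {f : ℝ → ℝ} (hf : Continuous f) {s : ℕ} {S : ℝ}
    (h : HasSum (fun k : ℤ => (1 + (k:ℝ) ^ 2) ^ s * hc f k ^ 2) S) : hsNorm s f = √S := by
  rw [hsNorm, (hasSum_weight_fc hf (ω := fun k : ℤ => (1 + (k:ℝ) ^ 2) ^ s)
    (fun k => by push_cast; ring) h).tsum_eq]

namespace GalLimit

variable {P : Eqn} {T : ℝ} {s : ℕ} (G : GalLimit P T s)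

/-- The approximations, extended constantly in time beyond `[0, T]`. -/
noncomputable def approx (i : ℕ) (t : ℝ) : ℝ → ℝ := emb (G.M i) (G.c i (clamp T t))

/-- The limit, extended constantly in time beyond `[0, T]`. -/
noncomputable def sol (t : ℝ) : ℝ → ℝ := ser (G.cl (clamp T t))

lemma near_clamp (i : ℕ) (t : ℝ) :
    Near s (ext0 (G.c i (clamp T t))) (G.cl (clamp T t)) (G.ε i) :=
  G.near i _ (clamp_mem G.T_nonneg t)

lemma summable_cl (t : ℝ) :
    Summable fun k : ℤ => (1 + (k:ℝ) ^ 2) ^ s * G.cl (clamp T t) k ^ 2 :=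
  (G.near_clamp 0 t).summable_right (ext0_of_notMem _)

lemma hc_sol (t : ℝ) (k : ℤ) : hc (G.sol t) k = G.cl (clamp T t) k :=
  hc_ser G.le_M (fun i => ext0_of_notMem (G.c i (clamp T t))) G.tendsto
    (fun i => (G.near_clamp i t).mono (by have := G.le_s; omega)) k

lemma contDiff_sol (t : ℝ) : ContDiff ℝ 3 (G.sol t) :=
  contDiff_ser (m := 3) (summable_weight_mono (by have := G.le_s; omega) (G.summable_cl t))

lemma periodic_sol (t : ℝ) : Function.Periodic (G.sol t) (2 * π) := periodic_ser _

lemma memHs_sol (t : ℝ) : MemHs s (G.sol t) := by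
  refine ⟨(G.contDiff_sol t).continuous, G.periodic_sol t, ?_⟩
  have := hasSum_weight_fc (G.contDiff_sol t).continuous (ω := fun k : ℤ => (1 + (k:ℝ) ^ 2) ^ s)
    (fun k => by push_cast; ring) (by simp only [hc_sol]; exact (G.summable_cl t).hasSum)
  exact this.summable

lemma smoothPer_approx (i : ℕ) (t : ℝ) : SmoothPer (G.approx i t) := smoothPer_emb _ _

lemma dx_approx_sub_le (i : ℕ) {j : ℕ} (hj : j ≤ 3) (t x : ℝ) :
    |dx j (G.approx i t) x - dx j (G.sol t) x| ≤ √(sobC * G.ε i) :=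
  ((G.near_clamp i t).mono (m := 3 + 1) (by have := G.le_s; omega)).dx_sub_le
    (ext0_of_notMem _) hj x

lemma tendsto_error : Tendsto (fun i => √(sobC * G.ε i)) atTop (𝓝 0) := by
  simpa using (G.tendsto.const_mul sobC).sqrt

lemma continuous_c (i : ℕ) : Continuous fun t => G.c i (clamp T t) := by
  have h : ContinuousOn (G.c i) (Icc 0 T) := fun t ht =>
    (G.gal i t ht).continuousAt.continuousWithinAt
  exact h.comp_continuous (continuous_clamp T) (clamp_mem G.T_nonneg)

lemma continuous_dx_approx (i j : ℕ) :
    Continuous fun p : ℝ × ℝ => dx j (G.approx i p.1) p.2 := by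
  simp only [approx, dx_emb]
  refine continuous_finsetSum _ fun k _ => ?_
  refine ((continuous_apply k).comp ((G.continuous_c i).comp continuous_fst)).mul ?_
  exact (((smoothPer_cas k).dx j).continuous).comp continuous_snd

lemma continuous_dx_sol {j : ℕ} (hj : j ≤ 3) :
    Continuous fun p : ℝ × ℝ => dx j (G.sol p.1) p.2 := by
  have h1 : ∃ᶠ i : ℕ in atTop, Continuous fun p : ℝ × ℝ => dx j (G.approx i p.1) p.2 :=
    Frequently.of_forall fun i => G.continuous_dx_approx i j
  have h2 : TendstoUniformly (fun (i : ℕ) (p : ℝ × ℝ) => dx j (G.approx i p.1) p.2)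
      (fun p : ℝ × ℝ => dx j (G.sol p.1) p.2) atTop := by
    rw [Metric.tendstoUniformly_iff]
    intro e he
    filter_upwards [G.tendsto_error.eventually_lt_const he] with i hi p
    rw [dist_comm, dist_eq]
    exact (G.dx_approx_sub_le i hj p.1 p.2).trans_lt hi
  exact h2.continuous h1

lemma abs_dx_approx_le (i : ℕ) {j : ℕ} (hj : j ≤ 3) (t x : ℝ) :
    |dx j (G.approx i t) x| ≤ √(2 * G.R) :=
  abs_dx_le_of_sob (G.smoothPer_approx i t) (show j + 1 ≤ 12 by omega)
    (G.bound i _ (clamp_mem G.T_nonneg t)) x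

lemma abs_dx_sol_le {j : ℕ} (hj : j ≤ 3) (t x : ℝ) : |dx j (G.sol t) x| ≤ √(2 * G.R) := by
  have lim : Tendsto (fun i => √(2 * G.R) + √(sobC * G.ε i)) atTop (𝓝 (√(2 * G.R) + 0)) :=
    G.tendsto_error.const_add _
  rw [add_zero] at lim
  refine ge_of_tendsto' lim fun i => ?_
  have h1 := G.abs_dx_approx_le i hj t x
  have h2 := G.dx_approx_sub_le i hj t x
  have h3 := abs_sub_abs_le_abs_sub (dx j (G.sol t) x) (dx j (G.approx i t) x)
  rw [abs_sub_comm] at h3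
  linarith

lemma continuous_hsNorm (t₀ : ℝ) {e : ℝ} (he : 0 < e) : ∃ δ > 0, ∀ t, |t - t₀| < δ →
    hsNorm s (fun x => G.sol t x - G.sol t₀ x) < e := by
  obtain ⟨i, hi⟩ := (G.tendsto.eventually_lt_const (show 0 < e ^ 2 / 12 by positivity)).exists
  have cs : Continuous fun t => ∑ k ∈ freq (G.M i), (1 + (k:ℝ) ^ 2) ^ s *
      (ext0 (G.c i (clamp T t)) k - ext0 (G.c i (clamp T t₀)) k) ^ 2 := by
    refine continuous_finsetSum _ fun k hk => continuous_const.mul ((Continuous.sub ?_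
      continuous_const).pow 2)
    simp only [ext0, hk, dif_pos]
    exact (continuous_apply _).comp (G.continuous_c i)
  have c0 := (cs.tendsto t₀).eventually_lt_const
    (u := e ^ 2 / 12) (by simp only [sub_self]; simp; positivity)
  obtain ⟨δ, hδ, h⟩ := Metric.eventually_nhds_iff.1 c0
  refine ⟨δ, hδ, fun t ht => ?_⟩
  have h1 := h (show dist t t₀ < δ by rwa [dist_eq])
  have hF : ∀ F : Finset ℤ, ∑ k ∈ F, (1 + (k:ℝ) ^ 2) ^ s *
      (G.cl (clamp T t) k - G.cl (clamp T t₀) k) ^ 2 ≤ 3 * (e ^ 2 / 12 + e ^ 2 / 12 + e ^ 2 / 12) :=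
    fun F => by
      have n1 := G.near_clamp i t F
      have n2 := G.near_clamp i t₀ F
      have n3 : ∑ k ∈ F, (1 + (k:ℝ) ^ 2) ^ s *
          (ext0 (G.c i (clamp T t)) k - ext0 (G.c i (clamp T t₀)) k) ^ 2 ≤ e ^ 2 / 12 := by
        refine le_trans ?_ h1.le
        have hS : HasSum (fun k : ℤ => (1 + (k:ℝ) ^ 2) ^ s *
            (ext0 (G.c i (clamp T t)) k - ext0 (G.c i (clamp T t₀)) k) ^ 2) _ :=
          hasSum_sum_of_ne_finset_zero (s := freq (G.M i)) fun k hk => by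
            simp [ext0_of_notMem _ k hk]
        exact sum_le_hasSum F (fun k _ => by positivity) hS
      have n4 : ∑ k ∈ F, (1 + (k:ℝ) ^ 2) ^ s *
          (G.cl (clamp T t) k - G.cl (clamp T t₀) k) ^ 2 ≤
          3 * (∑ k ∈ F, (1 + (k:ℝ) ^ 2) ^ s * (ext0 (G.c i (clamp T t)) k - G.cl (clamp T t) k) ^ 2 +
            ∑ k ∈ F, (1 + (k:ℝ) ^ 2) ^ s * (ext0 (G.c i (clamp T t₀)) k - G.cl (clamp T t₀) k) ^ 2 +
            ∑ k ∈ F, (1 + (k:ℝ) ^ 2) ^ s *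
              (ext0 (G.c i (clamp T t)) k - ext0 (G.c i (clamp T t₀)) k) ^ 2) := by
        rw [← Finset.sum_add_distrib, ← Finset.sum_add_distrib, Finset.mul_sum]
        refine Finset.sum_le_sum fun k _ => ?_
        rw [← mul_add, ← mul_add, mul_left_comm]
        refine mul_le_mul_of_nonneg_left ?_ (by positivity)
        generalize ext0 (G.c i (clamp T t)) k = x, ext0 (G.c i (clamp T t₀)) k = y,
          G.cl (clamp T t) k = z, G.cl (clamp T t₀) k = w
        nlinarith [sq_nonneg ((x - z) + (y - w)), sq_nonneg ((x - z) + (x - y)),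
          sq_nonneg ((y - w) - (x - y))]
      linarith
  have hs' : Summable fun k : ℤ => (1 + (k:ℝ) ^ 2) ^ s *
      (G.cl (clamp T t) k - G.cl (clamp T t₀) k) ^ 2 :=
    summable_of_sum_le (fun k => by positivity) hF
  have hle := hs'.tsum_le_of_sum_le hF
  have hS : HasSum (fun k : ℤ => (1 + (k:ℝ) ^ 2) ^ s *
      hc (fun x => G.sol t x - G.sol t₀ x) k ^ 2)
      (∑' k : ℤ, (1 + (k:ℝ) ^ 2) ^ s * (G.cl (clamp T t) k - G.cl (clamp T t₀) k) ^ 2) := by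
    convert hs'.hasSum using 4 with k
    rw [hc_sub (G.contDiff_sol t).continuous (G.contDiff_sol t₀).continuous, hc_sol, hc_sol]
  rw [hsNorm_sq_of_hc (f := fun x => G.sol t x - G.sol t₀ x)
    ((G.contDiff_sol t).continuous.sub (G.contDiff_sol t₀).continuous) hS]
  rw [sqrt_lt' he]
  nlinarith

end GalLimit

end LimitSolution

section TestFunctions

open Real MeasureTheory Set Filter Topology

/-- Smooth functions of time and space that are periodic in space. -/
structure TestFn (ψ : ℝ → ℝ → ℝ) : Prop where
  smooth : ContDiff ℝ (⊤ : ℕ∞) (Function.uncurry ψ)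
  periodic : ∀ t, Function.Periodic (ψ t) (2 * π)

/-- The derivative in time. -/
noncomputable def dt (ψ : ℝ → ℝ → ℝ) (t x : ℝ) : ℝ := deriv (fun τ => ψ τ x) t

namespace TestFn

variable {ψ : ℝ → ℝ → ℝ} (hψ : TestFn ψ)

include hψ

lemma continuous : Continuous (Function.uncurry ψ) := hψ.smooth.continuous

lemma smoothPer (t : ℝ) : SmoothPer (ψ t) :=
  ⟨hψ.smooth.comp (contDiff_const.prodMk contDiff_id), hψ.periodic t⟩

lemma hasDerivAt_time (t x : ℝ) :
    HasDerivAt (fun τ => ψ τ x) (fderiv ℝ (Function.uncurry ψ) (t, x) (1, 0)) t := by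
  have h1 := (hψ.smooth.differentiable (by simp) (t, x)).hasFDerivAt
  have h2 : HasDerivAt (fun τ : ℝ => (τ, x)) ((1:ℝ), (0:ℝ)) t :=
    (hasDerivAt_id t).prodMk (hasDerivAt_const t x)
  exact h1.comp_hasDerivAt t h2

lemma hasDerivAt_space (t x : ℝ) :
    HasDerivAt (ψ t) (fderiv ℝ (Function.uncurry ψ) (t, x) (0, 1)) x := by
  have h1 := (hψ.smooth.differentiable (by simp) (t, x)).hasFDerivAt
  have h2 : HasDerivAt (fun y : ℝ => (t, y)) ((0:ℝ), (1:ℝ)) x :=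
    (hasDerivAt_const x t).prodMk (hasDerivAt_id x)
  exact h1.comp_hasDerivAt x h2

lemma contDiff_fderiv_apply (v : ℝ × ℝ) :
    ContDiff ℝ (⊤ : ℕ∞) fun p => fderiv ℝ (Function.uncurry ψ) p v :=
  (hψ.smooth.fderiv_right (by simp)).clm_apply contDiff_const

lemma dt : TestFn (dt ψ) := by
  refine ⟨?_, fun t x => ?_⟩
  · convert hψ.contDiff_fderiv_apply (1, 0) with p
    exact (hψ.hasDerivAt_time p.1 p.2).deriv
  · simp only [FifthOrderStmt0.dt, (hψ.periodic _) x]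

lemma hasDerivAt (t x : ℝ) : HasDerivAt (fun τ => ψ τ x) (FifthOrderStmt0.dt ψ t x) t :=
  (hψ.hasDerivAt_time t x).differentiableAt.hasDerivAt

lemma deriv_space : TestFn fun t => deriv (ψ t) := by
  refine ⟨?_, fun t => ((hψ.smoothPer t).deriv).2⟩
  convert hψ.contDiff_fderiv_apply (0, 1) with p
  exact (hψ.hasDerivAt_space p.1 p.2).deriv

lemma dx (j : ℕ) : TestFn fun t => dx j (ψ t) := by
  induction j with
  | zero => simpa only [dx_zero] using hψ
  | succ j ih => simpa only [dx_succ] using ih.deriv_space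

lemma exists_bound (a b : ℝ) : ∃ B, 0 ≤ B ∧ ∀ t ∈ Icc a b, ∀ x, |ψ t x| ≤ B := by
  obtain ⟨B, hB⟩ := (isCompact_Icc.prod isCompact_Icc).exists_bound_of_continuousOn
    (s := Icc a b ×ˢ Icc 0 (2 * π)) hψ.continuous.continuousOn
  refine ⟨|B|, abs_nonneg _, fun t ht x => ?_⟩
  obtain ⟨y, hy, hxy⟩ := (hψ.periodic t).exists_mem_Ico₀ (by positivity) x
  rw [hxy]
  exact (hB (t, y) ⟨ht, Ico_subset_Icc_self hy⟩).trans (le_abs_self B)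

lemma continuous_apply (t : ℝ) : Continuous (ψ t) := (hψ.smoothPer t).continuous

lemma hasDerivAt_per {g : ℝ → ℝ} (hg : Continuous g) (t : ℝ) :
    HasDerivAt (fun τ => per fun x => g x * ψ τ x)
      (per fun x => g x * FifthOrderStmt0.dt ψ t x) t := by
  obtain ⟨B, -, hB⟩ := hψ.dt.exists_bound (t - 1) (t + 1)
  have hc1 := hψ.continuous_apply
  have hc2 := hψ.dt.continuous_apply
  refine (intervalIntegral.hasDerivAt_integral_of_dominated_loc_of_deriv_le
    (F := fun τ x => g x * ψ τ x) (F' := fun τ x => g x * FifthOrderStmt0.dt ψ τ x)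
    (bound := fun x => |g x| * B) (Icc_mem_nhds (show t - 1 < t by linarith)
      (show t < t + 1 by linarith)) ?_ ?_ ?_ ?_ ?_ ?_).2
  · exact Eventually.of_forall fun τ => (hg.mul (hc1 τ)).aestronglyMeasurable
  · exact (hg.mul (hc1 t)).intervalIntegrable _ _
  · exact (hg.mul (hc2 t)).aestronglyMeasurable
  · refine Eventually.of_forall fun x _ τ hτ => ?_
    rw [norm_eq_abs, abs_mul]
    exact mul_le_mul_of_nonneg_left (hB τ hτ x) (abs_nonneg _)
  · exact (hg.abs.mul_const B).intervalIntegrable _ _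
  · exact Eventually.of_forall fun x _ τ _ => (hψ.hasDerivAt τ x).const_mul _

end TestFn

lemma per_dx_mul {f g : ℝ → ℝ} (hf : SmoothPer f) (hg : SmoothPer g) (j : ℕ) :
    per (fun x => dx j f x * g x) = (-1) ^ j * per (fun x => f x * dx j g x) := by
  induction j generalizing g with
  | zero => simp [dx_zero]
  | succ j ih =>
    have h := per_parts (hf.dx j) hg
    rw [dx_dx, add_comm 1 j, ih (hg.dx 1), dx_dx] at h
    rw [h]
    ring

end TestFunctions

section WeakForm

open Real MeasureTheory Set Filter Topology
open MvPolynomial (pderiv)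

lemma ev_lipschitz {m : ℕ} {p : MvPolynomial ℕ ℝ} (hp : p ∈ ordLE m) (R : ℝ) :
    ∃ L, 0 ≤ L ∧ ∀ (f g : ℝ → ℝ) (x δ : ℝ), (∀ i ≤ m, |dx i f x| ≤ R) → (∀ i ≤ m, |dx i g x| ≤ R) →
      (∀ i ≤ m, |dx i f x - dx i g x| ≤ δ) → |ev p f x - ev p g x| ≤ L * δ := by
  obtain ⟨C, hC, h⟩ := eval_taylor hp R
  choose B hB hb using fun i => eval_bound (pderiv_mem i hp) R
  refine ⟨∑ i ∈ Finset.range (m + 1), B i + C * ((m + 1) * (2 * |R|)) * (m + 1),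
    add_nonneg (Finset.sum_nonneg fun i _ => hB i) (by positivity), fun f g x δ hf hg hd => ?_⟩
  have hδ : 0 ≤ δ := (abs_nonneg _).trans (hd 0 (Nat.zero_le _))
  have h1 := h (fun i => dx i g x) (fun i => dx i f x) hg hf
  have h2 : |lin m p (fun i => dx i g x) (fun i => dx i f x - dx i g x)| ≤
      (∑ i ∈ Finset.range (m + 1), B i) * δ := by
    rw [lin, Finset.sum_mul]
    refine (Finset.abs_sum_le_sum_abs _ _).trans (Finset.sum_le_sum fun i hi => ?_)
    rw [abs_mul]
    exact mul_le_mul (hb i _ hg) (hd i (by have := Finset.mem_range.1 hi; omega))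
      (abs_nonneg _) (hB i)
  have h3 : ∑ i ∈ Finset.range (m + 1), |dx i f x - dx i g x| ≤ (m + 1) * δ := by
    refine (Finset.sum_le_card_nsmul _ _ δ fun i hi =>
      hd i (by have := Finset.mem_range.1 hi; omega)).trans_eq ?_
    simp
  have h4 : ∑ i ∈ Finset.range (m + 1), |dx i f x - dx i g x| ≤ (m + 1) * (2 * |R|) := by
    refine (Finset.sum_le_card_nsmul _ _ (2 * |R|) fun i hi => ?_).trans_eq (by simp)
    have a1 := hf i (by have := Finset.mem_range.1 hi; omega)
    have a2 := hg i (by have := Finset.mem_range.1 hi; omega)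
    have a3 := abs_sub (dx i f x) (dx i g x)
    linarith [le_abs_self R]
  have h5 : (∑ i ∈ Finset.range (m + 1), |dx i f x - dx i g x|) ^ 2 ≤
      ((m + 1) * (2 * |R|)) * ((m + 1) * δ) := by
    rw [sq]
    exact mul_le_mul h4 h3 (Finset.sum_nonneg fun _ _ => abs_nonneg _) (by positivity)
  have h6 := mul_le_mul_of_nonneg_left h5 hC
  have h7 := abs_sub_abs_le_abs_sub (ev p f x - ev p g x)
    (lin m p (fun i => dx i g x) (fun i => dx i f x - dx i g x))
  simp only [ev] at *
  linarith

lemma per_emb_mul {M : ℕ} (c : freq M → ℝ) {g : ℝ → ℝ} (hg : Continuous g) :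
    per (fun x => emb M c x * g x) = ∑ k : freq M, c k * per (fun x => cas k x * g x) := by
  have h : (fun x => emb M c x * g x) = fun x => ∑ k : freq M, c k * (cas k x * g x) := by
    funext x
    have := dx_emb M 0 c x
    simp only [dx_zero] at this
    rw [this, Finset.sum_mul]
    exact Finset.sum_congr rfl fun k _ => by ring
  have hk : ∀ k ∈ (Finset.univ : Finset (freq M)), Continuous fun x => c k * (cas k x * g x) :=
    fun k _ => continuous_const.mul ((smoothPer_cas k).continuous.mul hg)
  rw [h, per_sum hk]
  simp only [per_const_mul]

lemma hasDerivAt_per_emb {M : ℕ} {c : ℝ → freq M → ℝ} {v : ℝ → ℝ} (hv : proj M v = v) {t : ℝ}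
    (h : HasDerivAt c (fun k => hc v k) t) {ψ : ℝ → ℝ → ℝ} (hψ : TestFn ψ) :
    HasDerivAt (fun τ => per fun x => emb M (c τ) x * ψ τ x)
      (per (fun x => v x * ψ t x) + per (fun x => emb M (c t) x * dt ψ t x)) t := by
  have e : v = emb M fun k => hc v k := by rw [emb_restrict]; exact hv.symm
  have e1 : per (fun x => v x * ψ t x) =
      ∑ k : freq M, hc v k * per (fun x => cas k x * ψ t x) := by
    conv_lhs => rw [e]
    exact per_emb_mul _ (hψ.continuous_apply t)
  rw [e1, per_emb_mul _ (hψ.dt.continuous_apply t), ← Finset.sum_add_distrib]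
  simp only [fun τ => per_emb_mul (c τ) (hψ.continuous_apply τ)]
  exact HasDerivAt.fun_sum fun k _ => ((hasDerivAt_pi.1 h k).fun_mul
    (hψ.hasDerivAt_per (smoothPer_cas k).continuous t))

/-- The adjoint of the linear part applied to a test function. -/
noncomputable def adj (P : Eqn) (ψ : ℝ → ℝ → ℝ) (t x : ℝ) : ℝ :=
  dt ψ t x + P.γ0 * dx 5 (ψ t) x + P.γ1 * dx 3 (ψ t) x + P.γ2 * dx 1 (ψ t) x

lemma TestFn.adj (P : Eqn) {ψ : ℝ → ℝ → ℝ} (hψ : TestFn ψ) : TestFn (adj P ψ) := by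
  refine ⟨?_, fun t x => ?_⟩
  · exact (((hψ.dt.smooth.add (contDiff_const.mul (hψ.dx 5).smooth)).add
      (contDiff_const.mul (hψ.dx 3).smooth)).add (contDiff_const.mul (hψ.dx 1).smooth))
  · simp only [FifthOrderStmt0.adj, hψ.dt.periodic t x, (hψ.dx 5).periodic t x,
      (hψ.dx 3).periodic t x, (hψ.dx 1).periodic t x]

/-- The integrand of the weak formulation. -/
noncomputable def weak (P : Eqn) (f : ℝ → ℝ) (ψ : ℝ → ℝ → ℝ) (t x : ℝ) : ℝ :=
  f x * adj P ψ t x + ev P.N f x * ψ t x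

lemma per_vf_mul (P : Eqn) (M : ℕ) {f : ℝ → ℝ} (hf : SmoothPer f) {ψ : ℝ → ℝ → ℝ}
    (hψ : TestFn ψ) (t : ℝ) :
    per (fun x => vf P M f x * ψ t x) + per (fun x => f x * dt ψ t x) =
      per (weak P f ψ t) + per (fun x => vfErr P M f x * ψ t x) := by
  have hs := hψ.smoothPer t
  have c0 := hf.continuous
  have d5 := (hf.dx 5).continuous
  have d3 := (hf.dx 3).continuous
  have d1 := (hf.dx 1).continuous
  have cs := hs.continuous
  have s5 := (hs.dx 5).continuous
  have s3 := (hs.dx 3).continuous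
  have s1 := (hs.dx 1).continuous
  have ct := hψ.dt.continuous_apply t
  have ce := (smoothPer_ev P.N hf).continuous
  have cv := (sd_vfErr P M hf).1.continuous
  have e1 : (fun x => vf P M f x * ψ t x) = fun x =>
      -P.γ0 * (dx 5 f x * ψ t x) + -P.γ1 * (dx 3 f x * ψ t x) + -P.γ2 * (dx 1 f x * ψ t x) +
        ev P.N f x * ψ t x + vfErr P M f x * ψ t x := by
    funext x; rw [vf, vfErr]; ring
  have e2 : weak P f ψ t = fun x => f x * dt ψ t x + P.γ0 * (f x * dx 5 (ψ t) x) +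
      P.γ1 * (f x * dx 3 (ψ t) x) + P.γ2 * (f x * dx 1 (ψ t) x) + ev P.N f x * ψ t x := by
    funext x; rw [weak, adj]; ring
  rw [e1, e2]
  repeat rw [per_add (by fun_prop) (by fun_prop)]
  simp only [per_const_mul, per_dx_mul hf hs]
  ring

lemma abs_per_le {f : ℝ → ℝ} {C : ℝ} (h : ∀ x, |f x| ≤ C) : |per f| ≤ 2 * π * C := by
  have := intervalIntegral.norm_integral_le_of_norm_le_const (a := 0) (b := 2 * π) (C := C) (f := f)
    fun x _ => h x
  rw [sub_zero, abs_of_pos (by positivity), norm_eq_abs] at this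
  rw [per]
  linarith

lemma abs_per_vfErr_mul_le (P : Eqn) (R : ℝ) : ∃ K, 0 ≤ K ∧ ∀ M f, SmoothPer f → sob 9 f ≤ R →
    ∀ (g : ℝ → ℝ) (B : ℝ), Continuous g → (∀ x, |g x| ≤ B) →
      |per fun x => vfErr P M f x * g x| ≤ (K + 4 * B ^ 2) * ((M:ℝ) + 1)⁻¹ := by
  obtain ⟨K, hK, h⟩ := vfErr_bound P R
  refine ⟨K, hK, fun M f hf hR g B hg hB => ?_⟩
  have hM : (0:ℝ) < (M:ℝ) + 1 := by positivity
  have h1 := h M f hf hR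
  have h0 := per_sq_nonneg (dx 1 (vfErr P M f))
  have h2 := per_sq_le_of_abs_le hg hB
  have cv := (sd_vfErr P M hf).1.continuous
  have key : ∀ g : ℝ → ℝ, Continuous g → per (fun x => g x ^ 2) ≤ 2 * π * B ^ 2 →
      per (fun x => vfErr P M f x * g x) ≤ (K + 4 * B ^ 2) * ((M:ℝ) + 1)⁻¹ := fun g hg hgB => by
    have h3 := per_mul_le cv hg hM
    have h4 : ((M:ℝ) + 1) * per (fun x => vfErr P M f x ^ 2) ≤ K * ((M:ℝ) + 1)⁻¹ := by
      calc ((M:ℝ) + 1) * per (fun x => vfErr P M f x ^ 2)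
          ≤ ((M:ℝ) + 1) * (K * (((M:ℝ) + 1)⁻¹) ^ 2) :=
            mul_le_mul_of_nonneg_left (by linarith) hM.le
        _ = _ := by field_simp
    have h5 : ((M:ℝ) + 1)⁻¹ * per (fun x => g x ^ 2) ≤ ((M:ℝ) + 1)⁻¹ * (8 * B ^ 2) :=
      mul_le_mul_of_nonneg_left (hgB.trans (by nlinarith [pi_le_four, sq_nonneg B]))
        (by positivity)
    have h6 : 0 ≤ K * ((M:ℝ) + 1)⁻¹ := by positivity
    linarith
  refine abs_le.2 ⟨?_, key g hg h2⟩
  have h7 := key (fun x => -g x) hg.neg (by simpa using h2)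
  have e : (fun x => vfErr P M f x * -g x) = fun x => -1 * (vfErr P M f x * g x) := by
    funext x; ring
  rw [e, per_const_mul] at h7
  linarith

end WeakForm

section WeakIdentity

open Real MeasureTheory Set Filter Topology

namespace GalLimit

variable {P : Eqn} {T : ℝ} {s : ℕ} (G : GalLimit P T s)

lemma continuous_ev_sol {m : ℕ} (hm : m ≤ 3) {p : MvPolynomial ℕ ℝ} (hp : p ∈ ordLE m) :
    Continuous fun q : ℝ × ℝ => ev p (G.sol q.1) q.2 := by
  refine mem_ordLE_induction (P := fun p => Continuous fun q : ℝ × ℝ => ev p (G.sol q.1) q.2)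
    (fun r => ?_) (fun i hi => ?_) (fun p q h1 h2 => ?_) (fun p q h1 h2 => ?_) hp
  · simpa only [ev, MvPolynomial.eval_C] using continuous_const
  · simpa only [ev_X] using G.continuous_dx_sol (hi.trans hm)
  · simp only [ev_add]
    exact h1.add h2
  · simp only [ev_mul]
    exact h1.mul h2

lemma continuous_weak {ψ : ℝ → ℝ → ℝ} (hψ : TestFn ψ) :
    Continuous fun q : ℝ × ℝ => weak P (G.sol q.1) ψ q.1 q.2 := by
  have h0 := G.continuous_dx_sol (j := 0) (Nat.zero_le _)
  simp only [dx_zero] at h0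
  have h1 := (hψ.adj P).continuous
  have h2 := hψ.continuous
  exact (h0.mul h1).add ((G.continuous_ev_sol le_rfl P.nonpar.1).mul h2)

lemma continuous_per_weak {ψ : ℝ → ℝ → ℝ} (hψ : TestFn ψ) :
    Continuous fun t => per (weak P (G.sol t) ψ t) :=
  intervalIntegral.continuous_parametric_intervalIntegral_of_continuous'
    (f := fun t x => weak P (G.sol t) ψ t x) (G.continuous_weak hψ) 0 (2 * π)

lemma exists_weak_error {ψ : ℝ → ℝ → ℝ} (hψ : TestFn ψ) :
    ∃ e : ℕ → ℝ, Tendsto e atTop (𝓝 0) ∧ ∀ i, ∀ t ∈ Icc 0 T,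
      |per (weak P (G.approx i t) ψ t) + per (fun x => vfErr P (G.M i) (G.approx i t) x * ψ t x) -
        per (weak P (G.sol t) ψ t)| ≤ e i := by
  obtain ⟨B, hB, hb⟩ := hψ.exists_bound 0 T
  obtain ⟨A, hA, ha⟩ := (hψ.adj P).exists_bound 0 T
  obtain ⟨K, hK, hk⟩ := abs_per_vfErr_mul_le P G.R
  obtain ⟨L, hL, hl⟩ := ev_lipschitz P.nonpar.1 √(2 * G.R)
  refine ⟨fun i => 2 * π * ((A + L * B) * √(sobC * G.ε i)) + (K + 4 * B ^ 2) * ((i:ℝ) + 1)⁻¹,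
    ?_, fun i t ht => ?_⟩
  · have h1 := (G.tendsto_error.const_mul (A + L * B)).const_mul (2 * π)
    have h2 := (tendsto_one_div_add_atTop_nhds_zero_nat (𝕜 := ℝ)).const_mul (K + 4 * B ^ 2)
    simpa only [mul_zero, add_zero, one_div] using h1.add h2
  · have s1 := G.smoothPer_approx i t
    have c1 : Continuous (weak P (G.approx i t) ψ t) :=
      (s1.continuous.mul ((hψ.adj P).continuous_apply t)).add
        ((smoothPer_ev P.N s1).continuous.mul (hψ.continuous_apply t))
    have c2 : Continuous (weak P (G.sol t) ψ t) :=
      (G.continuous_weak hψ).comp (continuous_const.prodMk continuous_id)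
    have b9 : sob 9 (G.approx i t) ≤ G.R :=
      (sob_mono (by norm_num) _).trans (G.bound i _ (clamp_mem G.T_nonneg t))
    have h1 := hk (G.M i) _ s1 b9 (ψ t) B (hψ.continuous_apply t) (hb t ht)
    have h2 : ((G.M i : ℝ) + 1)⁻¹ ≤ ((i:ℝ) + 1)⁻¹ := by
      have : (i:ℝ) ≤ G.M i := by exact_mod_cast G.le_M i
      gcongr
    have h3 := mul_le_mul_of_nonneg_left h2 (show 0 ≤ K + 4 * B ^ 2 by positivity)
    have h4 : |per fun x => weak P (G.approx i t) ψ t x - weak P (G.sol t) ψ t x| ≤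
        2 * π * ((A + L * B) * √(sobC * G.ε i)) := by
      refine abs_per_le fun x => ?_
      have d0 := G.dx_approx_sub_le i (j := 0) (Nat.zero_le _) t x
      simp only [dx_zero] at d0
      have d1 := hl (G.approx i t) (G.sol t) x _ (fun j hj => G.abs_dx_approx_le i hj t x)
        (fun j hj => G.abs_dx_sol_le hj t x) (fun j hj => G.dx_approx_sub_le i hj t x)
      have e : weak P (G.approx i t) ψ t x - weak P (G.sol t) ψ t x =
          (G.approx i t x - G.sol t x) * adj P ψ t x +
          (ev P.N (G.approx i t) x - ev P.N (G.sol t) x) * ψ t x := by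
        rw [weak, weak]; ring
      rw [e]
      refine (abs_add_le _ _).trans ?_
      rw [abs_mul, abs_mul]
      have m1 := mul_le_mul d0 (ha t ht x) (abs_nonneg _) (sqrt_nonneg _)
      have m2 := mul_le_mul d1 (hb t ht x) (abs_nonneg _) (mul_nonneg hL (sqrt_nonneg _))
      linarith
    rw [per_sub c1 c2] at h4
    rw [add_sub_right_comm]
    exact (abs_add_le _ _).trans (add_le_add h4 (h1.trans h3))

lemma tendsto_per_approx_mul {ψ : ℝ → ℝ → ℝ} (hψ : TestFn ψ) {t : ℝ} (ht : t ∈ Icc 0 T) :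
    Tendsto (fun i => per fun x => G.approx i t x * ψ t x) atTop
      (𝓝 (per fun x => G.sol t x * ψ t x)) := by
  obtain ⟨B, hB, hb⟩ := hψ.exists_bound 0 T
  have lim := (G.tendsto_error.mul_const B).const_mul (2 * π)
  simp only [zero_mul, mul_zero] at lim
  refine tendsto_iff_dist_tendsto_zero.2 (squeeze_zero (fun _ => dist_nonneg) (fun i => ?_) lim)
  have cψ := hψ.continuous_apply t
  have c1 := (G.smoothPer_approx i t).continuous
  have c2 := (G.contDiff_sol t).continuous
  rw [dist_eq, ← per_sub (f := fun x => G.approx i t x * ψ t x) (g := fun x => G.sol t x * ψ t x)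
    (c1.mul cψ) (c2.mul cψ)]
  refine abs_per_le fun x => ?_
  have d0 := G.dx_approx_sub_le i (j := 0) (Nat.zero_le _) t x
  simp only [dx_zero] at d0
  rw [← sub_mul, abs_mul]
  exact mul_le_mul d0 (hb t ht x) (abs_nonneg _) (sqrt_nonneg _)

lemma approx_weak_identity {ψ : ℝ → ℝ → ℝ} (hψ : TestFn ψ) {i : ℕ} {t : ℝ} (ht : t ∈ Icc 0 T) :
    HasDerivAt (fun τ => per fun x => emb (G.M i) (G.c i τ) x * ψ τ x)
      (per (weak P (G.approx i t) ψ t) +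
        per (fun x => vfErr P (G.M i) (G.approx i t) x * ψ t x)) t := by
  have h := hasDerivAt_per_emb (proj_vf P (G.M i) (proj_emb (G.M i) (G.c i t))) (G.gal i t ht) hψ
  rw [per_vf_mul P _ (smoothPer_emb _ _) hψ t] at h
  simpa only [approx, clamp_of_mem ht] using h

theorem weak_identity {ψ : ℝ → ℝ → ℝ} (hψ : TestFn ψ) :
    ∫ t in (0:ℝ)..T, per (weak P (G.sol t) ψ t) =
      per (fun x => G.sol T x * ψ T x) - per (fun x => G.sol 0 x * ψ 0 x) := by
  obtain ⟨e, he, hb⟩ := G.exists_weak_error hψ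
  have m0 : (0:ℝ) ∈ Icc 0 T := ⟨le_rfl, G.T_nonneg⟩
  have mT : T ∈ Icc 0 T := ⟨G.T_nonneg, le_rfl⟩
  set W : ℝ → ℝ := fun t => per (weak P (G.sol t) ψ t) with hW
  have cW : Continuous W := G.continuous_per_weak hψ
  have key : ∀ i, |(per (fun x => G.approx i T x * ψ T x) - ∫ t in (0:ℝ)..T, W t) -
      per (fun x => G.approx i 0 x * ψ 0 x)| ≤ e i * T := fun i => by
    have hd : ∀ t ∈ Icc 0 T, HasDerivWithinAt
        (fun τ => per (fun x => emb (G.M i) (G.c i τ) x * ψ τ x) - ∫ y in (0:ℝ)..τ, W y)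
        (per (weak P (G.approx i t) ψ t) +
          per (fun x => vfErr P (G.M i) (G.approx i t) x * ψ t x) - W t) (Icc 0 T) t :=
      fun t ht => ((G.approx_weak_identity hψ ht).fun_sub
        (intervalIntegral.integral_hasDerivAt_right (cW.intervalIntegrable _ _)
          (cW.stronglyMeasurableAtFilter _ _) cW.continuousAt)).hasDerivWithinAt
    have h := (convex_Icc 0 T).norm_image_sub_le_of_norm_hasDerivWithin_le hd
      (fun t ht => hb i t ht) m0 mT
    simp only [intervalIntegral.integral_same, sub_zero, norm_eq_abs, abs_of_nonneg G.T_nonneg] at h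
    simpa only [approx, clamp_of_mem m0, clamp_of_mem mT] using h
  have l1 := ((G.tendsto_per_approx_mul hψ mT).sub_const (∫ t in (0:ℝ)..T, W t)).sub
    (G.tendsto_per_approx_mul hψ m0)
  have l2 := le_of_tendsto_of_tendsto' l1.abs (he.mul_const T) key
  rw [zero_mul, abs_nonpos_iff] at l2
  linarith

/-- Restriction to a shorter time interval. -/
def restrict {T' : ℝ} (h0 : 0 ≤ T') (h : T' ≤ T) : GalLimit P T' s where
  M := G.M
  c := G.c
  cl := G.cl
  ε := G.ε
  R := G.R
  T_nonneg := h0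
  T_le := h.trans G.T_le
  le_s := G.le_s
  le_M := G.le_M
  gal i t ht := G.gal i t ⟨ht.1, ht.2.trans h⟩
  tendsto := G.tendsto
  near i t ht := G.near i t ⟨ht.1, ht.2.trans h⟩
  bound i t ht := G.bound i t ⟨ht.1, ht.2.trans h⟩

end GalLimit

theorem exists_galLimit (P : Eqn) (r : ℝ) : ∃ T, 0 < T ∧ T ≤ 1 ∧ ∀ s, 13 ≤ s → ∀ φ, MemHs s φ →
    hsNorm 12 φ ≤ r → ∀ T', 0 ≤ T' → T' ≤ T → ∃ G : GalLimit P T' s, G.sol 0 = φ := by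
  obtain ⟨T, hT, hT1, h⟩ := galerkin_limit P (r ^ 2)
  refine ⟨T, hT, hT1, fun s hs φ hφ hr T' h0 hT' => ?_⟩
  have sm : Summable fun k : ℤ => (1 + (k:ℝ) ^ 2) ^ s * hc φ k ^ 2 :=
    summable_weight_hc hφ.1 (fun k => by positivity) hφ.2.2
  have s12 : Summable fun k : ℤ => (1 + (k:ℝ) ^ 2) ^ 12 * hc φ k ^ 2 :=
    summable_weight_mono (by omega) sm
  have hn := hsNorm_sq_of_hc hφ.1 s12.hasSum
  have hle : ∑' k : ℤ, (1 + (k:ℝ) ^ 2) ^ 12 * hc φ k ^ 2 ≤ r ^ 2 := by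
    rw [hn] at hr
    exact (sqrt_le_iff.1 hr).2
  obtain ⟨M, c, cl, ε, R, h1, h2, h3, h4, h5, h6⟩ := h s hs (hc φ) sm hle
  let G : GalLimit P T s := ⟨M, c, cl, ε, R, hT.le, hT1, hs, h1, h2, h3, h4, h5⟩
  refine ⟨G.restrict h0 hT', eq_of_hc_eq ((G.restrict h0 hT').contDiff_sol 0).continuous hφ.1
    ((G.restrict h0 hT').periodic_sol 0) hφ.2.1 fun k => ?_⟩
  rw [GalLimit.hc_sol, clamp_of_mem ⟨le_rfl, h0⟩]
  exact congrFun h6 k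

end WeakIdentity

section TwoSided

open Real MeasureTheory Set Filter Topology
open MvPolynomial (X C pderiv)

/-- The nonlinearity as a differential polynomial. -/
noncomputable def nlPoly {j0 : ℕ} (lam : Fin j0 → ℝ) (a b c d : Fin j0 → ℕ) : MvPolynomial ℕ ℝ :=
  ∑ j, C (lam j) * X 3 ^ a j * X 2 ^ b j * X 1 ^ c j * X 0 ^ d j

section nlPoly

variable {j0 : ℕ} (lam : Fin j0 → ℝ) (a b c d : Fin j0 → ℕ)

lemma nlPoly_mem : nlPoly lam a b c d ∈ ordLE 3 := by
  have hX : ∀ i ≤ 3, ∀ n, (X i ^ n : MvPolynomial ℕ ℝ) ∈ ordLE 3 := fun i hi n =>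
    Subalgebra.pow_mem _ (X_mem_ordLE hi) n
  refine Subalgebra.sum_mem _ fun j _ => ?_
  exact mul_mem (mul_mem (mul_mem (mul_mem (Subalgebra.algebraMap_mem _ (lam j))
    (hX 3 le_rfl _)) (hX 2 (by norm_num) _)) (hX 1 (by norm_num) _)) (hX 0 (by norm_num) _)

lemma ev_nlPoly (f : ℝ → ℝ) (x : ℝ) : ev (nlPoly lam a b c d) f x = Nfun j0 lam a b c d f x := by
  rw [nlPoly, ev_sum, Nfun]
  refine Finset.sum_congr rfl fun j _ => ?_
  simp only [ev, map_mul, map_pow, MvPolynomial.eval_X, MvPolynomial.eval_C, dx_zero, dx_one]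
  rfl

lemma ev_pderiv_nlPoly (f : ℝ → ℝ) (x : ℝ) : ev (pderiv 2 (nlPoly lam a b c d)) f x =
    ∑ j, lam j * b j * (dx 3 f x ^ a j * dx 2 f x ^ (b j - 1) * dx 1 f x ^ c j * f x ^ d j) := by
  rw [nlPoly, map_sum, ev_sum]
  refine Finset.sum_congr rfl fun j _ => ?_
  have h : ∀ i ≠ 2, ∀ n, pderiv 2 (X i ^ n : MvPolynomial ℕ ℝ) = 0 := fun i hi n => by
    rw [MvPolynomial.pderiv_pow, MvPolynomial.pderiv_X_of_ne hi, mul_zero]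
  simp only [MvPolynomial.pderiv_mul, h 3 (by norm_num), h 1 (by norm_num), h 0 (by norm_num),
    MvPolynomial.pderiv_C, MvPolynomial.pderiv_pow, MvPolynomial.pderiv_X_self, ev, map_mul,
    map_add, map_pow, map_natCast, map_one, map_zero, MvPolynomial.eval_X, MvPolynomial.eval_C,
    dx_zero]
  ring

lemma nonParabolic_nlPoly (h : ∀ f : ℝ → ℝ, ContDiff ℝ (⊤ : ℕ∞) f →
    Function.Periodic f (2 * π) → PN j0 lam a b c d f = 0) :
    NonParabolic (nlPoly lam a b c d) := by
  refine ⟨nlPoly_mem lam a b c d, fun f hf => ?_⟩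
  have h0 := h f hf.1 hf.2
  have e : per (ev (pderiv 2 (nlPoly lam a b c d)) f) = 2 * π * PN j0 lam a b c d f := by
    have e1 : ev (pderiv 2 (nlPoly lam a b c d)) f = fun x => ∑ j, lam j * b j *
        (dx 3 f x ^ a j * dx 2 f x ^ (b j - 1) * dx 1 f x ^ c j * f x ^ d j) :=
      funext fun x => ev_pderiv_nlPoly lam a b c d f x
    have hk : ∀ j ∈ (Finset.univ : Finset (Fin j0)), Continuous fun x => lam j * b j *
        (dx 3 f x ^ a j * dx 2 f x ^ (b j - 1) * dx 1 f x ^ c j * f x ^ d j) := fun j _ => by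
      have c3 := (hf.dx 3).continuous
      have c2 := (hf.dx 2).continuous
      have c1 := (hf.dx 1).continuous
      have c0 := hf.continuous
      fun_prop
    rw [e1, per_sum hk, PN, Finset.mul_sum]
    refine Finset.sum_congr rfl fun j _ => ?_
    rw [per_const_mul, per, dx_one]
    have := pi_ne_zero
    simp only [dx]
    field_simp
  rw [e, h0, mul_zero]

end nlPoly

lemma ev_neg (p : MvPolynomial ℕ ℝ) (f : ℝ → ℝ) (x : ℝ) : ev (-p) f x = -ev p f x := map_neg _ _

/-- The equation satisfied by the time reversal. -/
noncomputable def Eqn.reverse (P : Eqn) : Eqn where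
  γ0 := -P.γ0
  γ1 := -P.γ1
  γ2 := -P.γ2
  N := -P.N
  ne_zero := neg_ne_zero.2 P.ne_zero
  nonpar := by
    refine ⟨neg_mem P.nonpar.1, fun f hf => ?_⟩
    have e : ev (pderiv 2 (-P.N)) f = fun x => -1 * ev (pderiv 2 P.N) f x := by
      funext x
      rw [map_neg, ev_neg]
      ring
    rw [e, per_const_mul, P.nonpar.2 f hf, mul_zero]

lemma TestFn.comp_neg {ψ : ℝ → ℝ → ℝ} (hψ : TestFn ψ) : TestFn fun t => ψ (-t) :=
  ⟨hψ.smooth.comp (contDiff_fst.neg.prodMk contDiff_snd), fun t => hψ.periodic (-t)⟩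

lemma dt_comp_neg (ψ : ℝ → ℝ → ℝ) (t x : ℝ) : dt (fun t => ψ (-t)) t x = -dt ψ (-t) x :=
  _root_.deriv_comp_neg (fun τ => ψ τ x) t

lemma weak_reverse (P : Eqn) (f : ℝ → ℝ) (ψ : ℝ → ℝ → ℝ) (t x : ℝ) :
    weak P.reverse f (fun t => ψ (-t)) (-t) x = -weak P f ψ t x := by
  simp only [weak, adj, dt_comp_neg, Eqn.reverse, ev_neg, neg_neg]
  ring

/-- A solution on both sides of the initial time. -/
noncomputable def glue (v w : ℝ → ℝ → ℝ) (t : ℝ) : ℝ → ℝ := if 0 ≤ t then v t else w (-t)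

lemma glue_of_nonneg (v w : ℝ → ℝ → ℝ) {t : ℝ} (ht : 0 ≤ t) : glue v w t = v t := if_pos ht

lemma glue_of_nonpos {v w : ℝ → ℝ → ℝ} (h : v 0 = w 0) {t : ℝ} (ht : t ≤ 0) :
    glue v w t = w (-t) := by
  rcases ht.lt_or_eq with h1 | rfl
  · exact if_neg h1.not_ge
  · rw [glue_of_nonneg v w le_rfl, neg_zero, h]

variable {P : Eqn} {T : ℝ} {s : ℕ} (G : GalLimit P T s) (H : GalLimit P.reverse T s)

lemma contInHs_glue (h : G.sol 0 = H.sol 0) (A : Set ℝ) : ContInHs s A (glue G.sol H.sol) := by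
  intro t₀ _ e he
  obtain ⟨δ₁, hδ₁, h1⟩ : ∃ δ > 0, ∀ t, |t - t₀| < δ → 0 ≤ t →
      hsNorm s (fun x => glue G.sol H.sol t x - glue G.sol H.sol t₀ x) < e := by
    rcases lt_or_ge t₀ 0 with h0 | h0
    · exact ⟨-t₀, by linarith, fun t ht h2 => absurd (lt_of_abs_lt ht) (by linarith)⟩
    · obtain ⟨δ, hδ, hd⟩ := G.continuous_hsNorm t₀ he
      refine ⟨δ, hδ, fun t ht h2 => ?_⟩
      rw [glue_of_nonneg _ _ h0, glue_of_nonneg _ _ h2]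
      exact hd t ht
  obtain ⟨δ₂, hδ₂, h2⟩ : ∃ δ > 0, ∀ t, |t - t₀| < δ → t ≤ 0 →
      hsNorm s (fun x => glue G.sol H.sol t x - glue G.sol H.sol t₀ x) < e := by
    rcases lt_or_ge 0 t₀ with h0 | h0
    · refine ⟨t₀, h0, fun t ht h2 => absurd (neg_lt_of_abs_lt ht) (by linarith)⟩
    · obtain ⟨δ, hδ, hd⟩ := H.continuous_hsNorm (-t₀) he
      refine ⟨δ, hδ, fun t ht h2 => ?_⟩
      rw [glue_of_nonpos h h0, glue_of_nonpos h h2]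
      exact hd (-t) (by rwa [← abs_neg, show -(-t - -t₀) = t - t₀ by ring])
  refine ⟨min δ₁ δ₂, lt_min hδ₁ hδ₂, fun t _ ht => ?_⟩
  rcases le_total 0 t with h0 | h0
  · exact h1 t (ht.trans_le (min_le_left _ _)) h0
  · exact h2 t (ht.trans_le (min_le_right _ _)) h0

lemma integral_weak_glue (h : G.sol 0 = H.sol 0) {ψ : ℝ → ℝ → ℝ} (hψ : TestFn ψ)
    (h0 : ∀ t ∉ Ioo (-T) T, ∀ x, ψ t x = 0) :
    ∫ t in (-T)..T, per (weak P (glue G.sol H.sol t) ψ t) = 0 := by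
  have hT := G.T_nonneg
  have c1 := G.continuous_per_weak hψ
  have c2 := H.continuous_per_weak hψ.comp_neg
  have e1 : EqOn (fun t => per (weak P (glue G.sol H.sol t) ψ t))
      (fun t => per (weak P (G.sol t) ψ t)) (uIcc 0 T) := fun t ht => by
    rw [uIcc_of_le hT] at ht
    simp only [glue_of_nonneg G.sol H.sol ht.1]
  have e2 : EqOn (fun t => per (weak P (glue G.sol H.sol t) ψ t))
      (fun t => -per (weak P.reverse (H.sol (-t)) (fun t => ψ (-t)) (-t))) (uIcc (-T) 0) :=
    fun t ht => by
      rw [uIcc_of_le (by linarith)] at ht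
      have e : weak P.reverse (H.sol (-t)) (fun t => ψ (-t)) (-t) =
          fun x => -1 * weak P (H.sol (-t)) ψ t x := by
        funext x
        rw [weak_reverse]
        ring
      simp only [glue_of_nonpos h ht.2]
      rw [e, per_const_mul, neg_one_mul, neg_neg]
  have z : per (fun _ => (0:ℝ)) = 0 := by simp [per]
  have zT : (fun x => G.sol T x * ψ T x) = fun _ => 0 := by
    funext x; rw [h0 T (by simp), mul_zero]
  have zT' : (fun x => H.sol T x * ψ (-T) x) = fun _ => 0 := by
    funext x; rw [h0 (-T) (by simp), mul_zero]
  have w1 := G.weak_identity hψ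
  have w2 := H.weak_identity hψ.comp_neg
  simp only [zT, zT', z, neg_zero] at w1 w2
  have c3 : Continuous fun t => -per (weak P.reverse (H.sol (-t)) (fun t => ψ (-t)) (-t)) :=
    (c2.comp continuous_neg).neg
  have i1 : IntervalIntegrable (fun t => per (weak P (glue G.sol H.sol t) ψ t)) volume 0 T :=
    (c1.intervalIntegrable 0 T).congr (e1.symm.mono uIoc_subset_uIcc)
  have i2 : IntervalIntegrable (fun t => per (weak P (glue G.sol H.sol t) ψ t)) volume (-T) 0 :=
    (c3.intervalIntegrable (-T) 0).congr (e2.symm.mono uIoc_subset_uIcc)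
  rw [← intervalIntegral.integral_add_adjacent_intervals i2 i1,
    intervalIntegral.integral_congr e1, intervalIntegral.integral_congr e2, w1,
    intervalIntegral.integral_neg,
    intervalIntegral.integral_comp_neg
      (fun t => per (weak P.reverse (H.sol t) (fun t => ψ (-t)) t)), neg_zero, neg_neg, w2, h]
  ring

theorem exists_two_sided (P : Eqn) (r : ℝ) : ∃ T, 0 < T ∧ ∀ s, 13 ≤ s → ∀ φ, MemHs s φ →
    hsNorm 12 φ ≤ r → ∀ T', 0 ≤ T' → T' ≤ T → ∃ u : ℝ → ℝ → ℝ, u 0 = φ ∧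
      (∀ t, ContDiff ℝ 3 (u t) ∧ MemHs s (u t)) ∧ (∀ A, ContInHs s A u) ∧
      ∀ ψ, TestFn ψ → (∀ t ∉ Ioo (-T') T', ∀ x, ψ t x = 0) →
        ∫ t in (-T')..T', per (weak P (u t) ψ t) = 0 := by
  obtain ⟨T₁, hT₁, -, h1⟩ := exists_galLimit P r
  obtain ⟨T₂, hT₂, -, h2⟩ := exists_galLimit P.reverse r
  refine ⟨min T₁ T₂, lt_min hT₁ hT₂, fun s hs φ hφ hr T' h0 hT' => ?_⟩
  obtain ⟨G, hG⟩ := h1 s hs φ hφ hr T' h0 (hT'.trans (min_le_left _ _))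
  obtain ⟨H, hH⟩ := h2 s hs φ hφ hr T' h0 (hT'.trans (min_le_right _ _))
  have h : G.sol 0 = H.sol 0 := hG.trans hH.symm
  refine ⟨glue G.sol H.sol, (glue_of_nonneg _ _ le_rfl).trans hG, fun t => ?_,
    contInHs_glue G H h, fun ψ hψ hz => integral_weak_glue G H h hψ hz⟩
  rw [glue]
  split_ifs
  · exact ⟨G.contDiff_sol _, G.memHs_sol _⟩
  · exact ⟨H.contDiff_sol _, H.memHs_sol _⟩

/-- Some positive nonincreasing function on the line is bounded at every `r` by the value of a
given positive sequence at `⌈r⌉₊`. -/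
lemma exists_antitone_pos (τ : ℕ → ℝ) (hτ : ∀ n, 0 < τ n) : ∃ f : ℝ → ℝ, (∀ r, 0 < f r) ∧
    (∀ r₁ r₂, r₁ ≤ r₂ → f r₂ ≤ f r₁) ∧ ∀ r, f r ≤ τ ⌈r⌉₊ := by
  have ne : ∀ n, (Finset.range (n + 1)).Nonempty := fun n => Finset.nonempty_range_add_one
  refine ⟨fun r => (Finset.range (⌈r⌉₊ + 1)).inf' (ne _) τ, fun r => ?_, fun r₁ r₂ h => ?_,
    fun r => Finset.inf'_le _ (Finset.self_mem_range_succ _)⟩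
  · exact (Finset.lt_inf'_iff _).2 fun n _ => hτ n
  · refine Finset.inf'_mono τ (Finset.range_subset_range.2 ?_) (ne _)
    have := Nat.ceil_mono h
    omega

end TwoSided

/-- **Local well-posedness (existence) for non-parabolic resonance type.**
If `P_N(f) = 0` for every smooth `2π`-periodic `f`, and `s ≥ 13`, then there is a
time `T > 0` depending only (nonincreasingly) on `‖φ‖_{H^{12}}` such that for every real-valued
`φ ∈ H^s(𝕋)` there is a solution `u ∈ C([-T,T]; H^s(𝕋))` with `u(0) = φ`. -/
theorem lwp_nonparabolic_existence
    (γ0 γ1 γ2 : ℝ) (hγ0 : γ0 ≠ 0)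
    (j0 : ℕ) (lam : Fin j0 → ℝ) (a b c d : Fin j0 → ℕ)
    (hp : ∀ j : Fin j0, 2 ≤ a j + b j + c j + d j)
    (hPN : ∀ f : ℝ → ℝ, ContDiff ℝ (⊤ : ℕ∞) f → Function.Periodic f (2 * Real.pi) →
      PN j0 lam a b c d f = 0)
    (s : ℕ) (hs : 13 ≤ s) :
    ∃ Tf : ℝ → ℝ, (∀ r : ℝ, 0 < Tf r) ∧ (∀ r₁ r₂ : ℝ, r₁ ≤ r₂ → Tf r₂ ≤ Tf r₁) ∧
      ∀ φ : ℝ → ℝ, MemHs s φ →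
        ∃ u : ℝ → ℝ → ℝ,
          u 0 = φ ∧
          IsSolution γ0 γ1 γ2 j0 lam a b c d (-(Tf (hsNorm 12 φ))) (Tf (hsNorm 12 φ)) u ∧
          (∀ t ∈ Set.Icc (-(Tf (hsNorm 12 φ))) (Tf (hsNorm 12 φ)), MemHs s (u t)) ∧
          ContInHs s (Set.Icc (-(Tf (hsNorm 12 φ))) (Tf (hsNorm 12 φ))) u := by
  let P : Eqn := ⟨γ0, γ1, γ2, nlPoly lam a b c d, hγ0, nonParabolic_nlPoly lam a b c d hPN⟩
  choose τ hτ h using fun n : ℕ => exists_two_sided P n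
  obtain ⟨Tf, hpos, hanti, hle⟩ := exists_antitone_pos τ hτ
  refine ⟨Tf, hpos, hanti, fun φ hφ => ?_⟩
  obtain ⟨u, h0, hmem, hcont, hweak⟩ := h _ s hs φ hφ (Nat.le_ceil _) _ (hpos _).le (hle _)
  refine ⟨u, h0, ⟨fun t _ => ⟨(hmem t).1, (hmem t).2.2.1⟩, fun ψ hψ hper hz => ?_⟩,
    fun t _ => (hmem t).2, hcont _⟩
  refine Eq.trans ?_ (hweak ψ ⟨hψ, hper⟩ hz)
  simp only [per, weak, adj, ← ev_nlPoly, dx_one]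
  rfl

end FifthOrderStmt0
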